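/- There exists a constant C > 0 such that the following holds: for every spherical profile (μ, k) with k ≥ 1 and μ_1 ≤ 1, any two square-tiled surfaces with profile (μ, k) can be connected by a sequence of at most C·k powers of cylinder shears (up to isomorphism). -/

import Mathlib

/-! Common definitions: square-tiled surfaces as triples of involutions,
cylinder shears, profiles, etc. -/

inductive Color : Type
  | R | G | B
  deriving DecidableEq

/-- A candidate square-tiled surface on `Fin n`: a triple of permutations
indexed by the three colours. -/
abbrev Surf (n : ℕ) := Color → Equiv.Perm (Fin n)

/-- `f` is a square-tiled surface on `{1,…,n}` (`n ≥ 1`): the three permutations are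
involutions and the subgroup they generate acts transitively. -/
def IsSTS (n : ℕ) (f : Surf n) : Prop :=
  1 ≤ n ∧ (∀ X, f X * f X = 1) ∧
    ∀ x y : Fin n,
      ∃ p ∈ Subgroup.closure ({f Color.R, f Color.G, f Color.B} : Set (Equiv.Perm (Fin n))),
        p x = y

/-- Number of fixed points of a permutation of `Fin n`. -/
def fixedCount {n : ℕ} (π : Equiv.Perm (Fin n)) : ℕ :=
  (Finset.univ.filter fun x => π x = x).card

/-- Number of cycles of length `i` of `π`, fixed points counted as cycles of length 1. -/
def cycleCount {n : ℕ} (π : Equiv.Perm (Fin n)) (i : ℕ) : ℕ :=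
  if i = 1 then fixedCount π else Multiset.count i π.cycleType

/-- The product `τ_R · τ_G · τ_B`. -/
def prodRGB {n : ℕ} (f : Surf n) : Equiv.Perm (Fin n) :=
  f Color.R * f Color.G * f Color.B

/-- Total number of fixed points of the three permutations. -/
def totalFixed {n : ℕ} (f : Surf n) : ℕ :=
  fixedCount (f Color.R) + fixedCount (f Color.G) + fixedCount (f Color.B)

/-- `f` has profile `(μ, k)`: `μ i` is the number of cycles of length `i` of
`τ_R·τ_G·τ_B` (for `i ≥ 1`), and `k` is the total number of fixed points of the
three involutions. -/
def HasProfile {n : ℕ} (f : Surf n) (μ : ℕ → ℕ) (k : ℕ) : Prop :=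
  (∀ i, 1 ≤ i → cycleCount (prodRGB f) i = μ i) ∧ totalFixed f = k

open Classical in
/-- The permutation acting as `σ` on the (`σ`-invariant) set `c` and as the identity
outside of `c`. (Junk value `1` if `c` is not `σ`-invariant.) -/
noncomputable def restrictPerm {α : Type*} (σ : Equiv.Perm α) (c : Set α) : Equiv.Perm α :=
  if h : ∀ x, σ x ∈ c ↔ x ∈ c then
    { toFun := fun x => if x ∈ c then σ x else x
      invFun := fun x => if x ∈ c then σ.symm x else x
      left_inv := fun x => by
        by_cases hx : x ∈ c
        · simp [hx, (h x).mpr hx]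
        · simp [hx]
      right_inv := fun x => by
        by_cases hx : x ∈ c
        · have h1 : σ.symm x ∈ c := (h (σ.symm x)).mp (by simpa using hx)
          simp [hx, h1]
        · simp [hx] }
  else 1

/-- `c` is an `{i,j}`-component of `f`: an orbit of the subgroup generated by
`f i` and `f j`. -/
def IsComponent (n : ℕ) (f : Surf n) (i j : Color) (c : Set (Fin n)) : Prop :=
  ∃ x : Fin n,
    c = MulAction.orbit ↥(Subgroup.closure ({f i, f j} : Set (Equiv.Perm (Fin n)))) x

/-- The cylinder shear `Shear_{c,i,j}`: replace `f i` by `f i · c_i · c_j` and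
`f j` by `f j · c_i · c_j`, keeping the third permutation unchanged. -/
noncomputable def shear {n : ℕ} (f : Surf n) (i j : Color) (c : Set (Fin n)) : Surf n :=
  fun X =>
    if X = i ∨ X = j then f X * restrictPerm (f i) c * restrictPerm (f j) c else f X

/-- `m`-th power of the cylinder shear `Shear_{c,i,j}`. -/
noncomputable def shearPow {n : ℕ} (f : Surf n) (i j : Color) (c : Set (Fin n)) : ℕ → Surf n
  | 0 => f
  | m + 1 => shear (shearPow f i j c m) i j c

/-- The unordered pair `{i,j}` is `{R,G}` or `{G,B}`. -/
def GoodPair (i j : Color) : Prop :=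
  ({i, j} : Set Color) = {Color.R, Color.G} ∨ ({i, j} : Set Color) = {Color.G, Color.B}

/-- `A` (together with its complement) witnesses that `f` is Abelian. -/
def IsAbelianWitness (n : ℕ) (f : Surf n) (A : Set (Fin n)) : Prop :=
  A.Nonempty ∧ Aᶜ.Nonempty ∧ ∀ X : Color, (⇑(f X)) '' A = Aᶜ

/-- `f` is Abelian. -/
def IsAbelian (n : ℕ) (f : Surf n) : Prop :=
  ∃ A : Set (Fin n), IsAbelianWitness n f A

/-- `f` is path-like: `f G` and `f B` alone generate a transitive subgroup and have
exactly two fixed points in total. -/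
def IsPathLike (n : ℕ) (f : Surf n) : Prop :=
  (∀ x y : Fin n,
      ∃ p ∈ Subgroup.closure ({f Color.G, f Color.B} : Set (Equiv.Perm (Fin n))),
        p x = y) ∧
    fixedCount (f Color.G) + fixedCount (f Color.B) = 2

/-- `f` and `f'` are isomorphic square-tiled surfaces. -/
def Isomorphic (n : ℕ) (f f' : Surf n) : Prop :=
  ∃ σ : Equiv.Perm (Fin n), ∀ X, f' X = σ * f X * σ⁻¹

/-- One power of a cylinder shear. -/
def ShearPowStep (n : ℕ) (f f' : Surf n) : Prop :=
  ∃ (i j : Color) (c : Set (Fin n)) (m : ℕ),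
    GoodPair i j ∧ IsComponent n f i j c ∧ 1 ≤ m ∧ f' = shearPow f i j c m

/-- A sequence of `L` powers of cylinder shears from `f` to `f'`. -/
def ShearPowSeq (n : ℕ) : ℕ → Surf n → Surf n → Prop
  | 0, f, f' => f = f'
  | L + 1, f, f' => ∃ g, ShearPowStep n f g ∧ ShearPowSeq n L g f'

/-- A single vertical (i.e. `{R,G}`) cylinder shear. -/
def VertStep (n : ℕ) (f f' : Surf n) : Prop :=
  ∃ (i j : Color) (c : Set (Fin n)),
    ({i, j} : Set Color) = {Color.R, Color.G} ∧ IsComponent n f i j c ∧ f' = shear f i j c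

/-- A power of a horizontal (i.e. `{G,B}`) cylinder shear. -/
def HorizPowStep (n : ℕ) (f f' : Surf n) : Prop :=
  ∃ (i j : Color) (c : Set (Fin n)) (m : ℕ),
    ({i, j} : Set Color) = {Color.G, Color.B} ∧ IsComponent n f i j c ∧ 1 ≤ m ∧
      f' = shearPow f i j c m

/-- A sequence of `L` operations, each a single vertical shear or a power of a
horizontal shear. -/
def MixedSeq (n : ℕ) : ℕ → Surf n → Surf n → Prop
  | 0, f, f' => f = f'
  | L + 1, f, f' => ∃ g, (VertStep n f g ∨ HorizPowStep n f g) ∧ MixedSeq n L g f'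

/-- Profile `([2^{μ2}, 4g-2], 0)` (as far as the partition is concerned;
`totalFixed = 0` gives `k = 0`). -/
def ProfileA (n g μ2 : ℕ) (f : Surf n) : Prop :=
  totalFixed f = 0 ∧ cycleCount (prodRGB f) 2 = μ2 ∧
    cycleCount (prodRGB f) (4 * g - 2) = 1 ∧
    ∀ i, 1 ≤ i → i ≠ 2 → i ≠ 4 * g - 2 → cycleCount (prodRGB f) i = 0

/-- Profile `([2^{μ2}, (2g)^2], 0)`. -/
def ProfileB (n g μ2 : ℕ) (f : Surf n) : Prop :=
  totalFixed f = 0 ∧ cycleCount (prodRGB f) 2 = μ2 ∧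
    cycleCount (prodRGB f) (2 * g) = 2 ∧
    ∀ i, 1 ≤ i → i ≠ 2 → i ≠ 2 * g → cycleCount (prodRGB f) i = 0

/-- `α` is an automorphism of `f`. -/
def IsAut {n : ℕ} (f : Surf n) (α : Equiv.Perm (Fin n)) : Prop :=
  ∀ X, α * f X = f X * α

/-- `q` is (a presentation of) the quotient of `f` by the order-2 automorphism `α`:
there is a surjection `p` whose fibers are exactly the `⟨α⟩`-orbits and which
intertwines the permutations. -/
def IsQuotientBy (n m : ℕ) (f : Surf n) (α : Equiv.Perm (Fin n)) (q : Surf m) : Prop :=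
  ∃ p : Fin n → Fin m, Function.Surjective p ∧
    (∀ x y : Fin n, p x = p y ↔ (y = x ∨ y = α x)) ∧
    ∀ X x, p (f X x) = q X (p x)

/-- `4g - 4` where `g` is the genus of `f`, i.e. `Σ_i μ_i (i-2) - k`. -/
noncomputable def genusFour {n : ℕ} (f : Surf n) : ℤ :=
  (∑ i ∈ Finset.Icc 1 n, (cycleCount (prodRGB f) i : ℤ) * ((i : ℤ) - 2)) - (totalFixed f : ℤ)

/-- `α` is a hyperelliptic involution of `f`: an order-2 automorphism whose quotient
is a square-tiled surface of genus 0. -/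
def IsHyperInvolution {n : ℕ} (f : Surf n) (α : Equiv.Perm (Fin n)) : Prop :=
  IsAut f α ∧ α * α = 1 ∧ α ≠ 1 ∧
    ∃ (m : ℕ) (q : Surf m), IsSTS m q ∧ IsQuotientBy n m f α q ∧ genusFour q = -4

/-- `α` sends every point lying on a cycle of length `2g` of `τ_R·τ_G·τ_B` to a
different cycle (hence exchanges the two cycles of length `2g`). -/
def ExchangesTwoCycles {n : ℕ} (f : Surf n) (α : Equiv.Perm (Fin n)) (g : ℕ) : Prop :=
  ∀ x : Fin n, ((prodRGB f).cycleOf x).support.card = 2 * g →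
    ¬ (prodRGB f).SameCycle x (α x)

/-- Membership in `ST^hyp_Ab([2^{μ2}, 4g-2])`. -/
def InSTHypA (n g μ2 : ℕ) (f : Surf n) : Prop :=
  IsSTS n f ∧ IsAbelian n f ∧ ProfileA n g μ2 f ∧ ∃ α, IsHyperInvolution f α

/-- Membership in `ST^hyp_Ab([2^{μ2}, (2g)^2])`. -/
def InSTHypB (n g μ2 : ℕ) (f : Surf n) : Prop :=
  IsSTS n f ∧ IsAbelian n f ∧ ProfileB n g μ2 f ∧
    ∃ α, IsHyperInvolution f α ∧ ExchangesTwoCycles f α g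

section ShearConnectivity
open Equiv Equiv.Perm Color

section Setoids
variable {α : Type*}

/-- The partition of `α` into the cycles of `σ`. -/
def oc (σ : Perm α) : Setoid α := SameCycle.setoid σ

theorem oc_apply (σ : Perm α) (x : α) : oc σ x (σ x) := ⟨1, by simp⟩

theorem oc_apply' (σ : Perm α) (x : α) : oc σ (σ x) x := (oc σ).symm' (oc_apply σ x)

theorem oc_iff {σ : Perm α} {x y : α} : oc σ x y ↔ σ.SameCycle x y := Iff.rfl

theorem oc_le {σ : Perm α} {s : Setoid α} : oc σ ≤ s ↔ ∀ x, s x (σ x) := by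
  constructor
  · intro h x
    exact h (oc_apply σ x)
  · intro h x y hxy
    obtain ⟨i, hi⟩ := hxy
    have key : ∀ (m : ℕ) (z : α), s z ((σ ^ m) z) := by
      intro m
      induction m with
      | zero => intro z; exact s.refl' z
      | succ m ih =>
        intro z
        rw [pow_succ', Perm.mul_apply]
        exact s.trans' (ih z) (h _)
    obtain ⟨m, rfl | rfl⟩ := i.eq_nat_or_neg
    · rw [← hi]; exact key m x
    · have : x = (σ ^ m) y := by
        rw [← hi]; simp
      rw [this]
      exact s.symm' (key m y)

theorem oc_mul_le (σ τ : Perm α) : oc (σ * τ) ≤ oc σ ⊔ oc τ := by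
  rw [oc_le]
  intro x
  exact Setoid.trans' _ ((le_sup_right : oc τ ≤ oc σ ⊔ oc τ) (oc_apply τ x))
    ((le_sup_left : oc σ ≤ oc σ ⊔ oc τ) (oc_apply σ (τ x)))

theorem oc_inv (σ : Perm α) : oc σ⁻¹ = oc σ := by
  ext x y; exact sameCycle_inv

theorem oc_pow_le (σ : Perm α) (m : ℕ) : oc (σ ^ m) ≤ oc σ := by
  rw [oc_le]; intro x; exact ⟨m, by simp⟩

theorem oc_one_le (s : Setoid α) : oc (1 : Perm α) ≤ s := by
  rw [oc_le]; intro x; exact s.refl' x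

theorem sup_oc_one (s : Setoid α) : s ⊔ oc (1 : Perm α) = s := by
  rw [sup_eq_left]; exact oc_one_le s

variable [DecidableEq α]

theorem oc_swap_le {a b : α} {s : Setoid α} : oc (swap a b) ≤ s ↔ s a b := by
  rw [oc_le]
  constructor
  · intro h
    simpa using h a
  · intro h x
    by_cases hxa : x = a
    · subst hxa; simpa using h
    by_cases hxb : x = b
    · subst hxb; simpa using s.symm' h
    rw [swap_apply_of_ne_of_ne hxa hxb]

/-- `r` with the classes of `a` and `b` merged. -/
def joinS (r : Setoid α) (a b : α) : Setoid α := r ⊔ oc (swap a b)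

theorem joinS_le {r s : Setoid α} {a b : α} : joinS r a b ≤ s ↔ r ≤ s ∧ s a b := by
  rw [joinS, sup_le_iff, oc_swap_le]

theorem le_joinS (r : Setoid α) (a b : α) : r ≤ joinS r a b := le_sup_left

theorem joinS_rel (r : Setoid α) (a b : α) : joinS r a b a b := (joinS_le.1 le_rfl).2

theorem joinS_apply {r : Setoid α} {a b x y : α} :
    joinS r a b x y ↔ r x y ∨ (r x a ∧ r b y) ∨ (r x b ∧ r a y) := by
  constructor
  · let t : Setoid α :=
      { r := fun x y => r x y ∨ (r x a ∧ r b y) ∨ (r x b ∧ r a y)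
        iseqv :=
          { refl := fun x => Or.inl (r.refl' x)
            symm := by
              rintro x y (h | ⟨h, h'⟩ | ⟨h, h'⟩)
              · exact Or.inl (r.symm' h)
              · exact Or.inr (Or.inr ⟨r.symm' h', r.symm' h⟩)
              · exact Or.inr (Or.inl ⟨r.symm' h', r.symm' h⟩)
            trans := by
              rintro x y z (h | ⟨h, h'⟩ | ⟨h, h'⟩) (g | ⟨g, g'⟩ | ⟨g, g'⟩)
              · exact Or.inl (r.trans' h g)
              · exact Or.inr (Or.inl ⟨r.trans' h g, g'⟩)
              · exact Or.inr (Or.inr ⟨r.trans' h g, g'⟩)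
              · exact Or.inr (Or.inl ⟨h, r.trans' h' g⟩)
              · exact Or.inr (Or.inl ⟨h, g'⟩)
              · exact Or.inl (r.trans' h g')
              · exact Or.inr (Or.inr ⟨h, r.trans' h' g⟩)
              · exact Or.inl (r.trans' h g')
              · exact Or.inr (Or.inr ⟨h, g'⟩) } }
    have : joinS r a b ≤ t := by
      rw [joinS_le]
      exact ⟨fun {x y} h => Or.inl h, Or.inr (Or.inl ⟨r.refl' a, r.refl' b⟩)⟩
    exact fun h => this h
  · have h0 := joinS_rel r a b
    have h1 := le_joinS r a b
    rintro (h | ⟨h, h'⟩ | ⟨h, h'⟩)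
    · exact h1 h
    · exact Setoid.trans' _ (h1 h) (Setoid.trans' _ h0 (h1 h'))
    · exact Setoid.trans' _ (h1 h) (Setoid.trans' _ (Setoid.symm' _ h0) (h1 h'))

theorem joinS_of_rel {r : Setoid α} {a b : α} (h : r a b) : joinS r a b = r :=
  le_antisymm (joinS_le.2 ⟨le_rfl, h⟩) (le_joinS r a b)

theorem joinS_swap_mul (σ : Perm α) (a b : α) :
    joinS (oc (swap a b * σ)) a b = joinS (oc σ) a b := by
  apply le_antisymm
  · rw [joinS_le]
    refine ⟨(oc_mul_le _ _).trans ?_, joinS_rel _ _ _⟩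
    rw [joinS, sup_comm]
  · rw [joinS_le]
    refine ⟨?_, joinS_rel _ _ _⟩
    have h := oc_mul_le (swap a b) (swap a b * σ)
    rw [← mul_assoc, swap_mul_self, one_mul] at h
    rw [joinS, sup_comm]
    exact h

/-- Number of classes. -/
noncomputable def nc (r : Setoid α) : ℕ := Nat.card (Quotient r)

omit [DecidableEq α] in
theorem nc_eq_one_iff [Finite α] [Nonempty α] {r : Setoid α} : nc r = 1 ↔ r = ⊤ := by
  rw [nc, Nat.card_eq_one_iff_unique, Setoid.eq_top_iff]
  constructor
  · rintro ⟨h, -⟩ x y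
    exact Quotient.exact (h.elim (Quotient.mk r x) (Quotient.mk r y))
  · intro h
    refine ⟨⟨fun p q => ?_⟩, ⟨Quotient.mk r (Classical.arbitrary α)⟩⟩
    induction p using Quotient.inductionOn with | _ x
    induction q using Quotient.inductionOn with | _ y
    exact Quotient.sound (h x y)

omit [DecidableEq α] in
theorem nc_pos [Finite α] [Nonempty α] (r : Setoid α) : 1 ≤ nc r := by
  have : Nonempty (Quotient r) := ⟨Quotient.mk r (Classical.arbitrary α)⟩
  exact Nat.card_pos

theorem nc_joinS [Finite α] {r : Setoid α} {a b : α} (h : ¬ r a b) :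
    nc (joinS r a b) + 1 = nc r := by
  classical
  have : Fintype (Quotient r) := Fintype.ofFinite _
  have e : {q : Quotient r // q ≠ Quotient.mk r b} ≃ Quotient (joinS r a b) := by
    refine Equiv.ofBijective (fun q => Quotient.map' id (le_joinS r a b) q.1) ⟨?_, ?_⟩
    · rintro ⟨p, hp⟩ ⟨q, hq⟩ hpq
      induction p using Quotient.inductionOn with | _ x
      induction q using Quotient.inductionOn with | _ y
      have h1 : joinS r a b x y := Quotient.exact hpq
      have hx : ¬ r x b := fun h => hp (Quotient.sound h)
      have hy : ¬ r y b := fun h => hq (Quotient.sound h)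
      rcases joinS_apply.1 h1 with h1 | ⟨h1, h2⟩ | ⟨h1, h2⟩
      · exact Subtype.ext (Quotient.sound h1)
      · exact absurd (r.symm' h2) hy
      · exact absurd h1 hx
    · intro q
      induction q using Quotient.inductionOn with | _ x
      by_cases hx : r x b
      · refine ⟨⟨Quotient.mk r a, fun h' => h (Quotient.exact h')⟩, ?_⟩
        exact Quotient.sound (joinS_apply.2 (Or.inr (Or.inl ⟨r.refl' a, r.symm' hx⟩)))
      · exact ⟨⟨Quotient.mk r x, fun h' => hx (Quotient.exact h')⟩, rfl⟩
  rw [nc, nc, ← Nat.card_congr e, Nat.card_eq_fintype_card, Nat.card_eq_fintype_card,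
    Fintype.card_subtype_compl, Fintype.card_subtype_eq]
  have : 0 < Fintype.card (Quotient r) := Fintype.card_pos_iff.2 ⟨Quotient.mk r b⟩
  omega

theorem nc_le_joinS [Finite α] (r : Setoid α) (a b : α) : nc r ≤ nc (joinS r a b) + 1 := by
  by_cases h : r a b
  · rw [joinS_of_rel h]; omega
  · rw [nc_joinS h]

/-- Two points in different cycles get merged by a transposition. -/
theorem oc_swap_mul_of_not [Finite α] {σ : Perm α} {a b : α} (h : ¬ oc σ a b) :
    oc (swap a b * σ) a b := by
  by_cases hab : a = b
  · subst hab; exact Setoid.refl' _ _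
  classical
  -- iterate from a until the return
  have hex : ∃ m, 0 < m ∧ (σ ^ m) a = a := by
    obtain ⟨m, hm, h'⟩ := (isOfFinOrder_of_finite σ).exists_pow_eq_one
    exact ⟨m, hm, by rw [h']; rfl⟩
  set m := Nat.find hex with hm
  obtain ⟨hm0, hma⟩ := Nat.find_spec hex
  have hmin : ∀ j, 0 < j → j < m → (σ ^ j) a ≠ a := fun j h1 h2 h3 =>
    Nat.find_min hex h2 ⟨h1, h3⟩
  have key : ∀ j, j < m → ((swap a b * σ) ^ j) a = (σ ^ j) a := by
    intro j
    induction j with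
    | zero => intro; rfl
    | succ j ih =>
      intro hj
      rw [pow_succ', Perm.mul_apply, ih (by omega), Perm.mul_apply,
        ← Perm.mul_apply σ, ← pow_succ']
      apply swap_apply_of_ne_of_ne
      · exact hmin _ (by omega) hj
      · intro h'
        exact h ⟨(j + 1 : ℕ), by rw [zpow_natCast]; exact h'⟩
  refine ⟨m, ?_⟩
  obtain ⟨j, hj⟩ : ∃ j, m = j + 1 := ⟨m - 1, by omega⟩
  rw [zpow_natCast, hj, pow_succ', Perm.mul_apply, key j (by omega), Perm.mul_apply,
    ← Perm.mul_apply σ, ← pow_succ', ← hj, hma, swap_apply_left]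

/-- Two points in the same cycle get separated by a transposition. -/
theorem not_oc_swap_mul [Finite α] {σ : Perm α} {a b : α} (hab : a ≠ b) (h : oc σ a b) :
    ¬ oc (swap a b * σ) a b := by
  classical
  have hex : ∃ m : ℕ, (σ ^ m) a = b := by
    obtain ⟨m, hm⟩ := SameCycle.exists_nat_pow_eq h
    exact ⟨m, hm⟩
  set m := Nat.find hex with hm
  have hmb : (σ ^ m) a = b := Nat.find_spec hex
  have hmin : ∀ j, j < m → (σ ^ j) a ≠ b := fun j h2 h3 => Nat.find_min hex h2 h3
  have hm0 : 0 < m := by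
    rcases Nat.eq_zero_or_pos m with h0 | h0
    · rw [h0] at hmb; exact absurd hmb hab
    · exact h0
  have key : ∀ j, ∃ i < m, ((swap a b * σ) ^ j) a = (σ ^ i) a := by
    intro j
    induction j with
    | zero => exact ⟨0, hm0, rfl⟩
    | succ j ih =>
      obtain ⟨i, hi, h1⟩ := ih
      rw [pow_succ', Perm.mul_apply, h1, Perm.mul_apply, ← Perm.mul_apply σ, ← pow_succ']
      by_cases hi' : i + 1 = m
      · exact ⟨0, hm0, by rw [hi', hmb, swap_apply_right]; rfl⟩
      by_cases h2 : (σ ^ (i + 1)) a = a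
      · exfalso
        -- period i+1 < m contradicts minimality
        have h3 : ∀ q, (σ ^ ((i + 1) * q)) a = a := by
          intro q
          induction q with
          | zero => rfl
          | succ q ih => rw [mul_add, pow_add, Perm.mul_apply, mul_one, h2, ih]
        have h4 : (σ ^ (m % (i + 1))) a = b := by
          conv_rhs => rw [← hmb, ← Nat.mod_add_div m (i + 1), pow_add, Perm.mul_apply, h3]
        have := Nat.mod_lt m (show 0 < i + 1 by omega)
        exact hmin _ (by omega) h4
      · refine ⟨i + 1, by omega, ?_⟩
        exact swap_apply_of_ne_of_ne h2 (hmin _ (by omega))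
  intro hc
  obtain ⟨j, hj⟩ := SameCycle.exists_nat_pow_eq hc
  obtain ⟨i, hi, h1⟩ := key j
  exact hmin i hi (h1 ▸ hj)

theorem nc_swap_mul_of_not [Finite α] {σ : Perm α} {a b : α} (h : ¬ oc σ a b) :
    nc (oc (swap a b * σ)) + 1 = nc (oc σ) := by
  rw [← nc_joinS h, ← joinS_swap_mul, joinS_of_rel (oc_swap_mul_of_not h)]

theorem nc_swap_mul [Finite α] {σ : Perm α} {a b : α} (hab : a ≠ b) (h : oc σ a b) :
    nc (oc (swap a b * σ)) = nc (oc σ) + 1 := by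
  rw [← nc_joinS (not_oc_swap_mul hab h), joinS_swap_mul, joinS_of_rel h]

end Setoids

section Counting
variable {α : Type*}

theorem joinS_sup [DecidableEq α] (r s : Setoid α) (a b : α) :
    r ⊔ joinS s a b = joinS (r ⊔ s) a b := (sup_assoc _ _ _).symm

/-- Pairwise unrelated points give distinct classes. -/
theorem card_le_nc [Finite α] {r : Setoid α} (s : Finset α)
    (h : ∀ x ∈ s, ∀ y ∈ s, r x y → x = y) : s.card ≤ nc r := by
  have h1 : Nat.card s ≤ nc r := by
    refine Nat.card_le_card_of_injective (fun x : s => Quotient.mk r x.1) ?_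
    rintro ⟨x, hx⟩ ⟨y, hy⟩ hxy
    exact Subtype.ext (h x hx y hy (Quotient.exact hxy))
  simpa using h1

theorem nc_oc_one [Finite α] : nc (oc (1 : Perm α)) = Nat.card α := by
  refine (Nat.card_congr (Equiv.ofBijective (Quotient.mk _) ⟨?_, ?_⟩)).symm
  · intro x y h
    have := Quotient.exact h
    obtain ⟨i, hi⟩ := (this : oc (1 : Perm α) x y)
    simpa using hi
  · exact Quotient.mk_surjective

theorem nc_le_card [Finite α] (r : Setoid α) : nc r ≤ Nat.card α :=
  Nat.card_le_card_of_surjective _ Quotient.mk_surjective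

section
variable [Finite α]

/-- A Riemann–Hurwitz type inequality. -/
theorem riemann_hurwitz (π : Perm α) (r : Setoid α) (hr : oc π ≤ r) (τ : Perm α) :
    nc (oc (τ * π)) + nc (oc τ) + 2 * nc r ≤ nc (oc π) + Nat.card α + 2 * nc (r ⊔ oc τ) := by
  classical
  generalize hm : Nat.card α - nc (oc τ) = m
  induction m generalizing τ with
  | zero =>
    have hτ : τ = 1 := by
      by_contra hne
      obtain ⟨a, ha⟩ : ∃ a, τ a ≠ a := by
        by_contra! h
        exact hne (Equiv.ext h)
      have := nc_swap_mul (Ne.symm ha) (oc_apply τ a)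
      have := nc_le_card (oc (swap a (τ a) * τ))
      omega
    subst hτ
    rw [one_mul, nc_oc_one, sup_oc_one]
  | succ m ih =>
    obtain ⟨a, ha⟩ : ∃ a, τ a ≠ a := by
      by_contra! h
      have : τ = 1 := Equiv.ext h
      rw [this, nc_oc_one] at hm
      omega
    have h1 := nc_swap_mul (Ne.symm ha) (oc_apply τ a)
    have h2 := not_oc_swap_mul (Ne.symm ha) (oc_apply τ a)
    set b := τ a with hb
    set τ' := swap a b * τ with hτ'
    have hτ : τ = swap a b * τ' := by rw [hτ', ← mul_assoc, swap_mul_self, one_mul]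
    have h3 := ih τ' (by omega)
    set r' := r ⊔ oc τ' with hr'
    have h4 : oc (τ' * π) ≤ r' := (oc_mul_le _ _).trans (by
      rw [sup_comm]; exact sup_le_sup_right hr _)
    have h5 : r ⊔ oc τ = joinS r' a b := by
      rw [hr', ← joinS_sup, hτ', joinS_swap_mul, joinS_of_rel (oc_apply τ a)]
    have h6 : τ * π = swap a b * (τ' * π) := by rw [hτ, mul_assoc]
    have h7 : nc (oc (swap a b * (τ' * π))) + 2 * nc r' ≤
        nc (oc (τ' * π)) + 1 + 2 * nc (joinS r' a b) := by
      by_cases h : r' a b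
      · rw [joinS_of_rel h]
        by_cases h' : oc (τ' * π) a b
        · rw [nc_swap_mul (Ne.symm ha) h']
        · have := nc_swap_mul_of_not h'
          omega
      · have h' : ¬ oc (τ' * π) a b := fun h' => h (h4 h')
        have := nc_swap_mul_of_not h'
        have := nc_joinS h
        omega
    rw [h5, h6]
    omega

theorem nc_sup_oc (r : Setoid α) (τ : Perm α) :
    nc r + nc (oc τ) ≤ nc (r ⊔ oc τ) + Nat.card α := by
  classical
  generalize hm : Nat.card α - nc (oc τ) = m
  induction m generalizing τ with
  | zero =>
    have hle : nc (oc τ) ≤ Nat.card α := nc_le_card _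
    have hτ : τ = 1 := by
      by_contra hne
      obtain ⟨a, ha⟩ : ∃ a, τ a ≠ a := by
        by_contra! h
        exact hne (Equiv.ext h)
      have := nc_swap_mul (Ne.symm ha) (oc_apply τ a)
      have := nc_le_card (oc (swap a (τ a) * τ))
      omega
    subst hτ
    rw [nc_oc_one, sup_oc_one]
  | succ m ih =>
    obtain ⟨a, ha⟩ : ∃ a, τ a ≠ a := by
      by_contra! h
      have : τ = 1 := Equiv.ext h
      rw [this, nc_oc_one] at hm
      omega
    have h1 := nc_swap_mul (Ne.symm ha) (oc_apply τ a)
    have h3 := ih (swap a (τ a) * τ) (by omega)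
    have h5 : r ⊔ oc τ = joinS (r ⊔ oc (swap a (τ a) * τ)) a (τ a) := by
      rw [← joinS_sup, joinS_swap_mul, joinS_of_rel (oc_apply τ a)]
    have := nc_le_joinS (r ⊔ oc (swap a (τ a) * τ)) a (τ a)
    rw [h5]
    omega

end

variable [Fintype α]

open Classical in
/-- Size of a class. -/
noncomputable def sz (r : Setoid α) (x : α) : ℕ := (Finset.univ.filter fun y => r x y).card

theorem sz_congr {r : Setoid α} {x y : α} (h : r x y) : sz r x = sz r y := by
  classical
  unfold sz
  congr 1
  ext z
  simp only [Finset.mem_filter, Finset.mem_univ, true_and]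
  exact ⟨fun h' => r.trans' (r.symm' h) h', fun h' => r.trans' h h'⟩

theorem sz_pos (r : Setoid α) (x : α) : 0 < sz r x := by
  classical
  exact Finset.card_pos.2 ⟨x, by simp⟩

theorem nc_eq_sum (r : Setoid α) : (nc r : ℚ) = ∑ x : α, 1 / (sz r x : ℚ) := by
  classical
  have h1 : ∑ x : α, 1 / (sz r x : ℚ) =
      ∑ q : Quotient r, ∑ x ∈ Finset.univ.filter (fun x => Quotient.mk r x = q),
        1 / (sz r x : ℚ) := by
    rw [Finset.sum_fiberwise]
  rw [h1, nc, Nat.card_eq_fintype_card]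
  have h2 : ∀ q : Quotient r, ∑ x ∈ Finset.univ.filter (fun x => Quotient.mk r x = q),
        1 / (sz r x : ℚ) = 1 := by
    intro q
    induction q using Quotient.inductionOn with | _ y
    have h3 : Finset.univ.filter (fun x => Quotient.mk r x = Quotient.mk r y) =
        Finset.univ.filter fun x => r y x := by
      ext x
      simp only [Finset.mem_filter, Finset.mem_univ, true_and]
      exact ⟨fun h => r.symm' (Quotient.exact h), fun h => Quotient.sound (r.symm' h)⟩
    rw [h3, Finset.sum_congr rfl (g := fun _ => 1 / (sz r y : ℚ))]
    · rw [Finset.sum_const, nsmul_eq_mul]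
      have : (sz r y : ℚ) ≠ 0 := by exact_mod_cast (sz_pos r y).ne'
      have h4 : ((Finset.univ.filter fun x => r y x).card : ℚ) = sz r y := by
        rw [sz]
      rw [h4]
      field_simp
    · intro x hx
      rw [sz_congr (Finset.mem_filter.1 hx).2]
  rw [Finset.sum_congr rfl fun q _ => h2 q]
  simp

/-- Number of fixed points. -/
def fx [DecidableEq α] (σ : Perm α) : ℕ := (Finset.univ.filter fun x => σ x = x).card

omit [Fintype α] in
theorem oc_invol {σ : Perm α} (h : σ * σ = 1) {x y : α} : oc σ x y ↔ y = x ∨ y = σ x := by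
  constructor
  · rintro ⟨i, rfl⟩
    have h2 : σ ^ (2 : ℤ) = 1 := by rw [← h]; exact zpow_two σ
    rcases i.even_or_odd' with ⟨c, rfl | rfl⟩
    · left; rw [zpow_mul, h2, one_zpow]; rfl
    · right; rw [zpow_add, zpow_mul, h2, one_zpow, one_mul, zpow_one]
  · rintro (rfl | rfl)
    · exact Setoid.refl' _ _
    · exact oc_apply σ x

theorem nc_invol [DecidableEq α] {σ : Perm α} (h : σ * σ = 1) :
    2 * nc (oc σ) = Nat.card α + fx σ := by
  classical
  have h1 : ∀ x, 2 * (1 / (sz (oc σ) x : ℚ)) = 1 + if σ x = x then 1 else 0 := by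
    intro x
    by_cases hx : σ x = x
    · have : sz (oc σ) x = 1 := by
        rw [sz, Finset.card_eq_one]
        refine ⟨x, ?_⟩
        ext y
        simp [oc_invol h, hx]
      rw [this]; simp [hx]; norm_num
    · have : sz (oc σ) x = 2 := by
        rw [sz, Finset.card_eq_two]
        refine ⟨x, σ x, fun h => hx h.symm, ?_⟩
        ext y
        simp [oc_invol h]
      rw [this]; simp [hx]
  have h2 : (2 * nc (oc σ) : ℚ) = Nat.card α + fx σ := by
    rw [nc_eq_sum, Finset.mul_sum, Finset.sum_congr rfl fun x _ => h1 x, Finset.sum_add_distrib]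
    simp [fx]
  exact_mod_cast h2

end Counting

section Steps

theorem orbit_iff {α : Type*} (S : Set (Perm α)) (t : Setoid α)
    (h1 : ∀ σ ∈ S, oc σ ≤ t) (h2 : ∀ s : Setoid α, (∀ σ ∈ S, oc σ ≤ s) → t ≤ s) (x y : α) :
    (∃ p ∈ Subgroup.closure S, p x = y) ↔ t x y := by
  constructor
  · rintro ⟨p, hp, rfl⟩
    have : oc p ≤ t := by
      induction hp using Subgroup.closure_induction with
      | mem p hp => exact h1 p hp
      | one => exact oc_one_le t
      | mul p q _ _ hp hq => exact (oc_mul_le p q).trans (sup_le hp hq)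
      | inv p _ hp => rw [oc_inv]; exact hp
    exact this (oc_apply p x)
  · intro h
    let s : Setoid α :=
      { r := fun x y => ∃ p ∈ Subgroup.closure S, p x = y
        iseqv :=
          { refl := fun x => ⟨1, one_mem _, rfl⟩
            symm := by
              rintro x y ⟨p, hp, rfl⟩
              exact ⟨p⁻¹, inv_mem hp, by simp⟩
            trans := by
              rintro x y z ⟨p, hp, rfl⟩ ⟨q, hq, rfl⟩
              exact ⟨q * p, mul_mem hq hp, rfl⟩ } }
    have : t ≤ s := h2 s fun σ hσ => oc_le.2 fun x => ⟨σ, Subgroup.subset_closure hσ, rfl⟩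
    exact this h

theorem orbit_pair {α : Type*} (a b : Perm α) (x y : α) :
    (∃ p ∈ Subgroup.closure ({a, b} : Set (Perm α)), p x = y) ↔ (oc a ⊔ oc b) x y := by
  apply orbit_iff
  · rintro σ (rfl | rfl)
    · exact le_sup_left
    · exact le_sup_right
  · intro s hs
    exact sup_le (hs _ (by simp)) (hs _ (by simp))

theorem orbit_triple {α : Type*} (a b c : Perm α) (x y : α) :
    (∃ p ∈ Subgroup.closure ({a, b, c} : Set (Perm α)), p x = y) ↔
      (oc a ⊔ oc b ⊔ oc c) x y := by
  apply orbit_iff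
  · rintro σ (rfl | rfl | rfl)
    · exact le_sup_left.trans le_sup_left
    · exact le_sup_right.trans le_sup_left
    · exact le_sup_right
  · intro s hs
    exact sup_le (sup_le (hs _ (by simp)) (hs _ (by simp))) (hs _ (by simp))

theorem restrictPerm_apply {α : Type*} {σ : Perm α} {c : Set α} (h : ∀ x, σ x ∈ c ↔ x ∈ c)
    (x : α) [Decidable (x ∈ c)] : restrictPerm σ c x = if x ∈ c then σ x else x := by
  classical
  rw [restrictPerm, dif_pos h]
  simp

theorem restrictPerm_mem {α : Type*} {σ : Perm α} {c : Set α} (h : ∀ x, σ x ∈ c ↔ x ∈ c)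
    {x : α} (hx : x ∈ c) : restrictPerm σ c x = σ x := by
  classical
  rw [restrictPerm_apply h, if_pos hx]

theorem restrictPerm_not_mem {α : Type*} {σ : Perm α} {c : Set α} (h : ∀ x, σ x ∈ c ↔ x ∈ c)
    {x : α} (hx : x ∉ c) : restrictPerm σ c x = x := by
  classical
  rw [restrictPerm_apply h, if_neg hx]

variable {n : ℕ}

/-- Pointwise description of `shearPow`. -/
structure Sheared (f f' : Surf n) (i j : Color) (c : Set (Fin n)) (m : ℕ) : Prop where
  other : ∀ X, X ≠ i → X ≠ j → f' X = f X
  on : ∀ X, X = i ∨ X = j → ∀ y ∈ c, f' X y = f X (((f i * f j) ^ m) y)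
  off : ∀ X, ∀ y ∉ c, f' X y = f X y

/-- `c` is a union of components. -/
def Closed (f : Perm (Fin n)) (c : Set (Fin n)) : Prop := ∀ y, f y ∈ c ↔ y ∈ c

theorem Closed.pow {f : Perm (Fin n)} {c : Set (Fin n)} (h : Closed f c) (m : ℕ) :
    Closed (f ^ m) c := by
  induction m with
  | zero => intro y; rfl
  | succ m ih =>
    intro y
    rw [pow_succ', Perm.mul_apply, h, ih]

theorem Closed.mul {f g : Perm (Fin n)} {c : Set (Fin n)} (h : Closed f c) (h' : Closed g c) :
    Closed (f * g) c := fun y => by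
  rw [Perm.mul_apply, h, h']

theorem Sheared.unique {f f' f'' : Surf n} {i j : Color} {c : Set (Fin n)} {m : ℕ}
    (h : Sheared f f' i j c m) (h' : Sheared f f'' i j c m) : f' = f'' := by
  funext X
  by_cases hX : X = i ∨ X = j
  · ext y
    by_cases hy : y ∈ c
    · rw [h.on X hX y hy, h'.on X hX y hy]
    · rw [h.off X y hy, h'.off X y hy]
  · rw [not_or] at hX
    rw [h.other X hX.1 hX.2, h'.other X hX.1 hX.2]

theorem Sheared.zero (f : Surf n) (i j : Color) (c : Set (Fin n)) : Sheared f f i j c 0 :=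
  ⟨fun _ _ _ => rfl, fun _ _ _ _ => rfl, fun _ _ _ => rfl⟩

section
variable {f f' : Surf n} {i j : Color} {c : Set (Fin n)} {m : ℕ}

theorem invol_apply {α : Type*} {σ : Perm α} (h : σ * σ = 1) (x : α) : σ (σ x) = x := by
  rw [← Perm.mul_apply, h]; rfl

theorem flip_pow {α : Type*} {r c : Perm α} (hc : c * c = 1) (h : c * r * c = r⁻¹) (m : ℕ)
    (y : α) : c ((r ^ m) (c ((r ^ m) y))) = y := by
  have hc' : c⁻¹ = c := inv_eq_of_mul_eq_one_left hc
  have h1 : c * r ^ m * c = (r ^ m)⁻¹ := by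
    have := conj_pow (a := c) (b := r) (i := m)
    rw [hc', h, inv_pow] at this
    exact this.symm
  have h2 := congrArg (fun p : Perm α => p ((r ^ m) y)) h1
  simpa using h2

theorem dihedral_pow {α : Type*} {a b : Perm α} (ha : a * a = 1) (hb : b * b = 1) (m : ℕ) (y : α) :
    b (((a * b) ^ m) (b (((a * b) ^ m) y))) = y := by
  apply flip_pow hb
  rw [mul_inv_rev, inv_eq_of_mul_eq_one_left ha, inv_eq_of_mul_eq_one_left hb, mul_assoc,
    mul_assoc, hb, mul_one]

theorem dihedral_pow' {α : Type*} {a b : Perm α} (ha : a * a = 1) (hb : b * b = 1) (m : ℕ) (y : α) :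
    a (((a * b) ^ m) (a (((a * b) ^ m) y))) = y := by
  apply flip_pow ha
  rw [mul_inv_rev, inv_eq_of_mul_eq_one_left ha, inv_eq_of_mul_eq_one_left hb, ← mul_assoc,
    ha, one_mul]

theorem dihedral_pow_comm {α : Type*} {a b : Perm α} (ha : a * a = 1) (hb : b * b = 1) (m : ℕ)
    (y : α) : ((a * b) ^ m) (b (((a * b) ^ m) y)) = b y := by
  have h := dihedral_pow ha hb m y
  rw [← h, invol_apply hb, h]

theorem exists_inverse_power (f : Surf n) (i j : Color) (m : ℕ) :
    ∃ N, 1 ≤ N ∧ (f i * f j) ^ (m + N) = 1 := by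
  refine ⟨m * (orderOf (f i * f j) - 1) + orderOf (f i * f j), ?_, ?_⟩
  · have := orderOf_pos (f i * f j); omega
  have := orderOf_pos (f i * f j)
  obtain ⟨q, hq⟩ : ∃ q, orderOf (f i * f j) = q + 1 := ⟨orderOf (f i * f j) - 1, by omega⟩
  have : m + (m * (orderOf (f i * f j) - 1) + orderOf (f i * f j)) =
      orderOf (f i * f j) * (m + 1) := by
    rw [hq]; simp; ring
  rw [this, pow_mul, pow_orderOf_eq_one, one_pow]

variable (hf : ∀ X, f X * f X = 1) (h : Sheared f f' i j c m)
  (hi : Closed (f i) c) (hj : Closed (f j) c)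
include hf h hi hj

theorem Sheared.invol (X : Color) : f' X * f' X = 1 := by
  by_cases hX : X = i ∨ X = j
  · ext y
    rw [Perm.mul_apply, Perm.one_apply]
    by_cases hy : y ∈ c
    · have h1 : ((f i * f j) ^ m) y ∈ c := ((hi.mul hj).pow m y).2 hy
      rw [h.on X hX y hy]
      rcases hX with rfl | rfl
      · rw [h.on _ (Or.inl rfl) _ ((hi _).2 h1), dihedral_pow' (hf _) (hf _)]
      · rw [h.on _ (Or.inr rfl) _ ((hj _).2 h1), dihedral_pow (hf _) (hf _)]
    · rw [h.off X y hy]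
      have : f X y ∉ c := by
        rcases hX with rfl | rfl
        · rwa [hi]
        · rwa [hj]
      rw [h.off X _ this, invol_apply (hf X)]
  · rw [not_or] at hX
    rw [h.other X hX.1 hX.2, hf]

theorem Sheared.prod : f' i * f' j = f i * f j := by
  ext y
  rw [Perm.mul_apply, Perm.mul_apply]
  by_cases hy : y ∈ c
  · have h1 : ((f i * f j) ^ m) y ∈ c := ((hi.mul hj).pow m y).2 hy
    rw [h.on j (Or.inr rfl) y hy, h.on i (Or.inl rfl) _ ((hj _).2 h1),
      dihedral_pow_comm (hf _) (hf _)]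
  · rw [h.off j y hy, h.off i _ (by rwa [hj])]

omit hf in
theorem Sheared.closed (X : Color) (hX : X = i ∨ X = j) : Closed (f' X) c := by
  intro y
  by_cases hy : y ∈ c
  · have h1 : ((f i * f j) ^ m) y ∈ c := ((hi.mul hj).pow m y).2 hy
    rw [h.on X hX y hy]
    rcases hX with rfl | rfl
    · simp [hi _, h1, hy]
    · simp [hj _, h1, hy]
  · rw [h.off X y hy]
    rcases hX with rfl | rfl
    · rw [hi]
    · rw [hj]

theorem Sheared.comp {f'' : Surf n} {m' : ℕ} (h' : Sheared f' f'' i j c m') :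
    Sheared f f'' i j c (m + m') := by
  refine ⟨fun X h1 h2 => ?_, fun X hX y hy => ?_, fun X y hy => ?_⟩
  · rw [h'.other X h1 h2, h.other X h1 h2]
  · rw [h'.on X hX y hy, h.prod hf hi hj, h.on X hX _ (((hi.mul hj).pow m' y).2 hy), pow_add,
      Perm.mul_apply]
  · rw [h'.off X y hy, h.off X y hy]

omit h in
theorem Sheared.exists (m : ℕ) :
    Sheared f (shearPow f i j c m) i j c m := by
  induction m with
  | zero => exact Sheared.zero f i j c
  | succ m ih =>
    refine ih.comp hf hi hj ?_
    have hi' := ih.closed hi hj i (Or.inl rfl)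
    have hj' := ih.closed hi hj j (Or.inr rfl)
    refine ⟨fun X h1 h2 => ?_, fun X hX y hy => ?_, fun X y hy => ?_⟩
    · rw [shearPow, shear, if_neg (by tauto)]
    · rw [shearPow, shear, if_pos hX, pow_one, Perm.mul_apply, Perm.mul_apply,
        restrictPerm_mem hj' hy, restrictPerm_mem hi' ((hj' y).2 hy)]
      rfl
    · rw [shearPow, shear]
      split_ifs
      · rw [Perm.mul_apply, Perm.mul_apply, restrictPerm_not_mem hj' hy,
          restrictPerm_not_mem hi' hy]
      · rfl

theorem Sheared.eq_shearPow : f' = shearPow f i j c m :=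
  h.unique (Sheared.exists hf hi hj m)

theorem Sheared.symm (N : ℕ) (hN : (f i * f j) ^ (m + N) = 1) : Sheared f' f i j c N := by
  refine ⟨fun X h1 h2 => (h.other X h1 h2).symm, fun X hX y hy => ?_, fun X y hy =>
    (h.off X y hy).symm⟩
  rw [h.prod hf hi hj, h.on X hX _ (((hi.mul hj).pow N y).2 hy), ← Perm.mul_apply _ _ y,
    ← pow_add, hN]
  rfl

omit hf in
theorem Sheared.sup_le : oc (f' i) ⊔ oc (f' j) ≤ oc (f i) ⊔ oc (f j) := by
  have key : ∀ X, X = i ∨ X = j → oc (f' X) ≤ oc (f i) ⊔ oc (f j) := by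
    intro X hX
    rw [oc_le]
    intro y
    have hle : oc (f X) ≤ oc (f i) ⊔ oc (f j) := by
      rcases hX with rfl | rfl
      · exact le_sup_left
      · exact le_sup_right
    by_cases hy : y ∈ c
    · rw [h.on X hX y hy]
      exact Setoid.trans' _ (((oc_pow_le _ m).trans (oc_mul_le _ _)) (oc_apply _ y))
        (hle (oc_apply _ _))
    · rw [h.off X y hy]
      exact hle (oc_apply _ _)
  exact _root_.sup_le (key i (Or.inl rfl)) (key j (Or.inr rfl))

theorem Sheared.sup_eq : oc (f' i) ⊔ oc (f' j) = oc (f i) ⊔ oc (f j) := by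
  refine le_antisymm (h.sup_le hi hj) ?_
  obtain ⟨N, -, hN⟩ := exists_inverse_power f i j m
  exact (h.symm hf hi hj N hN).sup_le (h.closed hi hj i (Or.inl rfl))
    (h.closed hi hj j (Or.inr rfl))

end
end Steps

section Conn
variable {n : ℕ}

/-- The component of `x0`. -/
def comp (f : Surf n) (i j : Color) (x0 : Fin n) : Set (Fin n) :=
  {y | (oc (f i) ⊔ oc (f j)) x0 y}

theorem closed_class {r : Setoid (Fin n)} {σ : Perm (Fin n)} (h : oc σ ≤ r) (x0 : Fin n) :
    Closed σ {y | r x0 y} := fun y =>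
  ⟨fun h' => r.trans' h' (h (oc_apply' σ y)), fun h' => r.trans' h' (h (oc_apply σ y))⟩

theorem comp_closed_left (f : Surf n) (i j : Color) (x0 : Fin n) : Closed (f i) (comp f i j x0) :=
  closed_class le_sup_left x0

theorem comp_closed_right (f : Surf n) (i j : Color) (x0 : Fin n) :
    Closed (f j) (comp f i j x0) :=
  closed_class le_sup_right x0

/-- A power of a cylinder shear, described pointwise. -/
def Step (f f' : Surf n) : Prop :=
  ∃ i j x0 m, GoodPair i j ∧ Sheared f f' i j (comp f i j x0) m

def Invol (f : Surf n) : Prop := ∀ X, f X * f X = 1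

theorem comp_eq_orbit (f : Surf n) (i j : Color) (x0 : Fin n) :
    comp f i j x0 =
      MulAction.orbit ↥(Subgroup.closure ({f i, f j} : Set (Equiv.Perm (Fin n)))) x0 := by
  ext y
  rw [comp, Set.mem_ofPred_eq, ← orbit_pair]
  constructor
  · rintro ⟨p, hp, rfl⟩
    exact ⟨⟨p, hp⟩, rfl⟩
  · rintro ⟨⟨p, hp⟩, rfl⟩
    exact ⟨p, hp, rfl⟩

theorem Step.shearPowStep {f f' : Surf n} (hf : Invol f) (h : Step f f') :
    ShearPowStep n f f' := by
  obtain ⟨i, j, x0, m, hg, h⟩ := h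
  refine ⟨i, j, comp f i j x0, m + orderOf (f i * f j), hg, ⟨x0, comp_eq_orbit f i j x0⟩, ?_, ?_⟩
  · have := orderOf_pos (f i * f j); omega
  · refine Sheared.eq_shearPow hf ⟨h.other, fun X hX y hy => ?_, h.off⟩
      (comp_closed_left f i j x0) (comp_closed_right f i j x0)
    rw [pow_add, pow_orderOf_eq_one, mul_one, h.on X hX y hy]

theorem Step.invol {f f' : Surf n} (hf : Invol f) (h : Step f f') : Invol f' := by
  obtain ⟨i, j, x0, m, hg, h⟩ := h
  exact h.invol hf (comp_closed_left f i j x0) (comp_closed_right f i j x0)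

theorem Step.symm {f f' : Surf n} (hf : Invol f) (h : Step f f') : Step f' f := by
  obtain ⟨i, j, x0, m, hg, h⟩ := h
  have hi := comp_closed_left f i j x0
  have hj := comp_closed_right f i j x0
  obtain ⟨N, -, hN⟩ := exists_inverse_power f i j m
  refine ⟨i, j, x0, N, hg, ?_⟩
  rw [comp, h.sup_eq hf hi hj]
  exact h.symm hf hi hj N hN

/-- Conjugation of all three permutations. -/
def conjS (σ : Perm (Fin n)) (f : Surf n) : Surf n := fun X => σ * f X * σ⁻¹

theorem conjS_apply (σ : Perm (Fin n)) (f : Surf n) (X : Color) (y : Fin n) :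
    conjS σ f X (σ y) = σ (f X y) := by
  simp [conjS]

theorem conjS_invol {σ : Perm (Fin n)} {f : Surf n} (h : Invol f) : Invol (conjS σ f) := by
  intro X
  have : σ * f X * σ⁻¹ * (σ * f X * σ⁻¹) = σ * (f X * f X) * σ⁻¹ := by group
  rw [conjS, this, h X]; group

theorem oc_conj (σ π : Perm (Fin n)) (x y : Fin n) :
    oc (σ * π * σ⁻¹) (σ x) (σ y) ↔ oc π x y := by
  rw [oc_iff, sameCycle_conj, oc_iff]
  simp

theorem sup_conj_le (σ π ρ : Perm (Fin n)) :
    oc π ⊔ oc ρ ≤ (oc (σ * π * σ⁻¹) ⊔ oc (σ * ρ * σ⁻¹)).comap σ := by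
  apply sup_le
  · rw [oc_le]
    intro x
    exact (le_sup_left : oc (σ * π * σ⁻¹) ≤ _) ((oc_conj _ _ _ _).2 (oc_apply π x))
  · rw [oc_le]
    intro x
    exact (le_sup_right : oc (σ * ρ * σ⁻¹) ≤ _) ((oc_conj _ _ _ _).2 (oc_apply ρ x))

theorem sup_conj (σ π ρ : Perm (Fin n)) (x y : Fin n) :
    (oc (σ * π * σ⁻¹) ⊔ oc (σ * ρ * σ⁻¹)) (σ x) (σ y) ↔ (oc π ⊔ oc ρ) x y := by
  constructor
  · intro h
    have h1 := sup_conj_le σ⁻¹ (σ * π * σ⁻¹) (σ * ρ * σ⁻¹) h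
    have e : ∀ π : Perm (Fin n), σ⁻¹ * (σ * π * σ⁻¹) * σ⁻¹⁻¹ = π := fun π => by group
    rw [e, e] at h1
    simpa [Setoid.comap_rel] using h1
  · intro h
    exact sup_conj_le σ π ρ h

theorem Step.conj {f f' : Surf n} (σ : Perm (Fin n)) (h : Step f f') :
    Step (conjS σ f) (conjS σ f') := by
  obtain ⟨i, j, x0, m, hg, h⟩ := h
  have hc : ∀ y, σ y ∈ comp (conjS σ f) i j (σ x0) ↔ y ∈ comp f i j x0 := fun y =>
    sup_conj σ (f i) (f j) x0 y
  refine ⟨i, j, σ x0, m, hg, fun X h1 h2 => ?_, fun X hX y hy => ?_, fun X y hy => ?_⟩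
  · rw [conjS, conjS, h.other X h1 h2]
  · obtain ⟨y, rfl⟩ := σ.surjective y
    rw [hc] at hy
    have e : conjS σ f i * conjS σ f j = σ * (f i * f j) * σ⁻¹ := by
      simp only [conjS]; group
    rw [e, conj_pow, conjS_apply, h.on X hX y hy]
    simp [conjS]
  · obtain ⟨y, rfl⟩ := σ.surjective y
    rw [hc] at hy
    rw [conjS_apply, conjS_apply, h.off X y hy]

/-- Connected by at most `N` steps up to isomorphism. -/
inductive Conn : ℕ → Surf n → Surf n → Prop
  | refl (N : ℕ) (f : Surf n) : Conn N f f
  | iso (N : ℕ) (f : Surf n) (σ : Perm (Fin n)) : Conn N f (conjS σ f)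
  | step {f f' : Surf n} (h : Step f f') : Conn 1 f f'
  | trans {N M : ℕ} {f g h : Surf n} : Conn N f g → Conn M g h → Conn (N + M) f h

theorem Conn.invol {N : ℕ} {f g : Surf n} (h : Conn N f g) (hf : Invol f) : Invol g := by
  induction h with
  | refl => exact hf
  | iso => exact conjS_invol hf
  | step h => exact h.invol hf
  | trans _ _ h1 h2 => exact h2 (h1 hf)

theorem Conn.symm {N : ℕ} {f g : Surf n} (h : Conn N f g) (hf : Invol f) : Conn N g f := by
  induction h with
  | refl => exact Conn.refl _ _
  | iso N f σ =>
    have : f = conjS σ⁻¹ (conjS σ f) := by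
      funext X; simp only [conjS]; group
    conv => rhs; rw [this]
    exact Conn.iso _ _ _
  | step h => exact Conn.step (h.symm hf)
  | trans h1 _ i1 i2 =>
    rw [add_comm]
    exact (i2 (h1.invol hf)).trans (i1 hf)

theorem Conn.mono {N M : ℕ} {f g : Surf n} (h : Conn N f g) (hNM : N ≤ M) : Conn M f g := by
  obtain ⟨q, rfl⟩ := Nat.exists_eq_add_of_le hNM
  exact h.trans (Conn.refl q g)

theorem ShearPowSeq.trans {L M : ℕ} {f g h : Surf n} (h1 : ShearPowSeq n L f g)
    (h2 : ShearPowSeq n M g h) : ShearPowSeq n (L + M) f h := by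
  induction L generalizing f with
  | zero => rw [ShearPowSeq] at h1; subst h1; rwa [zero_add]
  | succ L ih =>
    obtain ⟨g', hs, h1⟩ := h1
    rw [show L + 1 + M = (L + M) + 1 by ring]
    exact ⟨g', hs, ih h1⟩

/-- Step sequences. -/
def StepSeq : ℕ → Surf n → Surf n → Prop
  | 0, f, f' => f = f'
  | L + 1, f, f' => ∃ g, Step f g ∧ StepSeq L g f'

theorem StepSeq.trans {L M : ℕ} {f g h : Surf n} (h1 : StepSeq L f g)
    (h2 : StepSeq M g h) : StepSeq (L + M) f h := by
  induction L generalizing f with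
  | zero => rw [StepSeq] at h1; subst h1; rwa [zero_add]
  | succ L ih =>
    obtain ⟨g', hs, h1⟩ := h1
    rw [show L + 1 + M = (L + M) + 1 by ring]
    exact ⟨g', hs, ih h1⟩

theorem StepSeq.conj {L : ℕ} {f g : Surf n} (σ : Perm (Fin n)) (h : StepSeq L f g) :
    StepSeq L (conjS σ f) (conjS σ g) := by
  induction L generalizing f with
  | zero => rw [StepSeq] at h ⊢; rw [h]
  | succ L ih =>
    obtain ⟨g', hs, h⟩ := h
    exact ⟨_, hs.conj σ, ih h⟩

theorem StepSeq.shearPowSeq {L : ℕ} {f g : Surf n} (hf : Invol f) (h : StepSeq L f g) :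
    ShearPowSeq n L f g := by
  induction L generalizing f with
  | zero => exact h
  | succ L ih =>
    obtain ⟨g', hs, h⟩ := h
    exact ⟨g', hs.shearPowStep hf, ih (hs.invol hf) h⟩

theorem Conn.stepSeq {N : ℕ} {f g : Surf n} (h : Conn N f g) :
    ∃ L ≤ N, ∃ σ, StepSeq L f (conjS σ g) := by
  have h1 : ∀ f : Surf n, conjS 1 f = f := fun f => by funext X; simp [conjS]
  induction h with
  | refl N f => exact ⟨0, by omega, 1, (h1 f).symm⟩
  | iso N f σ =>
    refine ⟨0, by omega, σ⁻¹, ?_⟩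
    rw [StepSeq]
    funext X; simp only [conjS]; group
  | step h => exact ⟨1, le_rfl, 1, _, h, (h1 _).symm⟩
  | trans _ _ i1 i2 =>
    obtain ⟨L1, hL1, σ1, s1⟩ := i1
    obtain ⟨L2, hL2, σ2, s2⟩ := i2
    refine ⟨L1 + L2, by omega, σ1 * σ2, ?_⟩
    have := s1.trans (s2.conj σ1)
    convert this using 1
    funext X; simp only [conjS]; group

theorem Conn.final {N : ℕ} {f g : Surf n} (h : Conn N f g) (hf : Invol f) :
    ∃ (L : ℕ) (f'' : Surf n), L ≤ N ∧ ShearPowSeq n L f f'' ∧ Isomorphic n g f'' := by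
  obtain ⟨L, hL, σ, s⟩ := h.stepSeq
  exact ⟨L, _, hL, s.shearPowSeq hf, σ, fun X => rfl⟩

end Conn

section Good
variable {n : ℕ}

/-- Surfaces with a prescribed product and number of fixed points. -/
structure Good (P : Perm (Fin n)) (k : ℕ) (f : Surf n) : Prop where
  inv : Invol f
  tr : oc (f R) ⊔ oc (f G) ⊔ oc (f B) = ⊤
  prod : f R * f G * f B = P
  fix : fx (f R) + fx (f G) + fx (f B) = k

theorem goodPair_cases {i j : Color} (h : GoodPair i j) :
    (i = R ∧ j = G) ∨ (i = G ∧ j = R) ∨ (i = G ∧ j = B) ∨ (i = B ∧ j = G) := by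
  unfold GoodPair at h
  rw [Set.pair_eq_pair_iff, Set.pair_eq_pair_iff] at h
  tauto

theorem fx_split (σ : Perm (Fin n)) (p : Fin n → Prop) [DecidablePred p] :
    fx σ = (Finset.univ.filter fun x => p x ∧ σ x = x).card +
      (Finset.univ.filter fun x => ¬ p x ∧ σ x = x).card := by
  classical
  rw [fx, ← Finset.card_filter_add_card_filter_not (p := p)]
  congr 2 <;> ext x <;> simp [and_comm]

theorem Sheared.fx_one {f f' : Surf n} {i j : Color} {c : Set (Fin n)} (hf : Invol f)
    (h : Sheared f f' i j c 1) (hj : Closed (f j) c) :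
    fx (f' i) + fx (f' j) = fx (f i) + fx (f j) := by
  classical
  have e1 : ∀ y ∈ c, f' i y = f j y := fun y hy => by
    rw [h.on i (Or.inl rfl) y hy, pow_one, Perm.mul_apply, invol_apply (hf i)]
  have e2 : ∀ y ∈ c, f' j y = f j (f i (f j y)) := fun y hy => by
    rw [h.on j (Or.inr rfl) y hy, pow_one, Perm.mul_apply]
  have a1 : (Finset.univ.filter fun x => x ∈ c ∧ f' i x = x) =
      Finset.univ.filter fun x => x ∈ c ∧ f j x = x := by
    ext x; simp only [Finset.mem_filter, Finset.mem_univ, true_and]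
    constructor
    · rintro ⟨h1, h2⟩; exact ⟨h1, by rw [← e1 x h1, h2]⟩
    · rintro ⟨h1, h2⟩; exact ⟨h1, by rw [e1 x h1, h2]⟩
  have a2 : (Finset.univ.filter fun x => x ∈ c ∧ f' j x = x).card =
      (Finset.univ.filter fun x => x ∈ c ∧ f i x = x).card := by
    refine Finset.card_bij (fun x _ => f j x) ?_ ?_ ?_
    · intro x hx
      simp only [Finset.mem_filter, Finset.mem_univ, true_and] at hx ⊢
      refine ⟨(hj x).2 hx.1, ?_⟩
      have := hx.2
      rw [e2 x hx.1] at this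
      rw [← invol_apply (hf j) (f i (f j x)), this]
    · intro x _ y _ hxy; exact (f j).injective hxy
    · intro x hx
      simp only [Finset.mem_filter, Finset.mem_univ, true_and] at hx
      refine ⟨f j x, ?_, invol_apply (hf j) x⟩
      simp only [Finset.mem_filter, Finset.mem_univ, true_and]
      refine ⟨(hj x).2 hx.1, ?_⟩
      rw [e2 _ ((hj x).2 hx.1), invol_apply (hf j), hx.2]
  have a3 : ∀ X, (Finset.univ.filter fun x => ¬ x ∈ c ∧ f' X x = x) =
      Finset.univ.filter fun x => ¬ x ∈ c ∧ f X x = x := by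
    intro X
    ext x; simp only [Finset.mem_filter, Finset.mem_univ, true_and]
    constructor
    · rintro ⟨h1, h2⟩; exact ⟨h1, by rw [← h.off X x h1, h2]⟩
    · rintro ⟨h1, h2⟩; exact ⟨h1, by rw [h.off X x h1, h2]⟩
  rw [fx_split (f' i) (· ∈ c), fx_split (f' j) (· ∈ c), fx_split (f i) (· ∈ c),
    fx_split (f j) (· ∈ c), a1, a2, a3, a3]
  omega

theorem Sheared.fx_eq {f f' : Surf n} {i j : Color} {c : Set (Fin n)} {m : ℕ} (hf : Invol f)
    (h : Sheared f f' i j c m) (hi : Closed (f i) c) (hj : Closed (f j) c) :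
    fx (f' i) + fx (f' j) = fx (f i) + fx (f j) := by
  induction m generalizing f' with
  | zero =>
    have := h.unique (Sheared.zero f i j c)
    rw [this]
  | succ m ih =>
    have h1 := Sheared.exists hf hi hj m (c := c)
    have h2 := Sheared.exists (h1.invol hf hi hj) (h1.closed hi hj i (Or.inl rfl))
      (h1.closed hi hj j (Or.inr rfl)) 1 (c := c)
    rw [h.unique (h1.comp hf hi hj h2), h2.fx_one (h1.invol hf hi hj)
      (h1.closed hi hj j (Or.inr rfl)), ih h1]

theorem invol_mul_comm {a b a' b' : Perm (Fin n)} (ha : a * a = 1) (hb : b * b = 1)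
    (ha' : a' * a' = 1) (hb' : b' * b' = 1) (h : a' * b' = a * b) : b' * a' = b * a := by
  have e : ∀ a b : Perm (Fin n), a * a = 1 → b * b = 1 → b * a = (a * b)⁻¹ := by
    intro a b ha hb
    rw [mul_inv_rev, inv_eq_of_mul_eq_one_left ha, inv_eq_of_mul_eq_one_left hb]
  rw [e a b ha hb, e a' b' ha' hb', h]

theorem Step.good {P : Perm (Fin n)} {k : ℕ} {f f' : Surf n} (hf : Good P k f) (h : Step f f') :
    Good P k f' := by
  have hinv := h.invol hf.inv
  obtain ⟨i, j, x0, m, hg, h⟩ := h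
  have hi := comp_closed_left f i j x0
  have hj := comp_closed_right f i j x0
  have hp := h.prod hf.inv hi hj
  have hfx := h.fx_eq hf.inv hi hj
  have hs := h.sup_eq hf.inv hi hj
  have tr := hf.tr
  have prod := hf.prod
  have fix := hf.fix
  rcases goodPair_cases hg with ⟨rfl, rfl⟩ | ⟨rfl, rfl⟩ | ⟨rfl, rfl⟩ | ⟨rfl, rfl⟩
  · have hB := h.other B (by decide) (by decide)
    refine ⟨hinv, ?_, ?_, ?_⟩
    · rw [hs, hB, tr]
    · rw [hp, hB, prod]
    · rw [hB]; omega
  · have hB := h.other B (by decide) (by decide)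
    refine ⟨hinv, ?_, ?_, ?_⟩
    · rw [sup_comm (oc (f' R)), hs, hB, sup_comm (oc (f G)), tr]
    · rw [invol_mul_comm (hf.inv _) (hf.inv _) (hinv _) (hinv _) hp, hB, prod]
    · rw [hB]; omega
  · have hB := h.other R (by decide) (by decide)
    refine ⟨hinv, ?_, ?_, ?_⟩
    · rw [sup_assoc, hs, hB, ← sup_assoc, tr]
    · rw [mul_assoc, hp, hB, ← mul_assoc, prod]
    · rw [hB]; omega
  · have hB := h.other R (by decide) (by decide)
    refine ⟨hinv, ?_, ?_, ?_⟩
    · rw [sup_assoc, sup_comm (oc (f' G)), hs, hB, sup_comm (oc (f B)), ← sup_assoc, tr]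
    · rw [mul_assoc, invol_mul_comm (hf.inv _) (hf.inv _) (hinv _) (hinv _) hp, hB, ← mul_assoc,
        prod]
    · rw [hB]; omega

theorem fx_conj (σ π : Perm (Fin n)) : fx (σ * π * σ⁻¹) = fx π := by
  classical
  symm
  refine Finset.card_bij (fun x _ => σ x) ?_ ?_ ?_
  · intro x hx
    exact Finset.mem_filter.2 ⟨Finset.mem_univ _, by simp [(Finset.mem_filter.1 hx).2]⟩
  · intro x _ y _ h; exact σ.injective h
  · intro x hx
    refine ⟨σ⁻¹ x, Finset.mem_filter.2 ⟨Finset.mem_univ _, σ.injective ?_⟩, by simp⟩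
    simpa using (Finset.mem_filter.1 hx).2

theorem Good.conj {P : Perm (Fin n)} {k : ℕ} {f : Surf n} (hf : Good P k f) (σ : Perm (Fin n)) :
    Good (σ * P * σ⁻¹) k (conjS σ f) := by
  refine ⟨conjS_invol hf.inv, ?_, ?_, ?_⟩
  · rw [Setoid.eq_top_iff]
    intro x y
    have h1 : oc (f R) ⊔ oc (f G) ⊔ oc (f B) ≤
        (oc (conjS σ f R) ⊔ oc (conjS σ f G) ⊔ oc (conjS σ f B)).comap σ := by
      refine sup_le (sup_le ?_ ?_) ?_ <;> rw [oc_le] <;> intro x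
      · exact (le_sup_left.trans le_sup_left : oc (conjS σ f R) ≤ _)
          ((oc_conj _ _ _ _).2 (oc_apply _ x))
      · exact (le_sup_right.trans le_sup_left : oc (conjS σ f G) ≤ _)
          ((oc_conj _ _ _ _).2 (oc_apply _ x))
      · exact (le_sup_right : oc (conjS σ f B) ≤ _)
          ((oc_conj _ _ _ _).2 (oc_apply _ x))
    rw [hf.tr] at h1
    have := h1 (show (⊤ : Setoid (Fin n)) (σ⁻¹ x) (σ⁻¹ y) from trivial)
    simpa [Setoid.comap_rel] using this
  · rw [← hf.prod]; simp only [conjS]; group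
  · simp only [conjS, fx_conj]; exact hf.fix

/-- `ρ = G B`. -/
theorem Good.gb {P : Perm (Fin n)} {k : ℕ} {f : Surf n} (hf : Good P k f) :
    f G * f B = f R * P := by
  rw [← hf.prod, mul_assoc, ← mul_assoc, hf.inv R, one_mul]

theorem Good.G_conj {P : Perm (Fin n)} {k : ℕ} {f : Surf n} (hf : Good P k f) :
    f G * (f R * P) * f G = (f R * P)⁻¹ := by
  rw [← hf.gb, mul_inv_rev, inv_eq_of_mul_eq_one_left (hf.inv G),
    inv_eq_of_mul_eq_one_left (hf.inv B), ← mul_assoc, hf.inv, one_mul]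

theorem Good.B_eq {P : Perm (Fin n)} {k : ℕ} {f : Surf n} (hf : Good P k f) :
    f B = f G * (f R * P) := by
  rw [← hf.gb, ← mul_assoc, hf.inv, one_mul]

theorem Good.oc_G {P : Perm (Fin n)} {k : ℕ} {f : Surf n} (hf : Good P k f) {x y : Fin n}
    (h : oc (f R * P) x y) : oc (f R * P) (f G x) (f G y) := by
  have hG : (f G)⁻¹ = f G := inv_eq_of_mul_eq_one_left (hf.inv G)
  have h1 := (oc_conj (f G) (f R * P) x y).2 h
  rw [hG, hf.G_conj, oc_inv] at h1
  exact h1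

theorem Good.oc_B {P : Perm (Fin n)} {k : ℕ} {f : Surf n} (hf : Good P k f) {x : Fin n} :
    oc (f R * P) (f G x) (f B x) := by
  have hG : (f G)⁻¹ = f G := inv_eq_of_mul_eq_one_left (hf.inv G)
  rw [hf.B_eq, Perm.mul_apply]
  exact hf.oc_G (oc_apply _ x)

/-- The horizontal component of `x0`, explicitly. -/
theorem Good.sup_GB {P : Perm (Fin n)} {k : ℕ} {f : Surf n} (hf : Good P k f) {x y : Fin n} :
    (oc (f G) ⊔ oc (f B)) x y ↔ oc (f R * P) x y ∨ oc (f R * P) (f G x) y := by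
  set ρ := f R * P with hρ
  constructor
  · let t : Setoid (Fin n) :=
      { r := fun x y => oc ρ x y ∨ oc ρ (f G x) y
        iseqv :=
          { refl := fun x => Or.inl (Setoid.refl' _ x)
            symm := by
              rintro x y (h | h)
              · exact Or.inl (Setoid.symm' _ h)
              · right
                have := hf.oc_G h
                rw [invol_apply (hf.inv G)] at this
                exact Setoid.symm' _ this
            trans := by
              rintro x y z (h | h) (g | g)
              · exact Or.inl (Setoid.trans' _ h g)
              · exact Or.inr (Setoid.trans' _ (hf.oc_G h) g)
              · exact Or.inr (Setoid.trans' _ h g)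
              · left
                have := hf.oc_G h
                rw [invol_apply (hf.inv G)] at this
                exact Setoid.trans' _ this g } }
    have : oc (f G) ⊔ oc (f B) ≤ t := by
      apply sup_le
      · rw [oc_le]; intro x; exact Or.inr (Setoid.refl' _ _)
      · rw [oc_le]; intro x; exact Or.inr hf.oc_B
    exact fun h => this h
  · have hle : oc ρ ≤ oc (f G) ⊔ oc (f B) := by
      rw [hρ, ← hf.gb]; exact oc_mul_le _ _
    rintro (h | h)
    · exact hle h
    · exact Setoid.trans' _ ((le_sup_left : oc (f G) ≤ _) (oc_apply _ x)) (hle h)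

/-- Align `G` on one horizontal component. -/
theorem Good.align {P : Perm (Fin n)} {k : ℕ} {f : Surf n} (hf : Good P k f) {x y : Fin n}
    (h : oc (f R * P) (f G x) y) :
    ∃ f', Good P k f' ∧ Step f f' ∧ f' R = f R ∧ f' G x = y ∧
      (∀ z, ¬ oc (f R * P) x z → ¬ oc (f R * P) (f G x) z → f' G z = f G z ∧ f' B z = f B z) ∧
      (∀ z w, (oc (f' G) ⊔ oc (f' B)) z w ↔ (oc (f G) ⊔ oc (f B)) z w) := by
  have hρ := hf.gb
  have h' : oc (f R * P) x (f G y) := by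
    have := hf.oc_G h
    rwa [invol_apply (hf.inv G)] at this
  obtain ⟨m, hm⟩ := SameCycle.exists_nat_pow_eq h'
  have hs := Sheared.exists hf.inv (comp_closed_left f G B x) (comp_closed_right f G B x) m
  have hst : Step f (shearPow f G B (comp f G B x) m) :=
    ⟨G, B, x, m, Or.inr rfl, hs⟩
  refine ⟨_, hst.good hf, hst, hs.other R (by decide) (by decide), ?_, ?_, ?_⟩
  · rw [hs.on G (Or.inl rfl) x ((oc (f G) ⊔ oc (f B)).refl' x), hρ, hm, invol_apply (hf.inv G)]
  · intro z h1 h2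
    have : z ∉ comp f G B x := fun h3 => (hf.sup_GB.1 h3).elim h1 h2
    exact ⟨hs.off _ _ this, hs.off _ _ this⟩
  · intro z w
    rw [hs.sup_eq hf.inv (comp_closed_left f G B x) (comp_closed_right f G B x)]

end Good

section Profile
variable {n : ℕ}

theorem nc_eq_cycleType (P : Perm (Fin n)) : nc (oc P) = P.cycleType.card + fx P := by
  classical
  have h0 : (nc (oc P) : ℚ) = P.cycleType.card + fx P := by
    rw [nc_eq_sum, ← Finset.sum_filter_add_sum_filter_not _ (fun x => P x ≠ x)]
    congr 1
    · have h1 : ∀ x ∈ Finset.univ.filter (fun x => P x ≠ x),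
          P.cycleOf x ∈ P.cycleFactorsFinset := by
        intro x hx
        rw [cycleOf_mem_cycleFactorsFinset_iff, mem_support]
        exact (Finset.mem_filter.1 hx).2
      rw [← Finset.sum_fiberwise_of_maps_to h1, cycleType_def, Multiset.card_map, ← Finset.card_def,
        Finset.card_eq_sum_ones, Nat.cast_sum]
      refine Finset.sum_congr rfl fun c hc => ?_
      have h2 : (Finset.univ.filter (fun x => P x ≠ x)).filter (fun x => P.cycleOf x = c) =
          c.support := by
        ext x
        simp only [Finset.mem_filter, Finset.mem_univ, true_and]
        constructor
        · rintro ⟨hx, rfl⟩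
          rw [mem_support_cycleOf_iff]
          exact ⟨SameCycle.refl _ _, mem_support.2 hx⟩
        · intro hx
          refine ⟨?_, (cycle_is_cycleOf hx hc).symm⟩
          have := mem_cycleFactorsFinset_support_le hc hx
          exact mem_support.1 this
      have h3 : ∀ x ∈ c.support, 1 / (sz (oc P) x : ℚ) = 1 / (c.support.card : ℚ) := by
        intro x hx
        have : c.support = Finset.univ.filter fun y => oc P x y := by
          ext y
          rw [cycle_is_cycleOf hx hc, mem_support_cycleOf_iff]
          have hx' := mem_cycleFactorsFinset_support_le hc hx
          simp only [Finset.mem_filter, Finset.mem_univ, true_and]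
          exact ⟨fun h => h.1, fun h => ⟨h, hx'⟩⟩
        rw [sz, this]
      rw [h2, Finset.sum_congr rfl h3, Finset.sum_const, nsmul_eq_mul]
      have : (c.support.card : ℚ) ≠ 0 := by
        have : c.support.card ≠ 0 := by
          rw [Finset.card_ne_zero]
          exact (mem_cycleFactorsFinset_iff.1 hc).1.nonempty_support
        exact_mod_cast this
      field_simp
      simp
    · rw [fx, Finset.card_eq_sum_ones, Nat.cast_sum]
      have : (Finset.univ.filter fun x => ¬ P x ≠ x) = Finset.univ.filter fun x => P x = x := by
        ext x; simp
      rw [this]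
      refine Finset.sum_congr rfl fun x hx => ?_
      have hx' := (Finset.mem_filter.1 hx).2
      have : sz (oc P) x = 1 := by
        rw [sz, Finset.card_eq_one]
        refine ⟨x, ?_⟩
        ext y
        simp only [Finset.mem_filter, Finset.mem_univ, true_and, Finset.mem_singleton]
        constructor
        · rintro ⟨i, rfl⟩
          exact zpow_apply_eq_self_of_apply_eq_self hx' i
        · rintro rfl; exact Setoid.refl' _ _
      rw [this]; simp
  exact_mod_cast h0

theorem profile_sum (f : Surf n) (μ : ℕ → ℕ) (k : ℕ) (h : HasProfile f μ k) :
    ∑ i ∈ Finset.Icc 1 n, (μ i : ℤ) * ((i : ℤ) - 2) = n - 2 * nc (oc (prodRGB f)) := by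
  set P := prodRGB f with hP
  have h1 : ∑ i ∈ Finset.Icc 1 n, (μ i : ℤ) * ((i : ℤ) - 2) =
      ∑ i ∈ Finset.Icc 1 n, ((if i = 1 then (-(fx P : ℤ)) else 0) +
        (Multiset.count i P.cycleType : ℤ) * ((i : ℤ) - 2)) := by
    refine Finset.sum_congr rfl fun i hi => ?_
    rw [← h.1 i (Finset.mem_Icc.1 hi).1, cycleCount]
    split_ifs with hi1
    · subst hi1
      have : Multiset.count 1 P.cycleType = 0 := by
        rw [Multiset.count_eq_zero]
        intro h1
        have := two_le_of_mem_cycleType h1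
        omega
      rw [this]
      simp [fixedCount, fx, hP]
    · simp [hP]
  have hsum : ∀ i ∈ P.cycleType, i ∈ Finset.Icc 1 n := by
    intro i hi
    have h2 := two_le_of_mem_cycleType hi
    have h3 := le_card_support_of_mem_cycleType hi
    have h4 := Finset.card_le_univ P.support
    rw [Fintype.card_fin] at h4
    rw [Finset.mem_Icc]; omega
  have h2 : ∑ i ∈ Finset.Icc 1 n, (Multiset.count i P.cycleType : ℤ) * ((i : ℤ) - 2) =
      (P.cycleType.map fun i : ℕ => (i : ℤ) - 2).sum := by
    rw [Finset.sum_multiset_map_count]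
    symm
    rw [Finset.sum_subset (s₂ := Finset.Icc 1 n)]
    · simp
    · intro i hi; exact hsum i (Multiset.mem_toFinset.1 hi)
    · intro i _ hi
      rw [Multiset.count_eq_zero.2 (fun h => hi (Multiset.mem_toFinset.2 h))]
      simp
  rw [h1, Finset.sum_add_distrib, h2, Multiset.sum_map_sub, nc_eq_cycleType]
  have h5 : P.cycleType.sum + fx P = n := by
    have h6 := Equiv.Perm.sum_cycleType P
    have h7 : P.support.card + fx P = n := by
      have := Finset.card_filter_add_card_filter_not (s := Finset.univ) (fun x => P x ≠ x)
      simp only [not_not, Finset.card_univ, Fintype.card_fin] at this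
      exact this
    omega
  have h8 : (P.cycleType.map fun i : ℕ => (i : ℤ)).sum = (P.cycleType.sum : ℤ) := by
    simp
  have h9 : ∑ i ∈ Finset.Icc 1 n, (if i = 1 then (-(fx P : ℤ)) else 0) = -(fx P : ℤ) := by
    rw [Finset.sum_ite_eq']
    by_cases hn : 1 ≤ n
    · simp [hn]
    · have : n = 0 := by omega
      have hz : fx P = 0 := by omega
      simp [hz]
  rw [h8, h9]
  simp
  have : (P.cycleType.sum : ℤ) + fx P = n := by exact_mod_cast h5
  linarith

theorem cycleType_eq (f f' : Surf n) (μ : ℕ → ℕ) (k : ℕ) (h : HasProfile f μ k)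
    (h' : HasProfile f' μ k) : (prodRGB f).cycleType = (prodRGB f').cycleType := by
  ext i
  by_cases hi : 2 ≤ i
  · have h1 := h.1 i (by omega)
    have h2 := h'.1 i (by omega)
    rw [cycleCount, if_neg (by omega)] at h1 h2
    omega
  · have : ∀ P : Perm (Fin n), Multiset.count i P.cycleType = 0 := by
      intro P
      rw [Multiset.count_eq_zero]
      intro h1
      exact hi (two_le_of_mem_cycleType h1)
    rw [this, this]

theorem IsSTS.good {f : Surf n} (h : IsSTS n f) {μ : ℕ → ℕ} {k : ℕ} (hp : HasProfile f μ k) :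
    Good (prodRGB f) k f := by
  refine ⟨h.2.1, ?_, rfl, hp.2⟩
  rw [Setoid.eq_top_iff]
  intro x y
  exact (orbit_triple _ _ _ _ _).1 (h.2.2 x y)

end Profile

section Separation
variable {n : ℕ}

/-- Numerical data of the product permutation. -/
structure Prof (P : Perm (Fin n)) (k : ℕ) : Prop where
  eq : n + 4 = 2 * nc (oc P) + k
  fix : fx P ≤ 1

theorem Closed.compl {f : Perm (Fin n)} {c : Set (Fin n)} (h : Closed f c) : Closed f cᶜ :=
  fun y => not_congr (h y)

theorem restrict_invol {f : Perm (Fin n)} {c : Set (Fin n)} (h : Closed f c) (hf : f * f = 1) :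
    restrictPerm f c * restrictPerm f c = 1 := by
  ext y
  rw [Perm.mul_apply]
  by_cases hy : y ∈ c
  · rw [restrictPerm_mem h hy, restrictPerm_mem h ((h y).2 hy), invol_apply hf]; rfl
  · rw [restrictPerm_not_mem h hy, restrictPerm_not_mem h hy]; rfl

theorem fx_restrict {f : Perm (Fin n)} {c : Set (Fin n)} (h : Closed f c)
    (h0 : ∀ y ∉ c, f y ≠ y) (D : Finset (Fin n)) (hD : ∀ x, x ∈ D ↔ x ∉ c) :
    fx (restrictPerm f c) = fx f + D.card := by
  classical
  rw [fx_split _ (· ∈ c), fx_split f (· ∈ c)]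
  have e1 : (Finset.univ.filter fun x => x ∈ c ∧ restrictPerm f c x = x) =
      Finset.univ.filter fun x => x ∈ c ∧ f x = x := by
    ext x
    simp only [Finset.mem_filter, Finset.mem_univ, true_and]
    refine and_congr_right fun hx => ?_
    rw [restrictPerm_mem h hx]
  have e2 : (Finset.univ.filter fun x => ¬ x ∈ c ∧ restrictPerm f c x = x) =
      D := by
    ext x
    rw [hD]
    simp only [Finset.mem_filter, Finset.mem_univ, true_and]
    exact ⟨fun h => h.1, fun hx => ⟨hx, restrictPerm_not_mem h hx⟩⟩
  have e3 : (Finset.univ.filter fun x => ¬ x ∈ c ∧ f x = x) = ∅ := by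
    ext x
    simp only [Finset.mem_filter, Finset.mem_univ, true_and, Finset.notMem_empty, iff_false]
    rintro ⟨h1, h2⟩; exact h0 x h1 h2
  rw [e1, e2, e3]; simp

variable {P : Perm (Fin n)} {k : ℕ} {f : Surf n}

theorem Good.G_ne (hf : Good P k f) {x : Fin n} (h : ¬ oc (f R * P) x (f G x)) {y : Fin n}
    (hy : oc (f R * P) x y ∨ oc (f R * P) (f G x) y) : ¬ oc (f R * P) y (f G y) := by
  intro h'
  rcases hy with hy | hy
  · exact h (Setoid.trans' _ hy (Setoid.trans' _ h' (Setoid.symm' _ (hf.oc_G hy))))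
  · have := hf.oc_G hy
    rw [invol_apply (hf.inv G)] at this
    exact h (Setoid.trans' _ this (Setoid.trans' _ (Setoid.symm' _ h') (Setoid.symm' _ hy)))

theorem Good.B_ne (hf : Good P k f) {x : Fin n} (h : ¬ oc (f R * P) x (f G x)) {y : Fin n}
    (hy : oc (f R * P) x y ∨ oc (f R * P) (f G x) y) : ¬ oc (f R * P) y (f B y) := fun h' =>
  hf.G_ne h hy (Setoid.trans' _ h' (Setoid.symm' _ hf.oc_B))

open Classical in
theorem card_class_G (hf : Good P k f) (x : Fin n) :
    (Finset.univ.filter fun y => oc (f R * P) (f G x) y).card =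
      (Finset.univ.filter fun y => oc (f R * P) x y).card := by
  refine Finset.card_bij (fun y _ => f G y) ?_ ?_ ?_
  · intro y hy
    rw [Finset.mem_filter] at hy ⊢
    have := hf.oc_G hy.2
    rw [invol_apply (hf.inv G)] at this
    exact ⟨Finset.mem_univ _, this⟩
  · intro y _ z _ h; exact (f G).injective h
  · intro y hy
    rw [Finset.mem_filter] at hy
    exact ⟨f G y, Finset.mem_filter.2 ⟨Finset.mem_univ _, hf.oc_G hy.2⟩, invol_apply (hf.inv G) y⟩

theorem comp_GB (hf : Good P k f) (x : Fin n) :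
    comp f G B x = {y | oc (f R * P) x y ∨ oc (f R * P) (f G x) y} := by
  ext y; exact hf.sup_GB

open Classical in
theorem card_comp (hf : Good P k f) {x : Fin n} (h : ¬ oc (f R * P) x (f G x)) :
    (Finset.univ.filter fun y => y ∈ comp f G B x).card =
      2 * (Finset.univ.filter fun y => oc (f R * P) x y).card := by
  have : (Finset.univ.filter fun y => y ∈ comp f G B x) =
      (Finset.univ.filter fun y => oc (f R * P) x y) ∪
        (Finset.univ.filter fun y => oc (f R * P) (f G x) y) := by
    ext y
    rw [comp_GB hf]; simp
  rw [this, Finset.card_union_of_disjoint, card_class_G hf]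
  · ring
  · rw [Finset.disjoint_filter]
    intro y _ h1 h2
    exact h (Setoid.trans' _ h1 (Setoid.symm' _ h2))

theorem restrict_prod {a b : Perm (Fin n)} {c : Set (Fin n)} (ha : Closed a c) (hb : Closed b c) :
    restrictPerm a c * restrictPerm b c = restrictPerm (a * b) c := by
  ext y
  rw [Perm.mul_apply]
  by_cases hy : y ∈ c
  · rw [restrictPerm_mem hb hy, restrictPerm_mem ha ((hb y).2 hy),
      restrictPerm_mem (ha.mul hb) hy]; rfl
  · rw [restrictPerm_not_mem hb hy, restrictPerm_not_mem ha hy,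
      restrictPerm_not_mem (ha.mul hb) hy]

theorem restrict_compl_mul {a : Perm (Fin n)} {c : Set (Fin n)} (ha : Closed a c) :
    restrictPerm a cᶜ * restrictPerm a c = a := by
  ext y
  rw [Perm.mul_apply]
  by_cases hy : y ∈ c
  · rw [restrictPerm_mem ha hy, restrictPerm_not_mem ha.compl (by simpa using (ha y).2 hy)]
  · rw [restrictPerm_not_mem ha hy, restrictPerm_mem ha.compl hy]

/-- Cutting a closed cylinder separates the surface. -/
theorem Good.sep (hP : Prof P k) (hf : Good P k f) {x : Fin n}
    (h : ¬ oc (f R * P) x (f G x)) :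
    ∃ s : Setoid (Fin n), oc (f R) ≤ s ∧
      (∀ z, z ∉ comp f G B x → s z (f G z) ∧ s z (f B z)) ∧
      (∀ z w, oc (f R * P) x z → oc (f R * P) x w → s z w) ∧
      (∀ z w, oc (f R * P) (f G x) z → oc (f R * P) (f G x) w → s z w) ∧ ¬ s x (f G x) := by
  classical
  set ρ := f R * P with hρ
  set C := comp f G B x with hC
  have hCG : Closed (f G) C := comp_closed_left f G B x
  have hCB : Closed (f B) C := comp_closed_right f G B x
  have hCρ : Closed ρ C := by rw [hρ, ← hf.gb]; exact hCG.mul hCB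
  have hCm : ∀ y, y ∈ C ↔ oc ρ x y ∨ oc ρ (f G x) y := fun y => by
    rw [hC, comp_GB hf]; rfl
  set ρC := restrictPerm ρ C
  set Go := restrictPerm (f G) Cᶜ
  set Bo := restrictPerm (f B) Cᶜ
  have hprod : Go * (Bo * ρC) = ρ := by
    rw [← mul_assoc, restrict_prod hCG.compl hCB.compl, hf.gb, restrict_compl_mul hCρ]
  set r1 := oc ρC ⊔ oc Bo with hr1
  set r2 := r1 ⊔ oc Go with hr2
  set s := r2 ⊔ oc (f R) with hs
  have hρs : ∀ z ∈ C, s z (ρ z) := fun z hz => by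
    have : oc ρC ≤ s := le_sup_left.trans (le_sup_left.trans le_sup_left)
    have h2 := this (oc_apply ρC z)
    rwa [restrictPerm_mem hCρ hz] at h2
  have hcl : ∀ z ∈ C, ∀ w, oc ρ z w → s z w := by
    intro z hz w hw
    obtain ⟨i, rfl⟩ := SameCycle.exists_nat_pow_eq hw
    induction i with
    | zero => exact Setoid.refl' _ _
    | succ i ih =>
      rw [pow_succ', Perm.mul_apply]
      exact Setoid.trans' _ (ih ⟨i, by simp⟩) (hρs _ ((hCρ.pow i z).2 hz))
  have hoff : ∀ z, z ∉ C → s z (f G z) ∧ s z (f B z) := by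
    intro z hz
    have h1 : oc Go ≤ s := le_sup_right.trans le_sup_left
    have h2 : oc Bo ≤ s := le_sup_right.trans (le_sup_left.trans le_sup_left)
    have h3 := h1 (oc_apply Go z)
    have h4 := h2 (oc_apply Bo z)
    rw [restrictPerm_mem hCG.compl hz] at h3
    rw [restrictPerm_mem hCB.compl hz] at h4
    exact ⟨h3, h4⟩
  refine ⟨s, le_sup_right, hoff, ?_, ?_, ?_⟩
  · intro z w hz hw
    exact Setoid.trans' _ (Setoid.symm' _ (hcl x ((hCm x).2 (Or.inl (Setoid.refl' _ _))) z hz))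
      (hcl x ((hCm x).2 (Or.inl (Setoid.refl' _ _))) w hw)
  · intro z w hz hw
    exact Setoid.trans' _
      (Setoid.symm' _ (hcl _ ((hCm _).2 (Or.inr (Setoid.refl' _ _))) z hz))
      (hcl _ ((hCm _).2 (Or.inr (Setoid.refl' _ _))) w hw)
  intro hcon
  -- then `s` is everything
  have hCall : ∀ z ∈ C, s x z := by
    intro z hz
    rcases (hCm z).1 hz with hz | hz
    · exact hcl x ((hCm x).2 (Or.inl (Setoid.refl' _ _))) z hz
    · exact Setoid.trans' _ hcon (hcl _ ((hCm _).2 (Or.inr (Setoid.refl' _ _))) z hz)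
  have htop : s = ⊤ := by
    rw [eq_top_iff, ← hf.tr]
    refine sup_le (sup_le le_sup_right ?_) ?_ <;> rw [oc_le] <;> intro z <;> by_cases hz : z ∈ C
    · exact Setoid.trans' _ (Setoid.symm' _ (hCall z hz)) (hCall _ ((hCG z).2 hz))
    · exact (hoff z hz).1
    · exact Setoid.trans' _ (Setoid.symm' _ (hCall z hz)) (hCall _ ((hCB z).2 hz))
    · exact (hoff z hz).2
  have hne : Nonempty (Fin n) := ⟨x⟩
  have hnc : nc s = 1 := nc_eq_one_iff.2 htop
  have q1 := riemann_hurwitz ρC (oc ρC) le_rfl Bo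
  have q2 := riemann_hurwitz (Bo * ρC) r1 ((oc_mul_le _ _).trans (by rw [hr1, sup_comm])) Go
  have q3 := riemann_hurwitz ρ r2 (by
    rw [← hprod]
    refine (oc_mul_le _ _).trans (sup_le le_sup_right ((oc_mul_le _ _).trans ?_))
    rw [sup_comm, ← hr1]; exact le_sup_left) (f R)
  have hRρ : f R * ρ = P := by rw [hρ, ← mul_assoc, hf.inv, one_mul]
  rw [hprod] at q2
  rw [hRρ] at q3
  have i1 := nc_invol (hf.inv R)
  have i2 : 2 * nc (oc Go) = _ := nc_invol (restrict_invol hCG.compl (hf.inv G))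
  have i3 : 2 * nc (oc Bo) = _ := nc_invol (restrict_invol hCB.compl (hf.inv B))
  have hGne : ∀ y ∉ Cᶜ, f G y ≠ y := fun y hy h' => by
    have h2 := hf.G_ne h ((hCm y).1 (not_not.1 hy))
    rw [h'] at h2
    exact h2 (Setoid.refl' _ _)
  have hBne : ∀ y ∉ Cᶜ, f B y ≠ y := fun y hy h' => by
    have h2 := hf.B_ne h ((hCm y).1 (not_not.1 hy))
    rw [h'] at h2
    exact h2 (Setoid.refl' _ _)
  have hCc : ∀ y, y ∈ (Finset.univ.filter fun x => x ∈ C) ↔ y ∉ Cᶜ := fun y => by simp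
  rw [fx_restrict hCG.compl hGne _ hCc] at i2
  rw [fx_restrict hCB.compl hBne _ hCc] at i3
  have hfix := hf.fix
  have heq := hP.eq
  -- classes of `ρC`
  have hclass : (Finset.univ.filter fun x => x ∉ C).card + 2 ≤ nc (oc ρC) := by
    have hxG : x ≠ f G x := fun h' => h (by rw [← h'])
    have hx : x ∈ C := (hCm x).2 (Or.inl (Setoid.refl' _ _))
    have hGx : f G x ∈ C := (hCm _).2 (Or.inr (Setoid.refl' _ _))
    have hcard : (insert x (insert (f G x) (Finset.univ.filter fun x => x ∉ C))).card =
        (Finset.univ.filter fun x => x ∉ C).card + 2 := by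
      rw [Finset.card_insert_of_notMem, Finset.card_insert_of_notMem]
      · simp [hGx]
      · simp [hx, hxG]
    rw [← hcard]
    have hsep : ∀ y, oc ρC x y → oc ρ x y := by
      intro y hy
      have : oc ρC ≤ oc ρ := by
        rw [oc_le]; intro z
        by_cases hz : z ∈ C
        · rw [restrictPerm_mem hCρ hz]; exact oc_apply ρ z
        · rw [restrictPerm_not_mem hCρ hz]
      exact this hy
    have hoffc : ∀ y z, y ∉ C → oc ρC y z → y = z := by
      rintro y z hy ⟨i, rfl⟩
      exact (zpow_apply_eq_self_of_apply_eq_self (restrictPerm_not_mem hCρ hy) i).symm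
    refine card_le_nc _ ?_
    intro y hy z hz hyz
    simp only [Finset.mem_insert, Finset.mem_filter, Finset.mem_univ, true_and] at hy hz
    rcases hy with rfl | rfl | hy
    · rcases hz with rfl | rfl | hz
      · rfl
      · exact absurd (hsep _ hyz) h
      · exact (hoffc _ _ hz (Setoid.symm' _ hyz)).symm
    · rcases hz with rfl | rfl | hz
      · exact absurd (hsep _ (Setoid.symm' _ hyz)) h
      · rfl
      · exact (hoffc _ _ hz (Setoid.symm' _ hyz)).symm
    · exact hoffc _ _ hy hyz
  have hsum : (Finset.univ.filter fun x => x ∈ C).card +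
      (Finset.univ.filter fun x => x ∉ C).card = n := by
    rw [Finset.card_filter_add_card_filter_not]; simp
  have hn : Nat.card (Fin n) = n := by simp
  rw [hn] at q1 q2 q3 i1 i2 i3
  rw [← hs, hnc] at q3
  rw [← hr1] at q1
  rw [← hr2] at q2
  omega

end Separation

section Cap
variable {n : ℕ}

theorem nc_le_of_related {r : Setoid (Fin n)} (A : Finset (Fin n)) (x0 : Fin n)
    (h : ∀ y ∉ A, r x0 y) : nc r ≤ A.card + 1 := by
  classical
  have hs : Function.Surjective
      (fun o : Option A => o.elim (Quotient.mk r x0) fun a => Quotient.mk r a.1) := by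
    intro q
    induction q using Quotient.inductionOn with
    | h y =>
      by_cases hy : y ∈ A
      · exact ⟨some ⟨y, hy⟩, rfl⟩
      · exact ⟨none, Quotient.sound (h y hy)⟩
  have := Nat.card_le_card_of_surjective _ hs
  rw [nc]
  refine this.trans ?_
  simp

theorem oc_restrict_mem {P : Perm (Fin n)} {c : Set (Fin n)} (h : Closed P c) {x y : Fin n}
    (hx : x ∈ c) : oc (restrictPerm P c) x y ↔ oc P x y := by
  have hle : oc (restrictPerm P c) ≤ oc P := by
    rw [oc_le]; intro z
    by_cases hz : z ∈ c
    · rw [restrictPerm_mem h hz]; exact oc_apply P z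
    · rw [restrictPerm_not_mem h hz]
  refine ⟨fun h' => hle h', fun h' => ?_⟩
  obtain ⟨i, rfl⟩ := SameCycle.exists_nat_pow_eq h'
  clear h'
  induction i with
  | zero => exact Setoid.refl' _ _
  | succ i ih =>
    refine Setoid.trans' _ ih ?_
    have := oc_apply (restrictPerm P c) ((P ^ i) x)
    rwa [restrictPerm_mem h ((h.pow i x).2 hx), ← Perm.mul_apply, ← pow_succ'] at this

theorem oc_restrict_not_mem {P : Perm (Fin n)} {c : Set (Fin n)} (h : Closed P c) {x y : Fin n}
    (hx : x ∉ c) : oc (restrictPerm P c) x y ↔ x = y := by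
  constructor
  · rintro ⟨i, rfl⟩
    exact (zpow_apply_eq_self_of_apply_eq_self (restrictPerm_not_mem h hx) i).symm
  · rintro rfl; exact Setoid.refl' _ _

theorem sz_eq_of_iff {r s : Setoid (Fin n)} {x : Fin n} (h : ∀ y, r x y ↔ s x y) :
    sz r x = sz s x := by
  classical
  unfold sz
  congr 1; ext y
  rw [Finset.mem_filter, Finset.mem_filter, h]

theorem sz_ge_two {P : Perm (Fin n)} {x : Fin n} (h : P x ≠ x) : 2 ≤ sz (oc P) x := by
  classical
  exact Finset.one_lt_card.2 ⟨x, Finset.mem_filter.2 ⟨Finset.mem_univ _, Setoid.refl' _ _⟩, P x,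
    Finset.mem_filter.2 ⟨Finset.mem_univ _, oc_apply P x⟩, h.symm⟩

theorem sz_eq_one {r : Setoid (Fin n)} {x : Fin n} (h : ∀ y, r x y → x = y) : sz r x = 1 := by
  classical
  exact Finset.card_eq_one.2 ⟨x, by
    ext y
    rw [Finset.mem_filter, Finset.mem_singleton]
    exact ⟨fun h' => (h y h'.2).symm, by rintro rfl; exact ⟨Finset.mem_univ _, Setoid.refl' _ _⟩⟩⟩

theorem nc_restrict_ge {P : Perm (Fin n)} {c : Set (Fin n)} (h : Closed P c)
    (D : Finset (Fin n)) (hD : ∀ x, x ∈ D ↔ x ∉ c) :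
    2 * nc (oc P) + D.card ≤ 2 * nc (oc (restrictPerm P c)) + fx P := by
  classical
  have h1 := nc_eq_sum (oc P)
  have h2 := nc_eq_sum (oc (restrictPerm P c))
  have h3 : (D.card : ℚ) = ∑ x : Fin n, if x ∈ D then 1 else 0 := by simp
  have h4 : (fx P : ℚ) = ∑ x : Fin n, if P x = x then 1 else 0 := by simp [fx]
  have : (2 * nc (oc P) + D.card : ℚ) ≤ 2 * nc (oc (restrictPerm P c)) + fx P := by
    rw [h1, h2, h3, h4, Finset.mul_sum, Finset.mul_sum, ← Finset.sum_add_distrib,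
      ← Finset.sum_add_distrib]
    refine Finset.sum_le_sum fun x _ => ?_
    by_cases hx : x ∈ c
    · have e : sz (oc (restrictPerm P c)) x = sz (oc P) x :=
        sz_eq_of_iff fun y => oc_restrict_mem h hx
      rw [e, if_neg (fun h' => (hD x).1 h' hx)]
      split_ifs <;> linarith
    · have e : sz (oc (restrictPerm P c)) x = 1 :=
        sz_eq_one fun y => (oc_restrict_not_mem h hx).1
      rw [e, if_pos ((hD x).2 hx)]
      have hpos := sz_pos (oc P) x
      split_ifs with hfx
      · have : (1 : ℚ) / sz (oc P) x ≤ 1 := by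
          rw [div_le_one (by exact_mod_cast hpos)]; exact_mod_cast hpos
        norm_num at this ⊢; linarith
      · have h2 : (2 : ℚ) ≤ sz (oc P) x := by exact_mod_cast sz_ge_two hfx
        have : (1 : ℚ) / sz (oc P) x ≤ 1 / 2 := one_div_le_one_div_of_le (by norm_num) h2
        norm_num at this ⊢; linarith
  exact_mod_cast this

variable {P : Perm (Fin n)} {k : ℕ} {f : Surf n}

theorem Good.univ_of_closed (hf : Good P k f) {Y : Set (Fin n)} {x : Fin n} (hx : x ∈ Y)
    (h : ∀ X, ∀ y ∈ Y, f X y ∈ Y) (y : Fin n) : y ∈ Y := by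
  let t : Setoid (Fin n) := Setoid.ker (fun z => z ∈ Y)
  have key : ∀ X, oc (f X) ≤ t := by
    intro X
    rw [oc_le]; intro z
    refine propext ⟨h X z, fun h' => ?_⟩
    have := h X _ h'
    rwa [invol_apply (hf.inv X)] at this
  have : (⊤ : Setoid (Fin n)) ≤ t := by
    rw [← hf.tr]
    exact sup_le (sup_le (key R) (key G)) (key B)
  have h1 : (x ∈ Y) = (y ∈ Y) := this (show (⊤ : Setoid (Fin n)) x y from trivial)
  rwa [← h1]

/-- No horizontal cylinder is capped by a fixed point free involution on one boundary. -/
theorem Good.cap (hP : Prof P k) (hf : Good P k f) {v : Fin n} (h : ¬ oc (f R * P) v (f G v))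
    (hR : ∀ y, oc (f R * P) v y → oc (f R * P) v (f R y) ∧ f R y ≠ y) : False := by
  classical
  set ρ := f R * P with hρ
  set C := comp f G B v with hC
  have hCG : Closed (f G) C := comp_closed_left f G B v
  have hCB : Closed (f B) C := comp_closed_right f G B v
  have hCm : ∀ y, y ∈ C ↔ oc ρ v y ∨ oc ρ (f G v) y := fun y => by
    rw [hC, comp_GB hf]; rfl
  set D : Set (Fin n) := {y | oc ρ (f G v) y}
  set D' : Set (Fin n) := {y | oc ρ v y}
  have hDρ : Closed ρ D := closed_class le_rfl _
  have hDρ' : Closed ρ D' := closed_class le_rfl _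
  have hDR : Closed (f R) D' := fun y => ⟨fun h' => by
    have := (hR _ h').1
    rwa [invol_apply (hf.inv R)] at this, fun h' => (hR _ h').1⟩
  have hdis : ∀ y, y ∈ D → y ∉ D' := fun y h1 h2 =>
    h (Setoid.trans' _ h2 (Setoid.symm' _ h1))
  have hRρ : f R * ρ = P := by rw [hρ, ← mul_assoc, hf.inv, one_mul]
  have hDP : Closed P D' := by rw [← hRρ]; exact hDR.mul hDρ'
  set ρD := restrictPerm ρ D
  set Go := restrictPerm (f G) Cᶜ
  set Bo := restrictPerm (f B) Cᶜ
  set Ro := restrictPerm (f R) D'ᶜ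
  have hGBo : Go * Bo = restrictPerm ρ Cᶜ := by
    rw [restrict_prod hCG.compl hCB.compl, hf.gb]
  have hCρ : Closed ρ C := by rw [hρ, ← hf.gb]; exact hCG.mul hCB
  have hprod : Ro * (Go * (Bo * ρD)) = restrictPerm P D'ᶜ := by
    rw [← mul_assoc Go, hGBo]
    ext y
    rw [Perm.mul_apply, Perm.mul_apply]
    by_cases hy : y ∈ D'
    · have h1 : y ∉ D := fun h' => hdis y h' hy
      rw [restrictPerm_not_mem hDρ h1, restrictPerm_not_mem hCρ.compl
        (by simpa using (hCm y).2 (Or.inl hy)), restrictPerm_not_mem hDR.compl (by simpa using hy),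
        restrictPerm_not_mem hDP.compl (by simpa using hy)]
    · rw [restrictPerm_mem hDP.compl hy]
      have e : restrictPerm ρ Cᶜ (ρD y) = ρ y := by
        by_cases hy' : y ∈ D
        · rw [restrictPerm_mem hDρ hy', restrictPerm_not_mem hCρ.compl]
          simpa using (hCm _).2 (Or.inr ((hDρ y).2 hy'))
        · rw [restrictPerm_not_mem hDρ hy', restrictPerm_mem hCρ.compl]
          exact fun h' => ((hCm y).1 h').elim hy hy'
      rw [e, restrictPerm_mem hDR.compl (fun h' => hy ((hDρ' y).1 h')), ← hRρ]
      rfl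
  set r1 := oc ρD ⊔ oc Bo with hr1
  set r2 := r1 ⊔ oc Go with hr2
  set r3 := r2 ⊔ oc Ro with hr3
  have hDcl : ∀ y ∈ D, r3 (f G v) y := fun y hy => by
    have : oc ρD ≤ r3 := le_sup_left.trans (le_sup_left.trans le_sup_left)
    exact this ((oc_restrict_mem hDρ (show f G v ∈ D from (oc ρ).refl' _)).2 hy)
  have hconn : ∀ y, y ∉ D' → r3 (f G v) y := by
    intro y hy
    have := hf.univ_of_closed (Y := {y | y ∈ D' ∨ r3 (f G v) y}) (x := v)
      (Or.inl (show v ∈ D' from (oc ρ).refl' _)) ?_ y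
    · exact this.resolve_left hy
    intro X z hz
    by_cases hz' : z ∈ D'
    · cases X with
      | R => exact Or.inl ((hDR z).2 hz')
      | G => exact Or.inr (hDcl _ (hf.oc_G hz'))
      | B => exact Or.inr (hDcl _ (Setoid.trans' _ (hf.oc_G hz') hf.oc_B))
    · have hz := hz.resolve_left hz'
      by_cases hzD : z ∈ D
      · have hGz : oc ρ v (f G z) := by
          have := hf.oc_G hzD
          rwa [invol_apply (hf.inv G)] at this
        cases X with
        | R =>
          right
          have h1 : oc Ro ≤ r3 := le_sup_right
          have h2 := h1 (oc_apply Ro z)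
          rw [restrictPerm_mem hDR.compl hz'] at h2
          exact Setoid.trans' _ hz h2
        | G => exact Or.inl hGz
        | B => exact Or.inl (Setoid.trans' _ hGz hf.oc_B)
      · have hzC : z ∈ Cᶜ := fun h' => ((hCm z).1 h').elim hz' hzD
        right
        refine Setoid.trans' _ hz ?_
        cases X with
        | R =>
          have h1 : oc Ro ≤ r3 := le_sup_right
          have h2 := h1 (oc_apply Ro z)
          rwa [restrictPerm_mem hDR.compl hz'] at h2
        | G =>
          have h1 : oc Go ≤ r3 := le_sup_right.trans le_sup_left
          have h2 := h1 (oc_apply Go z)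
          rwa [restrictPerm_mem hCG.compl hzC] at h2
        | B =>
          have h1 : oc Bo ≤ r3 := le_sup_right.trans (le_sup_left.trans le_sup_left)
          have h2 := h1 (oc_apply Bo z)
          rwa [restrictPerm_mem hCB.compl hzC] at h2
  have q1 := riemann_hurwitz ρD (oc ρD) le_rfl Bo
  have q2 := riemann_hurwitz (Bo * ρD) r1 ((oc_mul_le _ _).trans (by rw [hr1, sup_comm])) Go
  have q3 := riemann_hurwitz (Go * (Bo * ρD)) r2 (by
    refine (oc_mul_le _ _).trans (sup_le le_sup_right ((oc_mul_le _ _).trans ?_))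
    rw [sup_comm, ← hr1]; exact le_sup_left) Ro
  rw [hprod] at q3
  have hGne : ∀ y ∉ Cᶜ, f G y ≠ y := fun y hy h' => by
    have h2 := hf.G_ne h ((hCm y).1 (not_not.1 hy))
    rw [h'] at h2
    exact h2 (Setoid.refl' _ _)
  have hBne : ∀ y ∉ Cᶜ, f B y ≠ y := fun y hy h' => by
    have h2 := hf.B_ne h ((hCm y).1 (not_not.1 hy))
    rw [h'] at h2
    exact h2 (Setoid.refl' _ _)
  set d := (Finset.univ.filter fun y => oc ρ v y).card with hd
  have hcardC : (Finset.univ.filter fun y => y ∈ C).card = 2 * d := card_comp hf h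
  have hcardD : (Finset.univ.filter fun y => oc ρ (f G v) y).card = d := card_class_G hf v
  have i1 : 2 * nc (oc Ro) = _ := nc_invol (restrict_invol hDR.compl (hf.inv R))
  have i2 : 2 * nc (oc Go) = _ := nc_invol (restrict_invol hCG.compl (hf.inv G))
  have i3 : 2 * nc (oc Bo) = _ := nc_invol (restrict_invol hCB.compl (hf.inv B))
  have hCc : ∀ y, y ∈ (Finset.univ.filter fun x => x ∈ C) ↔ y ∉ Cᶜ := fun y => by simp
  have hDc : ∀ y, y ∈ (Finset.univ.filter fun y => oc ρ v y) ↔ y ∉ D'ᶜ := fun y => by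
    rw [Finset.mem_filter]; simp [D']
  rw [fx_restrict hDR.compl (fun y hy => (hR y (not_not.1 hy)).2) _ hDc] at i1
  rw [fx_restrict hCG.compl hGne _ hCc, hcardC] at i2
  rw [fx_restrict hCB.compl hBne _ hCc, hcardC] at i3
  have hfix := hf.fix
  have heq := hP.eq
  have hPfix := hP.fix
  have hr := nc_restrict_ge hDP.compl _ hDc
  have hnc : nc r3 ≤ d + 1 := nc_le_of_related _ (f G v) fun y hy =>
    hconn y fun h' => hy (Finset.mem_filter.2 ⟨Finset.mem_univ _, h'⟩)
  have hclass : n + 1 ≤ nc (oc ρD) + d := by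
    have hsum : (Finset.univ.filter fun y => oc ρ (f G v) y).card +
        (Finset.univ.filter fun y => ¬ oc ρ (f G v) y).card = n := by
      rw [Finset.card_filter_add_card_filter_not]; simp
    have hcard : (insert (f G v) (Finset.univ.filter fun y => ¬ oc ρ (f G v) y)).card =
        (Finset.univ.filter fun y => ¬ oc ρ (f G v) y).card + 1 := by
      rw [Finset.card_insert_of_notMem]
      exact fun h' => (Finset.mem_filter.1 h').2 (Setoid.refl' _ _)
    have : (insert (f G v) (Finset.univ.filter fun y => ¬ oc ρ (f G v) y)).card ≤ nc (oc ρD) := by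
      refine card_le_nc _ ?_
      intro y hy z hz hyz
      rcases Finset.mem_insert.1 hy with rfl | hy
      · rcases Finset.mem_insert.1 hz with rfl | hz
        · rfl
        · exact ((oc_restrict_not_mem hDρ (Finset.mem_filter.1 hz).2).1 (Setoid.symm' _ hyz)).symm
      · exact (oc_restrict_not_mem hDρ (Finset.mem_filter.1 hy).2).1 hyz
    omega
  have hn : Nat.card (Fin n) = n := by simp
  rw [hn] at q1 q2 q3 i1 i2 i3
  rw [← hr1] at q1
  rw [← hr2] at q2
  rw [← hr3] at q3
  omega

end Cap

section Exploration
variable {n : ℕ} {P : Perm (Fin n)} {k : ℕ} {f : Surf n}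

theorem oc_agree {σ ρ : Perm (Fin n)} {C : Set (Fin n)} (hC : Closed ρ C)
    (h : ∀ y ∈ C, σ y = ρ y) {x y : Fin n} (hx : x ∈ C) : oc σ x y ↔ oc ρ x y := by
  have hp : ∀ i : ℕ, (σ ^ i) x = (ρ ^ i) x := by
    intro i
    induction i with
    | zero => rfl
    | succ i ih =>
      rw [pow_succ', pow_succ', Perm.mul_apply, Perm.mul_apply, ih, h _ ((hC.pow i x).2 hx)]
  constructor
  · intro h'
    obtain ⟨i, rfl⟩ := SameCycle.exists_nat_pow_eq h'
    rw [hp]; exact ⟨i, by simp⟩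
  · intro h'
    obtain ⟨i, rfl⟩ := SameCycle.exists_nat_pow_eq h'
    rw [← hp]; exact ⟨i, by simp⟩

theorem comp_ind (hf : Invol f) {i j : Color} {x z : Fin n} (hz : z ∈ comp f i j x)
    {Y : Set (Fin n)} (hx : x ∈ Y)
    (h : ∀ y ∈ Y, y ∈ comp f i j x → f i y ∈ Y ∧ f j y ∈ Y) : z ∈ Y := by
  let t : Setoid (Fin n) := Setoid.ker (fun z => z ∈ Y ∧ z ∈ comp f i j x)
  have ci := comp_closed_left f i j x
  have cj := comp_closed_right f i j x
  have key : oc (f i) ⊔ oc (f j) ≤ t := by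
    apply sup_le <;> rw [oc_le] <;> intro z <;> refine propext ⟨fun h' => ?_, fun h' => ?_⟩
    · exact ⟨(h z h'.1 h'.2).1, (ci z).2 h'.2⟩
    · have := (h _ h'.1 h'.2).1
      rw [invol_apply (hf i)] at this
      exact ⟨this, (ci z).1 h'.2⟩
    · exact ⟨(h z h'.1 h'.2).2, (cj z).2 h'.2⟩
    · have := (h _ h'.1 h'.2).2
      rw [invol_apply (hf j)] at this
      exact ⟨this, (cj z).1 h'.2⟩
  have h1 : (x ∈ Y ∧ x ∈ comp f i j x) = (z ∈ Y ∧ z ∈ comp f i j x) := key hz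
  have : z ∈ Y ∧ z ∈ comp f i j x := by
    rw [← h1]; exact ⟨hx, (oc (f i) ⊔ oc (f j)).refl' x⟩
  exact this.1

/-- `c` is generated from `u` inside `c` by the given moves. -/
theorem Good.vert (hf : Good P k f) {c : Set (Fin n)} {u : Fin n} (hu : u ∈ c)
    (hG : ∀ y ∈ c, f G y ∈ c) (hR : ∀ y ∈ c, f R y ∈ c)
    (con : ∀ Y : Set (Fin n), u ∈ Y → (∀ y ∈ Y, y ∈ c → f G y ∈ Y ∧ f R y ∈ Y) → c ⊆ Y) :
    ∃ f', Good P k f' ∧ Step f f' ∧ f' B = f B ∧ (∀ y ∈ c, f' G y = f R y) ∧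
      (∀ y ∈ c, f' R y = f R (f G (f R y))) ∧ ∀ y ∉ c, f' G y = f G y ∧ f' R y = f R y := by
  have hc : comp f G R u = c := by
    apply Set.Subset.antisymm
    · intro z hz
      exact comp_ind hf.inv hz hu fun y hy _ => ⟨hG y hy, hR y hy⟩
    · exact con _ ((oc (f G) ⊔ oc (f R)).refl' u)
        fun y hy _ => ⟨(comp_closed_left f G R u y).2 hy, (comp_closed_right f G R u y).2 hy⟩
  have hs := Sheared.exists hf.inv (comp_closed_left f G R u) (comp_closed_right f G R u) 1
  have hst : Step f (shearPow f G R (comp f G R u) 1) :=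
    ⟨G, R, u, 1, Or.inl (Set.pair_comm _ _), hs⟩
  rw [hc] at hs hst
  refine ⟨_, hst.good hf, hst, hs.other B (by decide) (by decide), ?_, ?_, ?_⟩
  · intro y hy
    rw [hs.on G (Or.inl rfl) y hy, pow_one, Perm.mul_apply, invol_apply (hf.inv G)]
  · intro y hy
    rw [hs.on R (Or.inr rfl) y hy, pow_one, Perm.mul_apply]
  · intro y hy
    exact ⟨hs.off _ _ hy, hs.off _ _ hy⟩

theorem Good.G_pow (hf : Good P k f) (m : ℕ) (y : Fin n) :
    ((f R * P) ^ m) (f G (((f R * P) ^ m) y)) = f G y := by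
  have := flip_pow (hf.inv G) hf.G_conj m y
  rw [← this, invol_apply (hf.inv G)]
  rw [this]

theorem Good.folded_fix (hf : Good P k f) {a : Fin n} (h : oc (f R * P) a (f G a)) :
    ∃ z, oc (f R * P) a z ∧ (f G z = z ∨ f B z = z) := by
  set ρ := f R * P with hρ
  obtain ⟨i, hi⟩ := SameCycle.exists_nat_pow_eq h
  rcases i.even_or_odd' with ⟨j, rfl | rfl⟩
  · refine ⟨(ρ ^ j) a, ⟨j, by simp⟩, Or.inl ?_⟩
    apply (ρ ^ j).injective
    rw [hf.G_pow, ← hi, ← Perm.mul_apply (ρ ^ j), ← pow_add, two_mul]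
  · refine ⟨(ρ ^ j) a, ⟨j, by simp⟩, Or.inr ?_⟩
    apply (ρ ^ (j + 1)).injective
    rw [hf.B_eq, Perm.mul_apply, ← hρ, ← Perm.mul_apply ρ, ← pow_succ', hf.G_pow, ← hi,
      ← Perm.mul_apply (ρ ^ (j + 1)), ← pow_add]
    congr 2; omega

theorem Good.fix_folded (hf : Good P k f) {z : Fin n} (h : f G z = z ∨ f B z = z) :
    oc (f R * P) z (f G z) := by
  rcases h with h | h
  · rw [h]
  · have := hf.oc_B (x := z)
    rw [h] at this
    exact Setoid.symm' _ this

/-- Points that are not generic. -/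
def Special (P : Perm (Fin n)) (f : Surf n) (x : Fin n) : Prop :=
  P (P x) ≠ x ∨ P x = x ∨ f R x = x ∨ f G x = x ∨ f B x = x

open Classical in
/-- The number of special points outside `F`. -/
noncomputable def spc (P : Perm (Fin n)) (f : Surf n) (F : Set (Fin n)) : ℕ :=
  (Finset.univ.filter fun x => x ∉ F ∧ Special P f x).card

theorem spc_le {f' : Surf n} {F F' : Set (Fin n)} (h : F ⊆ F')
    (h' : ∀ x ∉ F', ∀ X, f' X x = f X x) : spc P f' F' ≤ spc P f F := by
  classical
  refine Finset.card_le_card fun x hx => ?_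
  obtain ⟨-, h1, h2⟩ := Finset.mem_filter.1 hx
  refine Finset.mem_filter.2 ⟨Finset.mem_univ _, fun h3 => h1 (h h3), ?_⟩
  simpa only [Special, h' x h1] using h2

theorem spc_lt {f' : Surf n} {F F' : Set (Fin n)} (h : F ⊆ F')
    (h' : ∀ x ∉ F', ∀ X, f' X x = f X x) {z : Fin n} (hz : z ∈ F') (hz' : z ∉ F)
    (hs : Special P f z) : spc P f' F' + 1 ≤ spc P f F := by
  classical
  refine Finset.card_lt_card ⟨fun x hx => ?_, fun hsub => ?_⟩
  · obtain ⟨-, h1, h2⟩ := Finset.mem_filter.1 hx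
    refine Finset.mem_filter.2 ⟨Finset.mem_univ _, fun h3 => h1 (h h3), ?_⟩
    simpa only [Special, h' x h1] using h2
  · have := hsub (Finset.mem_filter.2 ⟨Finset.mem_univ z, hz', hs⟩)
    exact (Finset.mem_filter.1 this).2.1 hz

/-- The involution `G` after the vertical shear along `c`, with the ladder open at `u`. -/
noncomputable def vG (f : Surf n) (c : Set (Fin n)) (u : Fin n) : Perm (Fin n) :=
  restrictPerm (f G) cᶜ * restrictPerm (f R) (c \ {u})

structure Ladder (P : Perm (Fin n)) (k : ℕ) (f : Surf n) (F : Set (Fin n)) (u : Fin n)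
    (c : Set (Fin n)) : Prop where
  good : Good P k f
  clG : ∀ y ∈ F, f G y ∈ F
  clB : ∀ y ∈ F, f B y ∈ F
  sub : c ⊆ F
  mem : u ∈ c
  cG : ∀ y ∈ c, f G y ∈ c
  cR : ∀ y ∈ c, y ≠ u → f R y ∈ c ∧ f R y ≠ u
  tr : ∀ y ∈ F, oc (vG f c u * f B) u y
  sep : ∀ s : Setoid (Fin n), oc (f R) ≤ s → (∀ y ∈ F, s y (f G y) ∧ s y (f B y)) →
    ∀ y ∈ F, s u y
  con : ∀ Y : Set (Fin n), u ∈ Y → (∀ y ∈ Y, y ∈ c → f G y ∈ Y ∧ (y ≠ u → f R y ∈ Y)) → c ⊆ Y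

theorem closed_of_maps {σ : Perm (Fin n)} (h : σ * σ = 1) {c : Set (Fin n)}
    (hc : ∀ y ∈ c, σ y ∈ c) : Closed σ c := fun y =>
  ⟨fun h' => by have := hc _ h'; rwa [invol_apply h] at this, hc y⟩

theorem Ladder.closedG {F c : Set (Fin n)} {u : Fin n} (h : Ladder P k f F u c) :
    Closed (f G) c := closed_of_maps (h.good.inv G) h.cG

theorem Ladder.closedR {F c : Set (Fin n)} {u : Fin n} (h : Ladder P k f F u c) :
    Closed (f R) (c \ {u}) := closed_of_maps (h.good.inv R) fun y hy => h.cR y hy.1 hy.2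

theorem vG_u {c : Set (Fin n)} {u : Fin n} (hG : Closed (f G) c) (hR : Closed (f R) (c \ {u}))
    (hu : u ∈ c) : vG f c u u = u := by
  rw [vG, Perm.mul_apply, restrictPerm_not_mem hR (by simp),
    restrictPerm_not_mem hG.compl (by simpa using hu)]

theorem vG_on {c : Set (Fin n)} {u : Fin n} (hG : Closed (f G) c) (hR : Closed (f R) (c \ {u}))
    {y : Fin n} (hy : y ∈ c) (hyu : y ≠ u) : vG f c u y = f R y := by
  rw [vG, Perm.mul_apply, restrictPerm_mem hR ⟨hy, hyu⟩,
    restrictPerm_not_mem hG.compl (by simpa using ((hR y).2 ⟨hy, hyu⟩).1)]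

theorem vG_off {c : Set (Fin n)} {u : Fin n} (hG : Closed (f G) c) (hR : Closed (f R) (c \ {u}))
    {y : Fin n} (hy : y ∉ c) : vG f c u y = f G y := by
  rw [vG, Perm.mul_apply, restrictPerm_not_mem hR (fun h => hy h.1),
    restrictPerm_mem hG.compl hy]

theorem Ladder.closedV {F c : Set (Fin n)} {u : Fin n} (h : Ladder P k f F u c) :
    Closed (vG f c u) F := by
  have : ∀ y ∈ F, vG f c u y ∈ F := by
    intro y hy
    by_cases hyc : y ∈ c
    · by_cases hyu : y = u
      · rw [hyu, vG_u h.closedG h.closedR h.mem]; exact h.sub h.mem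
      · rw [vG_on h.closedG h.closedR hyc hyu]; exact h.sub (h.cR y hyc hyu).1
    · rw [vG_off h.closedG h.closedR hyc]; exact h.clG y hy
  have hinv : vG f c u * vG f c u = 1 := by
    ext y
    rw [Perm.mul_apply, Perm.one_apply]
    by_cases hyc : y ∈ c
    · by_cases hyu : y = u
      · rw [hyu, vG_u h.closedG h.closedR h.mem, vG_u h.closedG h.closedR h.mem]
      · rw [vG_on h.closedG h.closedR hyc hyu, vG_on h.closedG h.closedR (h.cR y hyc hyu).1
          (h.cR y hyc hyu).2, invol_apply (h.good.inv R)]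
    · rw [vG_off h.closedG h.closedR hyc, vG_off h.closedG h.closedR
        (fun h' => hyc ((h.closedG y).1 h')), invol_apply (h.good.inv G)]
  exact closed_of_maps hinv this

theorem Ladder.transfer {f' : Surf n} {F c : Set (Fin n)} {u : Fin n} (h : Ladder P k f F u c)
    (hf' : Good P k f') (hR : f' R = f R) (hG : ∀ y ∈ F, f' G y = f G y)
    (hB : ∀ y ∈ F, f' B y = f B y) : Ladder P k f' F u c := by
  have cG' : Closed (f' G) c := closed_of_maps (hf'.inv G) fun y hy => by
    rw [hG y (h.sub hy)]; exact h.cG y hy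
  have cR' : Closed (f' R) (c \ {u}) := by rw [hR]; exact h.closedR
  refine ⟨hf', fun y hy => ?_, fun y hy => ?_, h.sub, h.mem, fun y hy => ?_, ?_, fun y hy => ?_,
    fun s hs h' => ?_, fun Y hu h' => ?_⟩
  · rw [hG y hy]; exact h.clG y hy
  · rw [hB y hy]; exact h.clB y hy
  · rw [hG y (h.sub hy)]; exact h.cG y hy
  · rw [hR]; exact h.cR
  · refine (oc_agree (C := F) (h.closedV.mul (closed_of_maps (h.good.inv B) h.clB)) ?_
      (h.sub h.mem)).2 (h.tr y hy)
    intro y hy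
    rw [Perm.mul_apply, Perm.mul_apply, hB y hy]
    have hy := h.clB y hy
    by_cases hyc : f B y ∈ c
    · by_cases hyu : f B y = u
      · rw [hyu, vG_u h.closedG h.closedR h.mem, vG_u cG' cR' h.mem]
      · rw [vG_on h.closedG h.closedR hyc hyu, vG_on cG' cR' hyc hyu, hR]
    · rw [vG_off h.closedG h.closedR hyc, vG_off cG' cR' hyc, hG _ hy]
  · refine h.sep s (hR ▸ hs) fun y hy => ?_
    have := h' y hy
    rwa [hG y hy, hB y hy] at this
  · refine h.con Y hu fun y hy hyc => ?_
    have := h' y hy hyc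
    rwa [hG y (h.sub hyc), hR] at this

end Exploration

section Explore
variable {n : ℕ} {P : Perm (Fin n)} {k : ℕ} {f : Surf n}

theorem Ladder.comp_disj {F c : Set (Fin n)} {u a y : Fin n} (h : Ladder P k f F u c)
    (ha : a ∉ F) (hy : y ∈ comp f G B a) : y ∉ F :=
  comp_ind h.good.inv (Y := Fᶜ) hy ha fun y hy _ =>
    ⟨(closed_of_maps (h.good.inv G) h.clG).compl y |>.2 hy,
      (closed_of_maps (h.good.inv B) h.clB).compl y |>.2 hy⟩

theorem Ladder.tr_off {F c : Set (Fin n)} {u a x y : Fin n} (h : Ladder P k f F u c)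
    (ha : a ∉ F) (hx : x ∈ comp f G B a) :
    oc (vG f c u * f B) x y ↔ oc (f R * P) x y := by
  have cG := comp_closed_left f G B a
  have cB := comp_closed_right f G B a
  refine oc_agree (C := comp f G B a) (by rw [← h.good.gb]; exact cG.mul cB) (fun y hy => ?_) hx
  rw [← h.good.gb, Perm.mul_apply, Perm.mul_apply, vG_off h.closedG h.closedR]
  exact fun h' => h.comp_disj ha ((cB y).2 hy) (h.sub h')

theorem Closed.oc_mem {σ : Perm (Fin n)} {F : Set (Fin n)} (h : Closed σ F) {x y : Fin n}
    (hxy : oc σ x y) : x ∈ F ↔ y ∈ F := by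
  obtain ⟨i, rfl⟩ := SameCycle.exists_nat_pow_eq hxy
  exact (h.pow i x).symm

theorem oc_swap_join {σ : Perm (Fin n)} {a b : Fin n} (h : ¬ oc σ a b) :
    oc (swap a b * σ) = joinS (oc σ) a b := by
  rw [← joinS_swap_mul, joinS_of_rel (oc_swap_mul_of_not h)]

theorem Ladder.not_rel {F c : Set (Fin n)} {u a y : Fin n} (h : Ladder P k f F u c)
    (ha : a ∉ F) (hy : y ∈ F) : ¬ oc (vG f c u * f B) y a := fun h' =>
  ha (((h.closedV.mul (closed_of_maps (h.good.inv B) h.clB)).oc_mem h').1 hy)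

theorem Ladder.extend {F c : Set (Fin n)} {u : Fin n} (h : Ladder P k f F u c)
    (ha : f R u ∉ F) (hna : ¬ oc (f R * P) (f R u) (f G (f R u))) :
    Ladder P k f (F ∪ comp f G B (f R u)) (f G (f R u))
      (insert (f R u) (insert (f G (f R u)) c)) := by
  set a := f R u with had
  set v := f G a with hvd
  set C := comp f G B a with hC
  have hau : a ≠ u := fun e => ha (e ▸ h.sub h.mem)
  have cG := comp_closed_left f G B a
  have cB := comp_closed_right f G B a
  have haC : a ∈ C := (oc (f G) ⊔ oc (f B)).refl' a
  have hvC : v ∈ C := (cG a).2 haC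
  have hvF : v ∉ F := h.comp_disj ha hvC
  have hac : a ∉ c := fun h' => ha (h.sub h')
  have hvc : v ∉ c := fun h' => hvF (h.sub h')
  have huv : u ≠ v := fun e => hvc (e ▸ h.mem)
  have hva : v ≠ a := fun e => hna (by rw [e])
  have hRa : f R a = u := by rw [had, invol_apply (h.good.inv R)]
  have hGv : f G v = a := by rw [hvd, invol_apply (h.good.inv G)]
  set c' := insert a (insert v c) with hc'
  have hcG : ∀ y ∈ c', f G y ∈ c' := by
    rintro y (rfl | rfl | hy)
    · exact Or.inr (Or.inl rfl)
    · exact Or.inl hGv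
    · exact Or.inr (Or.inr (h.cG y hy))
  have hcR : ∀ y ∈ c', y ≠ v → f R y ∈ c' ∧ f R y ≠ v := by
    rintro y (rfl | rfl | hy) hyv
    · rw [hRa]; exact ⟨Or.inr (Or.inr h.mem), huv⟩
    · exact absurd rfl hyv
    · by_cases hyu : y = u
      · rw [hyu, ← had]; exact ⟨Or.inl rfl, hva.symm⟩
      · have := h.cR y hy hyu
        exact ⟨Or.inr (Or.inr this.1), fun e => hvc (e ▸ this.1)⟩
  have hG' : Closed (f G) c' := closed_of_maps (h.good.inv G) hcG
  have hR' : Closed (f R) (c' \ {v}) := closed_of_maps (h.good.inv R)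
    fun y hy => hcR y hy.1 hy.2
  have hv' : v ∈ c' := Or.inr (Or.inl rfl)
  have hV : vG f c' v = swap u a * (swap a v * vG f c u) := by
    ext y
    rw [Perm.mul_apply, Perm.mul_apply]
    congr 1
    by_cases hyu : y = u
    · rw [hyu, vG_u h.closedG h.closedR h.mem, swap_apply_of_ne_of_ne hau.symm huv,
        swap_apply_left, vG_on hG' hR' (Or.inr (Or.inr h.mem)) huv]
    by_cases hya : y = a
    · rw [hya, vG_off h.closedG h.closedR hac, ← hvd, swap_apply_right, swap_apply_right,
        vG_on hG' hR' (Or.inl rfl) hva.symm, hRa]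
    by_cases hyv : y = v
    · rw [hyv, vG_off h.closedG h.closedR hvc, hGv, swap_apply_left,
        swap_apply_of_ne_of_ne huv.symm hva, vG_u hG' hR' hv']
    by_cases hyc : y ∈ c
    · have h1 := h.cR y hyc hyu
      rw [vG_on h.closedG h.closedR hyc hyu, vG_on hG' hR' (Or.inr (Or.inr hyc)) hyv,
        swap_apply_of_ne_of_ne (fun e : f R y = a => hac (e ▸ h1.1))
          (fun e : f R y = v => hvc (e ▸ h1.1)),
        swap_apply_of_ne_of_ne h1.2 (fun e : f R y = a => hac (e ▸ h1.1))]
    · have hyc' : y ∉ c' := by rintro (e | e | e) <;> contradiction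
      have n1 : f G y ≠ a := fun e => hyv (by rw [hvd, ← e, invol_apply (h.good.inv G)])
      have n2 : f G y ≠ v := fun e => hya ((f G).injective e)
      have n3 : f G y ≠ u := fun e => hyc ((h.closedG y).1 (e ▸ h.mem))
      rw [vG_off h.closedG h.closedR hyc, vG_off hG' hR' hyc', swap_apply_of_ne_of_ne n1 n2,
        swap_apply_of_ne_of_ne n3 n1]
  have hrel : ∀ y, oc (vG f c' v * f B) v y ↔
      joinS (joinS (oc (vG f c u * f B)) a v) u a v y := by
    intro y
    have e1 : ¬ oc (vG f c u * f B) a v := by rwa [h.tr_off ha haC]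
    have e2 : ¬ oc (swap a v * (vG f c u * f B)) u a := by
      rw [oc_swap_join e1, joinS_apply]
      rintro (e | ⟨e, -⟩ | ⟨e, -⟩)
      · exact h.not_rel ha (h.sub h.mem) e
      · exact h.not_rel ha (h.sub h.mem) e
      · exact h.not_rel hvF (h.sub h.mem) e
    rw [hV, mul_assoc, mul_assoc, oc_swap_join e2, oc_swap_join e1]
  refine ⟨h.good, ?_, ?_, ?_, hv', hcG, hcR, ?_, ?_, ?_⟩
  · rintro y (hy | hy)
    · exact Or.inl (h.clG y hy)
    · exact Or.inr ((cG y).2 hy)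
  · rintro y (hy | hy)
    · exact Or.inl (h.clB y hy)
    · exact Or.inr ((cB y).2 hy)
  · rintro y (rfl | rfl | hy)
    · exact Or.inr haC
    · exact Or.inr hvC
    · exact Or.inl (h.sub hy)
  · intro y hy
    rw [hrel]
    set t := joinS (joinS (oc (vG f c u * f B)) a v) u a
    have t0 : oc (vG f c u * f B) ≤ t := (le_joinS _ _ _).trans (le_joinS _ _ _)
    have t1 : t a v := (le_joinS _ u a) (joinS_rel _ a v)
    have t2 : t u a := joinS_rel _ u a
    rcases hy with hy | hy
    · exact Setoid.trans' _ (Setoid.symm' _ t1)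
        (Setoid.trans' _ (Setoid.symm' _ t2) (t0 (h.tr y hy)))
    · rcases h.good.sup_GB.1 hy with hy | hy
      · exact Setoid.trans' _ (Setoid.symm' _ t1) (t0 ((h.tr_off ha haC).2 hy))
      · exact t0 ((h.tr_off ha hvC).2 hy)
  · intro s hs h' y hy
    have s1 : s u a := hs (oc_apply _ u)
    have s2 : s a v := (h' a (Or.inr haC)).1
    rcases hy with hy | hy
    · have := h.sep s hs (fun y hy => h' y (Or.inl hy)) y hy
      exact Setoid.trans' _ (Setoid.symm' _ (Setoid.trans' _ s1 s2)) this
    · refine Setoid.trans' _ (Setoid.symm' _ s2) ?_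
      exact comp_ind h.good.inv (Y := {y | s a y}) hy (Setoid.refl' _ a) fun y hy hyC =>
        ⟨Setoid.trans' _ hy (h' y (Or.inr hyC)).1, Setoid.trans' _ hy (h' y (Or.inr hyC)).2⟩
  · intro Y hvY hY
    have h1 : a ∈ Y := by
      have := (hY v hvY hv').1
      rwa [hGv] at this
    have h2 : u ∈ Y := by
      have := (hY a h1 (Or.inl rfl)).2 hva.symm
      rwa [hRa] at this
    rintro y (rfl | rfl | hy)
    · exact h1
    · exact hvY
    · refine h.con Y h2 (fun y hy hyc => ?_) hy
      have := hY y hy (Or.inr (Or.inr hyc))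
      exact ⟨this.1, fun _ => this.2 fun e => hvc (e ▸ hyc)⟩

/-- A region on which the horizontal flow is transitive. -/
structure Region (P : Perm (Fin n)) (k : ℕ) (f : Surf n) (F : Set (Fin n)) : Prop where
  good : Good P k f
  clG : ∀ y ∈ F, f G y ∈ F
  clB : ∀ y ∈ F, f B y ∈ F
  tr : ∃ u ∈ F, ∀ y ∈ F, oc (f R * P) u y

theorem Ladder.close {F c : Set (Fin n)} {u : Fin n} (h : Ladder P k f F u c) (hu : f R u = u) :
    ∃ f', Region P k f' F ∧ Step f f' ∧ ∀ x ∉ F, ∀ X, f' X x = f X x := by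
  have hR : ∀ y ∈ c, f R y ∈ c := fun y hy => by
    by_cases hyu : y = u
    · rw [hyu, hu]; exact h.mem
    · exact (h.cR y hy hyu).1
  obtain ⟨f', hf', hst, hB, h1, h2, h3⟩ := h.good.vert h.mem h.cG hR
    fun Y hY h' => h.con Y hY fun y hy hyc => ⟨(h' y hy hyc).1, fun _ => (h' y hy hyc).2⟩
  have hV : f' G = vG f c u := by
    ext y
    congr 1
    by_cases hyc : y ∈ c
    · by_cases hyu : y = u
      · rw [h1 y hyc, hyu, hu, vG_u h.closedG h.closedR h.mem]
      · rw [h1 y hyc, vG_on h.closedG h.closedR hyc hyu]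
    · rw [(h3 y hyc).1, vG_off h.closedG h.closedR hyc]
  refine ⟨f', ⟨hf', fun y hy => ?_, fun y hy => ?_, u, h.sub h.mem, fun y hy => ?_⟩, hst,
    fun x hx X => ?_⟩
  · rw [hV]; exact (h.closedV y).2 hy
  · rw [hB]; exact h.clB y hy
  · rw [← hf'.gb, hV, hB]; exact h.tr y hy
  · have := h3 x fun h' => hx (h.sub h')
    cases X
    · exact this.2
    · exact this.1
    · rw [hB]

theorem Ladder.close_folded {F c : Set (Fin n)} {u : Fin n} (h : Ladder P k f F u c)
    (ha : f R u ∉ F) (hG : f G (f R u) = f R u) :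
    ∃ f', Region P k f' (F ∪ comp f G B (f R u)) ∧ Step f f' ∧
      ∀ x ∉ F ∪ comp f G B (f R u), ∀ X, f' X x = f X x := by
  set a := f R u with had
  set C := comp f G B a with hC
  have hau : a ≠ u := fun e => ha (e ▸ h.sub h.mem)
  have cG := comp_closed_left f G B a
  have cB := comp_closed_right f G B a
  have haC : a ∈ C := (oc (f G) ⊔ oc (f B)).refl' a
  have hac : a ∉ c := fun h' => ha (h.sub h')
  have hRa : f R a = u := by rw [had, invol_apply (h.good.inv R)]
  have hcG : ∀ y ∈ insert a c, f G y ∈ insert a c := by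
    rintro y (rfl | hy)
    · exact Or.inl hG
    · exact Or.inr (h.cG y hy)
  have hcR : ∀ y ∈ insert a c, f R y ∈ insert a c := by
    rintro y (rfl | hy)
    · rw [hRa]; exact Or.inr h.mem
    · by_cases hyu : y = u
      · rw [hyu, ← had]; exact Or.inl rfl
      · exact Or.inr (h.cR y hy hyu).1
  obtain ⟨f', hf', hst, hB, h1, h2, h3⟩ := h.good.vert (u := u) (Or.inr h.mem) hcG hcR
    fun Y hY h' => by
      have : c ⊆ Y := h.con Y hY fun y hy hyc =>
        ⟨(h' y hy (Or.inr hyc)).1, fun _ => (h' y hy (Or.inr hyc)).2⟩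
      rintro y (rfl | hy)
      · exact (h' u hY (Or.inr h.mem)).2
      · exact this hy
  have hV : f' G = swap u a * vG f c u := by
    ext y
    congr 1
    rw [Perm.mul_apply]
    by_cases hya : y = a
    · rw [hya, h1 a (Or.inl rfl), hRa, vG_off h.closedG h.closedR hac, hG, swap_apply_right]
    by_cases hyc : y ∈ c
    · rw [h1 y (Or.inr hyc)]
      by_cases hyu : y = u
      · rw [hyu, vG_u h.closedG h.closedR h.mem, swap_apply_left]
      · have := h.cR y hyc hyu
        rw [vG_on h.closedG h.closedR hyc hyu,
          swap_apply_of_ne_of_ne this.2 (fun e : f R y = a => hac (e ▸ this.1))]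
    · have n1 : f G y ≠ a := fun e => hya (by rw [← hG] at e; exact (f G).injective e)
      have n3 : f G y ≠ u := fun e => hyc ((h.closedG y).1 (e ▸ h.mem))
      rw [(h3 y (by rintro (e | e) <;> contradiction)).1, vG_off h.closedG h.closedR hyc,
        swap_apply_of_ne_of_ne n3 n1]
  have hcF : insert a c ⊆ F ∪ C := by
    rintro y (rfl | hy)
    · exact Or.inr haC
    · exact Or.inl (h.sub hy)
  have hfo : ∀ y ∈ C, oc (f R * P) a y := fun y hy => by
    rcases h.good.sup_GB.1 hy with hy | hy
    · exact hy
    · rwa [hG] at hy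
  refine ⟨f', ⟨hf', fun y hy => ?_, fun y hy => ?_, u, Or.inl (h.sub h.mem), fun y hy => ?_⟩, hst,
    fun x hx X => ?_⟩
  · by_cases hyc : y ∈ insert a c
    · rw [h1 y hyc]; exact hcF (hcR y hyc)
    · rw [(h3 y hyc).1]
      exact hy.imp (h.clG y) (cG y).2
  · rw [hB]; exact hy.imp (h.clB y) (cB y).2
  · rw [← hf'.gb, hV, hB, mul_assoc, oc_swap_join (h.not_rel ha (h.sub h.mem))]
    rcases hy with hy | hy
    · exact le_joinS _ _ _ (h.tr y hy)
    · exact Setoid.trans' _ (joinS_rel _ _ _)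
        (le_joinS _ _ _ ((h.tr_off ha haC).2 (hfo y hy)))
  · have := h3 x fun h' => hx (hcF h')
    cases X
    · exact this.2
    · exact this.1
    · rw [hB]

end Explore

section ExploreMain
variable {n : ℕ} {P : Perm (Fin n)} {k : ℕ}

/-- Align inside a component disjoint from the explored region. -/
theorem Ladder.align {f : Surf n} {F c : Set (Fin n)} {u a y : Fin n} (h : Ladder P k f F u c)
    (ha : a ∉ F) (hy : oc (f R * P) (f G a) y) :
    ∃ f', Ladder P k f' F u c ∧ Step f f' ∧ f' R = f R ∧ f' G a = y ∧
      comp f' G B a = comp f G B a ∧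
      ∀ x ∉ F ∪ comp f G B a, ∀ X, f' X x = f X x := by
  obtain ⟨f', hf', hst, hR, hG, hoff, hs⟩ := h.good.align hy
  have hoff' : ∀ x, x ∉ comp f G B a → f' G x = f G x ∧ f' B x = f B x := fun x hx =>
    hoff x (fun h' => hx (h.good.sup_GB.2 (Or.inl h'))) fun h' => hx (h.good.sup_GB.2 (Or.inr h'))
  have hF : ∀ x ∈ F, x ∉ comp f G B a := fun x hx hx' => h.comp_disj ha hx' hx
  refine ⟨f', h.transfer hf' hR (fun x hx => (hoff' x (hF x hx)).1)
    (fun x hx => (hoff' x (hF x hx)).2), hst, hR, hG, Set.ext fun z => hs a z, fun x hx X => ?_⟩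
  have := hoff' x fun h' => hx (Or.inr h')
  cases X
  · rw [hR]
  · exact this.1
  · exact this.2

theorem Ladder.sep_notMem {f : Surf n} (hP : Prof P k) {F c : Set (Fin n)} {u v : Fin n}
    (h : Ladder P k f F u c)
    (ha : f R u ∉ F) (hna : ¬ oc (f R * P) (f R u) (f G (f R u)))
    (hv : oc (f R * P) (f G (f R u)) v) (hRv : ¬ oc (f R * P) (f G (f R u)) (f R v)) :
    f R v ∉ F ∪ comp f G B (f R u) := by
  obtain ⟨s, hs, h1, h2, h3, h4⟩ := h.good.sep hP hna
  have hRR : s v (f R v) := hs (oc_apply _ v)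
  have e3 := h3 _ _ (Setoid.refl' _ _) hv
  rintro (h' | h')
  · have := h.sep s hs (fun y hy => h1 y fun hy' => h.comp_disj ha hy' hy) _ h'
    have e1 : s u (f R u) := hs (oc_apply _ u)
    refine h4 (Setoid.symm' _ ?_)
    exact Setoid.trans' _ (Setoid.trans' _ e3 hRR)
      (Setoid.trans' _ (Setoid.symm' _ this) e1)
  · rcases h.good.sup_GB.1 h' with h' | h'
    · have := h2 _ _ (Setoid.refl' _ _) h'
      exact h4 (Setoid.trans' _ this (Setoid.symm' _ (Setoid.trans' _ e3 hRR)))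
    · exact hRv h'

/-- If all points of a horizontal boundary are generic, `R` preserves it. -/
theorem Good.boundary_closed {f : Surf n} (hf : Good P k f) {v : Fin n}
    (hs : ∀ z, oc (f R * P) v z → ¬ Special P f z) (h0 : oc (f R * P) v (f R v)) {z : Fin n}
    (hz : oc (f R * P) v z) : oc (f R * P) v (f R z) := by
  obtain ⟨i, rfl⟩ := SameCycle.exists_nat_pow_eq hz
  clear hz
  induction i with
  | zero => exact h0
  | succ i ih =>
    set z := ((f R * P) ^ i) v with hzd
    have hzv : oc (f R * P) v z := ⟨i, by simp [hzd]⟩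
    have hPP : P (P z) = z := by
      by_contra h'; exact hs z hzv (Or.inl h')
    rw [pow_succ', Perm.mul_apply, ← hzd, Perm.mul_apply, invol_apply (hf.inv R)]
    have : (f R * P) (P z) = f R z := by rw [Perm.mul_apply, hPP]
    refine Setoid.trans' _ ih ?_
    rw [← this]; exact oc_apply' _ _

theorem explore (hP : Prof P k) (m : ℕ) : ∀ (f : Surf n) (F : Set (Fin n)) (u : Fin n)
    (c : Set (Fin n)), Ladder P k f F u c → f R u ∉ F → Fᶜ.ncard ≤ m →
    ∃ N f' F', Region P k f' F' ∧ Conn N f f' ∧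
      N + 2 * spc P f' F' ≤ 2 * spc P f F ∧ spc P f' F' + 1 ≤ spc P f F := by
  induction m with
  | zero =>
    intro f F u c h ha hm
    have := (Set.ncard_eq_zero (Set.toFinite _)).1 (Nat.le_zero.1 hm)
    exact absurd ha (by rw [← Set.mem_compl_iff, this]; exact Set.notMem_empty _)
  | succ m ih =>
    intro f F u c h ha hm
    have key : ∀ F' : Set (Fin n), F ⊆ F' → f R u ∈ F' → F'ᶜ.ncard ≤ m := by
      intro F' h1 h2
      have : F'ᶜ.ncard < Fᶜ.ncard :=
        Set.ncard_lt_ncard ⟨Set.compl_subset_compl.2 h1, fun h3 => h3 ha h2⟩ (Set.toFinite _)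
      omega
    have haC : f R u ∈ comp f G B (f R u) := (oc (f G) ⊔ oc (f B)).refl' _
    by_cases hna : oc (f R * P) (f R u) (f G (f R u))
    · -- folded component
      obtain ⟨z, hz, hfz⟩ := h.good.folded_fix hna
      obtain ⟨f1, h1, hst, hR1, hG1, hC1, hoff1⟩ := h.align ha (Setoid.symm' _ hna)
      rw [← hR1] at ha hC1 hG1 hoff1
      obtain ⟨f2, h2, hst2, hoff2⟩ := h1.close_folded ha hG1
      rw [hC1] at h2 hoff2
      have hzF : z ∈ comp f G B (f1 R u) := by
        rw [hR1]; exact h.good.sup_GB.2 (Or.inl hz)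
      have hT : spc P f2 (F ∪ comp f G B (f1 R u)) + 1 ≤ spc P f F :=
        spc_lt Set.subset_union_left (fun x hx X => by rw [hoff2 x hx, hoff1 x hx]) (Or.inr hzF)
          (h.comp_disj ha hzF) (by
            unfold Special; tauto)
      exact ⟨2, f2, _, h2, (Conn.step hst).trans (Conn.step hst2), by omega, hT⟩
    · have hvna : ∀ v, oc (f R * P) (f G (f R u)) v → v ∈ comp f G B (f R u) := fun v hv =>
        h.good.sup_GB.2 (Or.inr hv)
      by_cases hfix : ∃ v, oc (f R * P) (f G (f R u)) v ∧ f R v = v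
      · obtain ⟨v, hv, hRv⟩ := hfix
        obtain ⟨f1, h1, hst, hR1, hG1, hC1, hoff1⟩ := h.align ha hv
        have hna1 : ¬ oc (f1 R * P) (f1 R u) (f1 G (f1 R u)) := by
          rw [hR1, hG1]; exact fun h' => hna (Setoid.trans' _ h' (Setoid.symm' _ hv))
        have h2 := h1.extend (by rwa [hR1]) hna1
        rw [hR1, hG1, hC1] at h2
        obtain ⟨f2, h3, hst2, hoff2⟩ := h2.close (by rw [hR1, hRv])
        have hT : spc P f2 (F ∪ comp f G B (f R u)) + 1 ≤ spc P f F :=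
          spc_lt Set.subset_union_left (fun x hx X => by rw [hoff2 x hx, hoff1 x hx])
            (Or.inr (hvna v hv)) (h.comp_disj ha (hvna v hv)) (by unfold Special; tauto)
        exact ⟨2, f2, _, h3, (Conn.step hst).trans (Conn.step hst2), by omega, hT⟩
      by_cases hout : oc (f R * P) (f G (f R u)) (f R (f G (f R u)))
      · by_cases hex : ∃ v, oc (f R * P) (f G (f R u)) v ∧
            ¬ oc (f R * P) (f G (f R u)) (f R v)
        · obtain ⟨v, hv, hRv⟩ := hex
          have hsp : ∃ z, oc (f R * P) (f G (f R u)) z ∧ Special P f z := by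
            by_contra hcon
            push Not at hcon
            exact hRv (h.good.boundary_closed hcon hout hv)
          obtain ⟨z, hz, hzs⟩ := hsp
          have hnot := h.sep_notMem hP ha hna hv hRv
          obtain ⟨f1, h1, hst, hR1, hG1, hC1, hoff1⟩ := h.align ha hv
          have hna1 : ¬ oc (f1 R * P) (f1 R u) (f1 G (f1 R u)) := by
            rw [hR1, hG1]; exact fun h' => hna (Setoid.trans' _ h' (Setoid.symm' _ hv))
          have h2 := h1.extend (by rwa [hR1]) hna1
          rw [hR1, hG1, hC1] at h2
          obtain ⟨N, f2, F2, h3, hc, hN, hT⟩ := ih f1 _ _ _ h2 (by rwa [hR1])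
            (key _ Set.subset_union_left (Or.inr haC))
          have hT1 : spc P f1 (F ∪ comp f G B (f R u)) + 1 ≤ spc P f F :=
            spc_lt Set.subset_union_left (fun x hx X => by rw [hoff1 x hx])
              (Or.inr (hvna z hz)) (h.comp_disj ha (hvna z hz)) hzs
          exact ⟨1 + N, f2, F2, h3, (Conn.step hst).trans hc, by omega, by omega⟩
        · push Not at hex hfix
          exact (h.good.cap hP (v := f G (f R u))
            (by rw [invol_apply (h.good.inv G)]; exact fun h' => hna (Setoid.symm' _ h'))
            fun y hy => ⟨hex y hy, hfix y hy⟩).elim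
      · have h2 := h.extend ha hna
        have hnot := h.sep_notMem hP ha hna (Setoid.refl' _ _) hout
        obtain ⟨N, f2, F2, h3, hc, hN, hT⟩ := ih f _ _ _ h2 hnot
          (key _ Set.subset_union_left (Or.inr haC))
        have hT1 : spc P f (F ∪ comp f G B (f R u)) ≤ spc P f F :=
          spc_le Set.subset_union_left fun x hx X => rfl
        exact ⟨N, f2, F2, h3, hc, by omega, by omega⟩

theorem Region.closed {f : Surf n} {F : Set (Fin n)} (h : Region P k f F) :
    Closed (f R * P) F := by
  rw [← h.good.gb]
  exact (closed_of_maps (h.good.inv G) h.clG).mul (closed_of_maps (h.good.inv B) h.clB)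

theorem Region.rel {f : Surf n} {F : Set (Fin n)} (h : Region P k f F) {x y : Fin n}
    (hx : x ∈ F) (hy : y ∈ F) : oc (f R * P) x y := by
  obtain ⟨u, -, hu⟩ := h.tr
  exact Setoid.trans' _ (Setoid.symm' _ (hu x hx)) (hu y hy)

/-- Fold the explored region at a point where it can be left. -/
theorem Region.ladder {f : Surf n} {F : Set (Fin n)} (h : Region P k f F) {w : Fin n}
    (hw : w ∈ F) :
    ∃ f', Ladder P k f' F w {w} ∧ Step f f' ∧ f' R = f R ∧
      ∀ x ∉ F, ∀ X, f' X x = f X x := by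
  obtain ⟨f', hf', hst, hR, hG, hoff, -⟩ := h.good.align (h.rel (h.clG w hw) hw)
  have hoff' : ∀ x ∉ F, ∀ X, f' X x = f X x := by
    intro x hx X
    have := hoff x (fun h' => hx ((h.closed.oc_mem h').1 hw))
      (fun h' => hx ((h.closed.oc_mem h').1 (h.clG w hw)))
    cases X
    · rw [hR]
    · exact this.1
    · exact this.2
  have cG : Closed (f' G) F := by
    rw [← compl_compl F]
    refine Closed.compl (closed_of_maps (hf'.inv G) fun y hy => ?_)
    rw [hoff' y hy G]
    exact ((closed_of_maps (h.good.inv G) h.clG).compl y).2 hy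
  have cB : Closed (f' B) F := by
    rw [← compl_compl F]
    refine Closed.compl (closed_of_maps (hf'.inv B) fun y hy => ?_)
    rw [hoff' y hy B]
    exact ((closed_of_maps (h.good.inv B) h.clB).compl y).2 hy
  have cG1 : Closed (f' G) {w} := closed_of_maps (hf'.inv G) (by rintro y rfl; exact hG)
  have cR1 : Closed (f' R) ({w} \ {w}) := by intro y; simp
  have hv : vG f' {w} w = f' G := by
    ext1 y
    by_cases hy : y = w
    · subst hy; rw [vG_u cG1 cR1 rfl, hG]
    · exact vG_off cG1 cR1 hy
  refine ⟨f', ⟨hf', fun y hy => (cG y).2 hy, fun y hy => (cB y).2 hy, by simpa using hw, rfl,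
    fun y hy => (cG1 y).2 hy, fun y hy hyw => absurd hy hyw, fun y hy => ?_,
    fun s hs hs' y hy => ?_,
    fun Y hY _ => by simpa using hY⟩, hst, hR, hoff'⟩
  · rw [hv, hf'.gb, hR]
    exact h.rel hw hy
  · have hc : ∀ x ∈ F, s w x → ∀ i : ℕ, s w (((f' R * P) ^ i) x) := by
      intro x hx hs1 i
      induction i with
      | zero => simpa using hs1
      | succ i ih =>
        have hm : ((f' R * P) ^ i) x ∈ F := by
          have : Closed (f' R * P) F := by rw [hR]; exact h.closed
          exact (this.pow i x).2 hx
        rw [pow_succ', Perm.mul_apply, ← hf'.gb, Perm.mul_apply, hf'.gb]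
        exact Setoid.trans' _ ih (Setoid.trans' _ (hs' _ hm).2 (hs' _ ((cB _).2 hm)).1)
    have : oc (f' R * P) w y := by rw [hR]; exact h.rel hw hy
    obtain ⟨i, rfl⟩ := SameCycle.exists_nat_pow_eq this
    exact hc w hw (Setoid.refl' _ _) i

theorem Region.all (hP : Prof P k) (m : ℕ) : ∀ (f : Surf n) (F : Set (Fin n)),
    Region P k f F → spc P f F ≤ m →
    ∃ N f', Good P k f' ∧ Conn N f f' ∧ oc (f' R * P) = ⊤ ∧ N ≤ 3 * spc P f F := by
  induction m using Nat.strong_induction_on with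
  | _ m ih =>
    intro f F h hm
    by_cases hF : ∀ y, y ∈ F
    · refine ⟨0, f, h.good, Conn.refl _ _, ?_, Nat.zero_le _⟩
      ext x y
      exact ⟨fun _ => trivial, fun _ => h.rel (hF x) (hF y)⟩
    · obtain ⟨u, hu, -⟩ := h.tr
      have : ∃ w ∈ F, f R w ∉ F := by
        by_contra! hcon
        refine hF (h.good.univ_of_closed hu fun X y hy => ?_)
        cases X
        exacts [hcon y hy, h.clG y hy, h.clB y hy]
      obtain ⟨w, hw, hRw⟩ := this
      obtain ⟨f1, hl, hst, hR, hoff⟩ := h.ladder hw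
      have hs1 : spc P f1 F ≤ spc P f F := spc_le (le_refl F) hoff
      obtain ⟨N, f2, F2, h2, hc, hN, hT⟩ := explore hP _ f1 F w _ hl (by rwa [hR]) le_rfl
      obtain ⟨N', f3, h3, hc', ho, hN'⟩ := ih (spc P f2 F2) (by omega) f2 F2 h2 le_rfl
      exact ⟨1 + N + N', f3, h3, ((Conn.step hst).trans hc).trans hc', ho, by omega⟩

end ExploreMain

section PathLike
variable {n : ℕ} {P : Perm (Fin n)} {k : ℕ}

/-- The contribution `1 - 2 / size` of a point to `n - 2 * nc`. -/
noncomputable def wt (r : Setoid (Fin n)) (x : Fin n) : ℚ := 1 - 2 / (sz r x : ℚ)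

theorem sum_wt (r : Setoid (Fin n)) : ∑ x, wt r x = n - 2 * (nc r : ℚ) := by
  simp only [wt, Finset.sum_sub_distrib, nc_eq_sum r, Finset.mul_sum]
  simp [div_eq_mul_inv]

theorem Prof.sum_wt (hP : Prof P k) : ∑ x, wt (oc P) x = (k : ℚ) - 4 := by
  have : (n : ℚ) + 4 = 2 * nc (oc P) + k := by exact_mod_cast hP.eq
  rw [_root_.sum_wt]; linarith

theorem wt_fix {x : Fin n} (h : P x = x) : wt (oc P) x = -1 := by
  have : sz (oc P) x = 1 := sz_eq_one fun y hy => by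
    obtain ⟨i, rfl⟩ := SameCycle.exists_nat_pow_eq hy
    exact (pow_apply_eq_self_of_apply_eq_self h i).symm
  rw [wt, this]; norm_num

theorem wt_nonneg {x : Fin n} (h : P x ≠ x) : 0 ≤ wt (oc P) x := by
  have := sz_ge_two h
  have h2 : (2 : ℚ) ≤ sz (oc P) x := by exact_mod_cast this
  rw [wt, sub_nonneg, div_le_one (by linarith)]; exact h2

theorem sz_ge_three {x : Fin n} (h : P (P x) ≠ x) : 3 ≤ sz (oc P) x := by
  classical
  have h1 : P x ≠ x := fun h' => h (by rw [h', h'])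
  have h2 : P (P x) ≠ P x := fun h' => h1 (P.injective h')
  have : ({x, P x, P (P x)} : Finset (Fin n)).card = 3 := by
    rw [Finset.card_eq_three]; exact ⟨x, P x, P (P x), h1.symm, h.symm, h2.symm, rfl⟩
  rw [← this]
  refine Finset.card_le_card fun y hy => Finset.mem_filter.2 ⟨Finset.mem_univ _, ?_⟩
  simp only [Finset.mem_insert, Finset.mem_singleton] at hy
  rcases hy with rfl | rfl | rfl
  · exact Setoid.refl' _ _
  · exact oc_apply P x
  · exact Setoid.trans' _ (oc_apply P x) (oc_apply P _)

theorem wt_big {x : Fin n} (h : P (P x) ≠ x) : 1 / 3 ≤ wt (oc P) x := by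
  have := sz_ge_three h
  have h2 : (3 : ℚ) ≤ sz (oc P) x := by exact_mod_cast this
  have : 2 / (sz (oc P) x : ℚ) ≤ 2 / 3 := by gcongr
  rw [wt]; linarith

theorem Prof.card_odd (hP : Prof P k) (D : Finset (Fin n))
    (hD : ∀ x ∈ D, P (P x) ≠ x ∨ P x = x) : D.card + 8 ≤ 3 * k := by
  classical
  have h1 : ∀ x, (if x ∈ D then (1 : ℚ) else 0) ≤
      3 * wt (oc P) x + if P x = x then 4 else 0 := by
    intro x
    by_cases hx : P x = x
    · rw [wt_fix hx, if_pos hx]; split_ifs <;> norm_num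
    · rw [if_neg hx]
      split_ifs with h
      · have := wt_big ((hD x h).resolve_right hx); linarith
      · have := wt_nonneg hx; linarith
  have h2 := Finset.sum_le_sum fun x (_ : x ∈ Finset.univ) => h1 x
  rw [Finset.sum_add_distrib, ← Finset.mul_sum, hP.sum_wt] at h2
  simp only [Finset.sum_ite_mem, Finset.univ_inter, Finset.sum_const, nsmul_eq_mul, mul_one,
    ← Finset.sum_filter] at h2
  have h3 : ((Finset.univ.filter fun x => P x = x).card : ℚ) ≤ 1 := by exact_mod_cast hP.fix
  have h4 : (D.card : ℚ) + 8 ≤ 3 * k := by linarith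
  exact_mod_cast h4

theorem Good.spc_le {f : Surf n} (hf : Good P k f) (hP : Prof P k) (F : Set (Fin n)) :
    spc P f F ≤ 4 * k := by
  classical
  have h1 := hP.card_odd (Finset.univ.filter fun x => P (P x) ≠ x ∨ P x = x) (by simp)
  have h2 := hf.fix
  unfold fx at h2
  have h3 : spc P f F ≤ ((Finset.univ.filter fun x => P (P x) ≠ x ∨ P x = x) ∪
      (Finset.univ.filter fun x => f R x = x) ∪ (Finset.univ.filter fun x => f G x = x) ∪
      (Finset.univ.filter fun x => f B x = x)).card := by
    refine Finset.card_le_card fun x hx => ?_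
    have := (Finset.mem_filter.1 hx).2.2
    simp only [Finset.mem_union, Finset.mem_filter, Finset.mem_univ, true_and]
    unfold Special at this
    tauto
  have h4 := h3.trans (Finset.card_union_le _ _)
  have h5 := Finset.card_union_le ((Finset.univ.filter fun x => P (P x) ≠ x ∨ P x = x) ∪
      (Finset.univ.filter fun x => f R x = x)) (Finset.univ.filter fun x => f G x = x)
  have h6 := Finset.card_union_le (Finset.univ.filter fun x => P (P x) ≠ x ∨ P x = x)
      (Finset.univ.filter fun x => f R x = x)
  omega

theorem Good.region {f : Surf n} (hf : Good P k f) {z : Fin n} (h : f G z = z ∨ f B z = z) :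
    Region P k f (comp f G B z) := by
  refine ⟨hf, fun y hy => (comp_closed_left f G B z y).2 hy,
    fun y hy => (comp_closed_right f G B z y).2 hy, z, (oc (f G) ⊔ oc (f B)).refl' z,
    fun y hy => ?_⟩
  rcases hf.sup_GB.1 hy with h' | h'
  · exact h'
  · exact Setoid.trans' _ (hf.fix_folded h) h'

theorem Good.region_exists {f : Surf n} (hf : Good P k f) (hk : 1 ≤ k) :
    ∃ f' F, Region P k f' F ∧ Conn 1 f f' := by
  by_cases h : ∃ z, f G z = z ∨ f B z = z
  · obtain ⟨z, hz⟩ := h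
    exact ⟨f, _, hf.region hz, Conn.refl _ _⟩
  · have : ∃ x, f R x = x := by
      by_contra hR
      have := hf.fix
      unfold fx at this
      push Not at h hR
      rw [Finset.filter_false_of_mem (fun x _ => hR x),
        Finset.filter_false_of_mem (fun x _ => (h x).1),
        Finset.filter_false_of_mem (fun x _ => (h x).2)] at this
      simp at this; omega
    obtain ⟨x, hx⟩ := this
    obtain ⟨f', h1, h2, -, h4, -, -⟩ := hf.vert (c := comp f G R x) (u := x)
      ((oc (f G) ⊔ oc (f R)).refl' x)
      (fun y hy => (comp_closed_left f G R x y).2 hy)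
      (fun y hy => (comp_closed_right f G R x y).2 hy)
      (fun Y hu h y hy => comp_ind hf.inv hy hu h)
    exact ⟨f', _, h1.region (z := x) (Or.inl (by
      rw [h4 x ((oc (f G) ⊔ oc (f R)).refl' x), hx])), Conn.step h2⟩

theorem Good.to_pathLike {f : Surf n} (hf : Good P k f) (hP : Prof P k) (hk : 1 ≤ k) :
    ∃ f', Good P k f' ∧ Conn (13 * k) f f' ∧ oc (f' R * P) = ⊤ := by
  obtain ⟨f1, F, h1, hc⟩ := hf.region_exists hk
  obtain ⟨N, f2, h2, hc2, ho, hN⟩ := Region.all hP _ f1 F h1 le_rfl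
  have := h1.good.spc_le hP F
  exact ⟨f2, h2, (hc.trans hc2).mono (by omega), ho⟩

end PathLike

section TreeMoves
variable {n : ℕ} {P : Perm (Fin n)} {k : ℕ}

/-- The relation generated by two permutations. -/
abbrev cn (P T : Perm (Fin n)) : Setoid (Fin n) := oc P ⊔ oc T

section SwapInvolution
variable {T : Perm (Fin n)} {p q x y : Fin n}

theorem sw_left (hq : T p = p) : (swap p q * T) p = q := by
  rw [Perm.mul_apply, hq, swap_apply_left]

theorem sw_right (hq : T q = q) : (swap p q * T) q = p := by
  rw [Perm.mul_apply, hq, swap_apply_right]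

theorem sw_ne (hp : T p = p) (hq : T q = q) (h1 : x ≠ p) (h2 : x ≠ q) :
    (swap p q * T) x = T x := by
  rw [Perm.mul_apply, swap_apply_of_ne_of_ne]
  · intro h; exact h1 (T.injective (h.trans hp.symm))
  · intro h; exact h2 (T.injective (h.trans hq.symm))

theorem sw_invol (h : T * T = 1) (hp : T p = p) (hq : T q = q) :
    (swap p q * T) * (swap p q * T) = 1 := by
  ext1 x
  rw [Perm.mul_apply, Perm.one_apply]
  by_cases h1 : x = p
  · subst h1; rw [sw_left hp, sw_right hq]
  by_cases h2 : x = q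
  · subst h2; rw [sw_right hq, sw_left hp]
  rw [sw_ne hp hq h1 h2, sw_ne hp hq, invol_apply h]
  · intro h; exact h1 (T.injective (h.trans hp.symm))
  · intro h; exact h2 (T.injective (h.trans hq.symm))

theorem not_oc_fixed (hp : T p = p) (hpq : p ≠ q) : ¬ oc T p q := by
  intro h
  obtain ⟨i, hi⟩ := SameCycle.exists_nat_pow_eq h
  rw [pow_apply_eq_self_of_apply_eq_self hp] at hi
  exact hpq hi

theorem oc_sw (hp : T p = p) (hpq : p ≠ q) : oc (swap p q * T) = joinS (oc T) p q :=
  oc_swap_join (not_oc_fixed hp hpq)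

theorem cn_sw (hp : T p = p) (hpq : p ≠ q) : cn P (swap p q * T) = joinS (cn P T) p q := by
  rw [cn, oc_sw hp hpq, joinS_sup]

theorem fx_sw (h : T * T = 1) (hp : T p = p) (hq : T q = q) (hpq : p ≠ q) :
    fx (swap p q * T) + 2 = fx T := by
  have h1 := nc_invol h
  have h2 := nc_invol (sw_invol h hp hq)
  have h3 := nc_swap_mul_of_not (not_oc_fixed hp hpq)
  omega

theorem sw_sw (p q : Fin n) (T : Perm (Fin n)) : swap p q * (swap p q * T) = T := by
  rw [← mul_assoc, swap_mul_self, one_mul]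

theorem cut_left (he : T p = q) : (swap p q * T) p = p := by
  rw [Perm.mul_apply, he, swap_apply_right]

theorem cut_right (h : T * T = 1) (he : T p = q) : (swap p q * T) q = q := by
  rw [Perm.mul_apply, ← he, invol_apply h, swap_apply_left]

theorem cut_ne (h : T * T = 1) (he : T p = q) (h1 : x ≠ p) (h2 : x ≠ q) :
    (swap p q * T) x = T x := by
  rw [Perm.mul_apply, swap_apply_of_ne_of_ne]
  · rintro rfl; exact h2 (by rw [← he, invol_apply h])
  · intro h3; exact h1 (T.injective (h3.trans he.symm))

theorem cut_invol (h : T * T = 1) (he : T p = q) : (swap p q * T) * (swap p q * T) = 1 := by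
  ext1 x
  rw [Perm.mul_apply, Perm.one_apply]
  by_cases h1 : x = p
  · subst h1; rw [cut_left he, cut_left he]
  by_cases h2 : x = q
  · subst h2; rw [cut_right h he, cut_right h he]
  rw [cut_ne h he h1 h2, cut_ne h he, invol_apply h]
  · rintro rfl; exact h2 (by rw [← he, invol_apply h])
  · intro h3; exact h1 (T.injective (h3.trans he.symm))

end SwapInvolution

/-- Involutions forming a plane tree with the cycles of `P`. -/
structure PTree (P : Perm (Fin n)) (k : ℕ) (T : Perm (Fin n)) : Prop where
  inv : T * T = 1
  con : cn P T = ⊤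
  fix : fx T + 2 = k

/-- A tree with one edge removed. -/
structure Cut (P : Perm (Fin n)) (k : ℕ) (T : Perm (Fin n)) : Prop where
  inv : T * T = 1
  two : ∀ u v, ¬ cn P T u v → ∀ z, cn P T u z ∨ cn P T v z
  fix : fx T = k

variable {T : Perm (Fin n)}

theorem PTree.trans (h : PTree P k T) (hP : Prof P k) : oc (T * P) = ⊤ := by
  rcases isEmpty_or_nonempty (Fin n) with he | he
  · ext x; exact he.elim x
  rw [← nc_eq_one_iff]
  have h1 := riemann_hurwitz P (oc P) le_rfl T
  have h2 := nc_invol h.inv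
  have h3 := hP.eq
  have h4 := h.fix
  have h5 : nc (oc P ⊔ oc T) = 1 := nc_eq_one_iff.2 h.con
  have h6 := nc_pos (oc (T * P))
  rw [Nat.card_fin] at h1 h2
  omega

theorem Good.tree {f : Surf n} (hf : Good P k f) (hP : Prof P k) (h : oc (f R * P) = ⊤) :
    PTree P k (f R) := by
  have con : cn P (f R) = ⊤ := by
    rw [eq_top_iff, ← h, cn, sup_comm]; exact oc_mul_le _ _
  refine ⟨hf.inv R, con, ?_⟩
  rcases isEmpty_or_nonempty (Fin n) with he | he
  · have := hP.eq
    have h0 : n = 0 := by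
      rcases Nat.eq_zero_or_pos n with h' | h'
      · exact h'
      · exact (he.elim ⟨0, h'⟩)
    subst h0
    have := hf.fix
    have e : ∀ σ : Perm (Fin 0), fx σ = 0 := fun σ => by simp [fx]
    rw [e, e, e] at this
    have := nc_le_card (oc P)
    rw [Nat.card_fin] at this
    omega
  have h1 := nc_sup_oc (oc P) (f R)
  rw [nc_eq_one_iff.2 con] at h1
  have h2 := nc_sup_oc (oc (f G)) (f B)
  have h3 : oc (f G) ⊔ oc (f B) = ⊤ := by
    rw [eq_top_iff, ← h, ← hf.gb]; exact oc_mul_le _ _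
  rw [nc_eq_one_iff.2 h3] at h2
  have i1 := nc_invol (hf.inv R)
  have i2 := nc_invol (hf.inv G)
  have i3 := nc_invol (hf.inv B)
  have := hf.fix
  have := hP.eq
  rw [Nat.card_fin] at *
  omega

theorem Good.same_R {f g : Surf n} (hf : Good P k f) (hg : Good P k g) (h : oc (f R * P) = ⊤)
    (hR : f R = g R) : Conn 1 f g := by
  rcases isEmpty_or_nonempty (Fin n) with he | he
  · have : f = g := by funext X; ext x; exact he.elim x
    rw [this]; exact Conn.refl _ _
  obtain ⟨x⟩ := he
  obtain ⟨f', hf', hst, hR', hG', -, -⟩ := hf.align (x := x) (y := g G x) (by rw [h]; trivial)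
  have hG : f' G = g G := by
    ext1 z
    have : oc (f R * P) x z := by rw [h]; trivial
    obtain ⟨i, rfl⟩ := SameCycle.exists_nat_pow_eq this
    have e1 := hf'.G_pow i x
    have e2 := hg.G_pow i x
    rw [hR'] at e1
    rw [← hR] at e2
    exact (((f R * P) ^ i).injective (by rw [e1, e2, hG']))
  have : f' = g := by
    funext X
    cases X
    · rw [hR', hR]
    · exact hG
    · rw [hf'.B_eq, hg.B_eq, hG, hR', hR]
  rw [← this]; exact Conn.step hst

theorem PTree.cut (h : PTree P k T) (hP : Prof P k) {u v : Fin n} (he : T u = v) (hne : u ≠ v) :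
    Cut P k (swap u v * T) ∧ ¬ cn P (swap u v * T) u v := by
  have : Nonempty (Fin n) := ⟨u⟩
  have hu := cut_left he
  have hv := cut_right h.inv he
  have hi := cut_invol h.inv he
  have hfx := fx_sw hi hu hv hne
  have hcn : joinS (cn P (swap u v * T)) u v = ⊤ := by
    rw [← cn_sw hu hne, sw_sw, h.con]
  rw [sw_sw] at hfx
  have hnot : ¬ cn P (swap u v * T) u v := by
    intro h'
    rw [joinS_of_rel h'] at hcn
    have h1 := nc_sup_oc (oc P) (swap u v * T)
    have h2 := nc_eq_one_iff.2 hcn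
    have h3 := nc_invol hi
    have := hP.eq
    have := h.fix
    rw [cn] at h2
    rw [Nat.card_fin] at *
    omega
  refine ⟨⟨hi, fun a b hab z => ?_, by have := h.fix; omega⟩, hnot⟩
  have key : ∀ z, cn P (swap u v * T) u z ∨ cn P (swap u v * T) v z := by
    intro z
    have : joinS (cn P (swap u v * T)) u v u z := by rw [hcn]; trivial
    rcases joinS_apply.1 this with h | h | h
    exacts [Or.inl h, Or.inr h.2, Or.inl h.2]
  set r := cn P (swap u v * T)
  rcases key a with h1 | h1 <;> rcases key b with h2 | h2 <;> rcases key z with h3 | h3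
  all_goals first
    | exact absurd (r.trans' (r.symm' h1) h2) hab
    | exact Or.inl (r.trans' (r.symm' h1) h3)
    | exact Or.inr (r.trans' (r.symm' h2) h3)

theorem Cut.tree (h : Cut P k T) {p q : Fin n} (hp : T p = p) (hq : T q = q)
    (hpq : ¬ cn P T p q) : PTree P k (swap p q * T) := by
  have hne : p ≠ q := by rintro rfl; exact hpq ((cn P T).refl' _)
  refine ⟨sw_invol h.inv hp hq, ?_, by rw [fx_sw h.inv hp hq hne, h.fix]⟩
  rw [cn_sw hp hne, Setoid.eq_top_iff]
  have key : ∀ z, joinS (cn P T) p q p z := fun z => by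
    rw [joinS_apply]
    rcases h.two p q hpq z with h' | h'
    exacts [Or.inl h', Or.inr (Or.inl ⟨(cn P T).refl' _, h'⟩)]
  exact fun x y => Setoid.trans' _ (Setoid.symm' _ (key x)) (key y)

/-- Any state over `T` can be moved to a state over `T'` in `N` steps. -/
def RQ (P : Perm (Fin n)) (k N : ℕ) (T' T'' : Perm (Fin n)) : Prop :=
  ∀ f : Surf n, Good P k f → f R = T' → ∃ f', Good P k f' ∧ f' R = T'' ∧ Conn N f f'

theorem RQ.refl (N : ℕ) (T : Perm (Fin n)) : RQ P k N T T :=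
  fun f hf h => ⟨f, hf, h, Conn.refl _ _⟩

theorem RQ.trans {N M : ℕ} {R₁ R₂ R₃ : Perm (Fin n)} (h : RQ P k N R₁ R₂) (h' : RQ P k M R₂ R₃) :
    RQ P k (N + M) R₁ R₃ := by
  intro f hf hR
  obtain ⟨f', h1, h2, h3⟩ := h f hf hR
  obtain ⟨f'', h4, h5, h6⟩ := h' f' h1 h2
  exact ⟨f'', h4, h5, h3.trans h6⟩

theorem RQ.mono {N M : ℕ} {R₁ R₂ : Perm (Fin n)} (h : RQ P k N R₁ R₂) (hNM : N ≤ M) :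
    RQ P k M R₁ R₂ := by
  intro f hf hR
  obtain ⟨f', h1, h2, h3⟩ := h f hf hR
  exact ⟨f', h1, h2, h3.mono hNM⟩

theorem RQ.conj {σ : Perm (Fin n)} (hσ : σ * P * σ⁻¹ = P) (T : Perm (Fin n)) :
    RQ P k 0 T (σ * T * σ⁻¹) := by
  intro f hf hR
  have := hf.conj σ
  rw [hσ] at this
  exact ⟨_, this, by rw [← hR]; rfl, Conn.iso _ _ _⟩

theorem Good.pair_fix {f : Surf n} (hf : Good P k f) {x y : Fin n} (hxy : x ≠ y) (hx : f R x = x)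
    (hy : f R y = y) (hG : f G x = y) :
    ∃ f', Good P k f' ∧ Step f f' ∧ f' R = swap x y * f R ∧ f' G x = x ∧ f' G y = y := by
  have hG' : f G y = x := by rw [← hG, invol_apply (hf.inv G)]
  obtain ⟨f', h1, h2, -, h3, h4, h5⟩ := hf.vert (c := {x, y}) (u := x) (by simp)
    (by rintro z (rfl | rfl) <;> simp [*]) (by rintro z (rfl | rfl) <;> simp [*])
    (fun Y hY h z hz => by
      rcases hz with rfl | rfl
      · exact hY
      · rw [← hG]; exact (h x hY (by simp)).1)
  refine ⟨f', h1, h2, ?_, by rw [h3 _ (by simp), hx], by rw [h3 _ (by simp), hy]⟩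
  ext1 z
  by_cases hzx : z = x
  · subst hzx; rw [h4 _ (by simp), sw_left hx, hx, hG, hy]
  by_cases hzy : z = y
  · subst hzy; rw [h4 _ (by simp), sw_right hy, hy, hG', hx]
  rw [(h5 z (by simp [hzx, hzy])).2, sw_ne hx hy hzx hzy]

theorem Good.pair_edge {f : Surf n} (hf : Good P k f) {x y : Fin n} (hx : f G x = x)
    (hy : f G y = y) (hR : f R x = y) :
    ∃ f', Good P k f' ∧ Step f f' ∧ f' R = swap x y * f R := by
  have hR' : f R y = x := by rw [← hR, invol_apply (hf.inv R)]
  obtain ⟨f', h1, h2, -, h3, h4, h5⟩ := hf.vert (c := {x, y}) (u := x) (by simp)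
    (by rintro z (rfl | rfl) <;> simp [*]) (by rintro z (rfl | rfl) <;> simp [*])
    (fun Y hY h z hz => by
      rcases hz with rfl | rfl
      · exact hY
      · rw [← hR]; exact (h x hY (by simp)).2)
  refine ⟨f', h1, h2, ?_⟩
  ext1 z
  by_cases hzx : z = x
  · subst hzx; rw [h4 _ (by simp), cut_left hR, hR, hy, hR']
  by_cases hzy : z = y
  · subst hzy; rw [h4 _ (by simp), cut_right (hf.inv R) hR, hR', hx, hR]
  rw [(h5 z (by simp [hzx, hzy])).2, cut_ne (hf.inv R) hR hzx hzy]

/-- Removing an edge whose ends lie on different faces, both folded. -/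
theorem Good.unlink {f : Surf n} (hf : Good P k f) {p q : Fin n} (hR : f R p = q)
    (hpq : ¬ oc (f R * P) p q) (hp : oc (f R * P) (f G p) p) (hq : oc (f R * P) (f G q) q) :
    ∃ f', Good P k f' ∧ Conn 3 f f' ∧ f' R = swap p q * f R := by
  obtain ⟨f1, h1, s1, R1, G1, o1, -⟩ := hf.align hp
  have hq1 : f1 G q = f G q := (o1 q hpq fun h => hpq (Setoid.trans' _ (Setoid.symm' _ hp) h)).1
  obtain ⟨f2, h2, s2, R2, G2, o2, -⟩ := h1.align (x := q) (y := q) (by rw [R1, hq1]; exact hq)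
  have hp2 : f2 G p = p := by
    rw [(o2 p ?_ ?_).1, G1]
    · rw [R1]; exact fun h => hpq (Setoid.symm' _ h)
    · rw [R1, hq1]; exact fun h => hpq (Setoid.trans' _ (Setoid.symm' _ h) hq)
  obtain ⟨f3, h3, s3, R3⟩ := h2.pair_edge hp2 G2 (by rw [R2, R1, hR])
  exact ⟨f3, h3, ((Conn.step s1).trans (Conn.step s2)).trans (Conn.step s3), by rw [R3, R2, R1]⟩

/-- Joining two legs of a tree: the contour splits into two folded faces. -/
theorem Good.link {f : Surf n} (hf : Good P k f) (h : oc (f R * P) = ⊤) {x y : Fin n}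
    (hxy : x ≠ y) (hx : f R x = x) (hy : f R y = y) :
    ∃ f', Good P k f' ∧ Conn 2 f f' ∧ f' R = swap x y * f R ∧ f' G x = x ∧ f' G y = y ∧
      ¬ oc (f' R * P) x y ∧ (∀ z, oc (f' R * P) x z ∨ oc (f' R * P) y z) ∧
      ∀ z, oc (f' R * P) (f' G z) z := by
  obtain ⟨f1, h1, s1, R1, G1, -, -⟩ := hf.align (x := x) (y := y) (by rw [h]; trivial)
  obtain ⟨f2, h2, s2, R2, Gx, Gy⟩ := h1.pair_fix hxy (by rw [R1, hx]) (by rw [R1, hy]) G1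
  have e : f2 R * P = swap x y * (f R * P) := by rw [R2, R1, mul_assoc]
  have hnot : ¬ oc (f2 R * P) x y := by
    rw [e]; exact not_oc_swap_mul hxy (by rw [h]; trivial)
  have hall : ∀ z, oc (f2 R * P) x z ∨ oc (f2 R * P) y z := by
    intro z
    have : joinS (oc (f2 R * P)) x y x z := by
      rw [e, joinS_swap_mul]
      exact le_joinS _ _ _ (by rw [h]; trivial)
    rcases joinS_apply.1 this with h | h | h
    exacts [Or.inl h, Or.inr h.2, Or.inl h.2]
  refine ⟨f2, h2, (Conn.step s1).trans (Conn.step s2), by rw [R2, R1], Gx, Gy, hnot, hall,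
    fun z => ?_⟩
  rcases hall z with h' | h'
  · have := h2.oc_G h'
    rw [Gx] at this
    exact Setoid.trans' _ (Setoid.symm' _ this) h'
  · have := h2.oc_G h'
    rw [Gy] at this
    exact Setoid.trans' _ (Setoid.symm' _ this) h'

theorem Cut.move (h : Cut P k T) (hP : Prof P k) {p q p' q' : Fin n} (hp : T p = p) (hq : T q = q)
    (hpq : ¬ cn P T p q) (hp' : T p' = p') (hq' : T q' = q') (hpq' : ¬ cn P T p' q')
    (h1 : p' ≠ p) (h2 : p' ≠ q) (h3 : q' ≠ p) (h4 : q' ≠ q) :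
    RQ P k 5 (swap p q * T) (swap p' q' * T) := by
  have hT := h.tree hp hq hpq
  have hT' := h.tree hp' hq' hpq'
  have hne : p ≠ q := by rintro rfl; exact hpq ((cn P T).refl' _)
  have hne' : p' ≠ q' := by rintro rfl; exact hpq' ((cn P T).refl' _)
  intro f hf hR
  obtain ⟨f1, g1, c1, R1, -, -, -, -, hG⟩ := hf.link (x := p') (y := q')
    (by rw [hR]; exact hT.trans hP) hne' (by rw [hR, sw_ne hp hq h1 h2, hp'])
    (by rw [hR, sw_ne hp hq h3 h4, hq'])
  have hcomm : swap p q * f1 R = swap p' q' * T := by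
    rw [R1, hR, ← mul_assoc (swap p' q'), ← (Perm.Disjoint.commute
      (Equiv.Perm.disjoint_swap_swap (x := p) (y := q) (z := p') (t := q') (by
        simp [hne, hne', h1.symm, h2.symm, h3.symm, h4.symm]))).eq, mul_assoc, sw_sw]
  have hnot : ¬ oc (f1 R * P) p q := by
    have e : f1 R * P = swap p q * (swap p' q' * T * P) := by
      rw [← hcomm, mul_assoc, sw_sw]
    rw [e]
    exact not_oc_swap_mul hne (by rw [hT'.trans hP]; trivial)
  have hp1 : f1 R p = q := by
    rw [R1, hR, sw_ne, sw_left hp]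
    · rw [sw_ne hp hq h1 h2, hp']
    · rw [sw_ne hp hq h3 h4, hq']
    · exact h1.symm
    · exact h3.symm
  obtain ⟨f2, g2, c2, R2⟩ := g1.unlink hp1 hnot (hG p) (hG q)
  exact ⟨f2, g2, by rw [R2, hcomm], c1.trans c2⟩

end TreeMoves

section Legs
variable {n : ℕ} {P : Perm (Fin n)} {k : ℕ} {S T : Perm (Fin n)}

/-- The points of `A`, glued along `r`, and the points outside `A`, all glued together. -/
def spl (A : Set (Fin n)) (r : Setoid (Fin n)) : Setoid (Fin n) where
  r a b := (a ∈ A ↔ b ∈ A) ∧ (a ∈ A → r a b)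
  iseqv := ⟨fun a => ⟨Iff.rfl, fun _ => r.refl' a⟩, fun h => ⟨h.1.symm, fun hb =>
    r.symm' (h.2 (h.1.2 hb))⟩, fun h h' => ⟨h.1.trans h'.1, fun ha =>
    r.trans' (h.2 ha) (h'.2 (h.1.1 ha))⟩⟩

theorem spl_apply {A : Set (Fin n)} {r : Setoid (Fin n)} {a b : Fin n} :
    spl A r a b ↔ (a ∈ A ↔ b ∈ A) ∧ (a ∈ A → r a b) := Iff.rfl

theorem legs_ge (hP : Prof P k) (hi : T * T = 1) (hfx : fx T = k) (A L : Finset (Fin n))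
    (hA : ∀ x ∈ A, ∀ y, cn P T x y → y ∈ A) (hcon : ∀ x ∉ A, ∀ y ∉ A, cn P T x y)
    (hL : ∀ x, x ∈ L ↔ x ∈ A ∧ T x = x) : (2 : ℚ) + ∑ x ∈ A, wt (oc P) x ≤ L.card := by
  classical
  have hPA : ∀ y, y ∈ A ↔ P y ∈ A := fun y =>
    ⟨fun h => hA y h _ (le_sup_left (a := oc P) (oc_apply P y)),
      fun h => hA _ h _ ((cn P T).symm' (le_sup_left (a := oc P) (oc_apply P y)))⟩
  have hTA : ∀ y, y ∈ A ↔ T y ∈ A := fun y =>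
    ⟨fun h => hA y h _ (le_sup_right (a := oc P) (oc_apply T y)),
      fun h => hA _ h _ ((cn P T).symm' (le_sup_right (a := oc P) (oc_apply T y)))⟩
  set c : Set (Fin n) := {y | y ∉ A} with hc
  have hcl : Closed T c := fun y => not_congr (hTA y).symm
  set U := restrictPerm T c with hU
  have hUi : U * U = 1 := restrict_invol hcl hi
  have hUin : ∀ y, y ∉ A → U y = T y := fun y hy => restrictPerm_mem hcl hy
  have hUout : ∀ y, y ∈ A → U y = y := fun y hy => restrictPerm_not_mem hcl (by simpa [hc] using hy)
  have hfxU : fx U + L.card = k + A.card := by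
    have e : (Finset.univ.filter fun x => U x = x) ∪ L =
        (Finset.univ.filter fun x => T x = x) ∪ A := by
      ext x
      by_cases hx : x ∈ A
      · simp [hx, hUout x hx]
      · simp [hx, hUin x hx, hL]
    have e1 : (Finset.univ.filter fun x => U x = x) ∩ L = L := by
      ext x
      simp only [Finset.mem_inter, Finset.mem_filter, Finset.mem_univ, true_and,
    and_iff_right_iff_imp]
      exact fun h => hUout x ((hL x).1 h).1
    have e2 : (Finset.univ.filter fun x => T x = x) ∩ A = L := by
      ext x; simp [hL, and_comm]
    have h1 := Finset.card_union_add_card_inter (Finset.univ.filter fun x => U x = x) L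
    have h2 := Finset.card_union_add_card_inter (Finset.univ.filter fun x => T x = x) A
    rw [e, e1] at h1
    rw [e2] at h2
    have h3 : (Finset.univ.filter fun x => T x = x).card = k := hfx
    have h4 : fx U = (Finset.univ.filter fun x => U x = x).card := rfl
    omega
  set r := oc P ⊔ oc U with hr
  have h1 : cn P T ≤ spl c r := by
    refine sup_le ?_ ?_ <;> rw [oc_le] <;> intro y <;> rw [spl_apply]
    · exact ⟨not_congr (hPA y), fun _ => le_sup_left (a := oc P) (oc_apply P y)⟩
    · refine ⟨not_congr (hTA y), fun hy => ?_⟩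
      rw [← hUin y hy]
      exact le_sup_right (a := oc P) (oc_apply U y)
  have h2 : r ≤ spl A (oc P) := by
    refine sup_le ?_ ?_ <;> rw [oc_le] <;> intro y <;> rw [spl_apply]
    · exact ⟨hPA y, fun _ => oc_apply P y⟩
    · by_cases hy : y ∈ A
      · rw [hUout y hy]; exact ⟨Iff.rfl, fun _ => (oc P).refl' y⟩
      · rw [hUin y hy]; exact ⟨hTA y, fun h => absurd h hy⟩
  have hs1 : ∀ x ∈ A, sz r x = sz (oc P) x := fun x hx => sz_eq_of_iff fun y =>
    ⟨fun h => (h2 h).2 hx, fun h => le_sup_left (a := oc P) h⟩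
  have hs2 : ∀ x ∈ Aᶜ, (1 : ℚ) / sz r x ≤ 1 / (Aᶜ).card := by
    intro x hx
    have hpos : 0 < (Aᶜ).card := Finset.card_pos.2 ⟨x, hx⟩
    have : (Aᶜ).card ≤ sz r x := by
      refine Finset.card_le_card fun y hy => ?_
      rw [Finset.mem_filter]
      rw [Finset.mem_compl] at hx hy
      exact ⟨Finset.mem_univ _, (h1 (hcon x hx y hy)).2 hx⟩
    have : ((Aᶜ).card : ℚ) ≤ sz r x := by exact_mod_cast this
    have : (0 : ℚ) < (Aᶜ).card := by exact_mod_cast hpos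
    exact one_div_le_one_div_of_le this ‹_›
  have hnc : (nc r : ℚ) ≤ ∑ x ∈ A, 1 / (sz (oc P) x : ℚ) + 1 := by
    rw [nc_eq_sum, ← Finset.sum_add_sum_compl A]
    refine add_le_add (le_of_eq (Finset.sum_congr rfl fun x hx => by rw [hs1 x hx])) ?_
    refine (Finset.sum_le_sum hs2).trans ?_
    rw [Finset.sum_const, nsmul_eq_mul]
    rcases Nat.eq_zero_or_pos (Aᶜ).card with h | h
    · rw [h]; norm_num
    · rw [mul_one_div_cancel]; exact_mod_cast h.ne'
  have hw : ∑ x ∈ A, wt (oc P) x = A.card - 2 * ∑ x ∈ A, 1 / (sz (oc P) x : ℚ) := by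
    simp only [wt]
    rw [Finset.sum_sub_distrib, Finset.sum_const, nsmul_eq_mul, mul_one, Finset.mul_sum]
    exact congrArg _ (Finset.sum_congr rfl fun x _ => by rw [mul_one_div])
  have q1 := nc_sup_oc (oc P) U
  have q2 := nc_invol hUi
  have q3 := hP.eq
  rw [← hr] at q1
  rw [Nat.card_fin] at q1 q2
  have q1' : (nc (oc P) : ℚ) + nc (oc U) ≤ nc r + n := by exact_mod_cast q1
  have q2' : 2 * (nc (oc U) : ℚ) = n + fx U := by exact_mod_cast q2
  have q3' : (n : ℚ) + 4 = 2 * nc (oc P) + k := by exact_mod_cast q3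
  have q4' : (fx U : ℚ) + L.card = k + A.card := by exact_mod_cast hfxU
  linarith

theorem sum_wt_ge (hP : Prof P k) (A X : Finset (Fin n)) (hX : X ⊆ A)
    (hb : ∀ x ∈ X, P (P x) ≠ x) : (X.card : ℚ) / 3 - 1 ≤ ∑ x ∈ A, wt (oc P) x := by
  classical
  have h1 : ∀ x ∈ A, (if x ∈ X then (1 / 3 : ℚ) else 0) - (if P x = x then 1 else 0) ≤
      wt (oc P) x := by
    intro x _
    by_cases h : P x = x
    · have : x ∉ X := fun h' => hb x h' (by rw [h, h])
      rw [if_neg this, if_pos h, wt_fix h]; norm_num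
    · rw [if_neg h]
      split_ifs with h'
      · have := wt_big (hb x h'); linarith
      · have := wt_nonneg h; linarith
  refine le_trans ?_ (Finset.sum_le_sum h1)
  rw [Finset.sum_sub_distrib, Finset.sum_ite_mem, Finset.inter_eq_right.2 hX, Finset.sum_const,
    nsmul_eq_mul]
  have h2 : ∑ x ∈ A, (if P x = x then (1 : ℚ) else 0) ≤ 1 := by
    have h3 : ∑ x ∈ A, (if P x = x then (1 : ℚ) else 0) ≤
        ∑ x, (if P x = x then (1 : ℚ) else 0) :=
      Finset.sum_le_sum_of_subset_of_nonneg (Finset.subset_univ _)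
        fun x _ _ => by split_ifs <;> norm_num
    refine h3.trans ?_
    rw [Finset.sum_boole]
    exact_mod_cast hP.fix
  linarith

theorem sum_wt_nonneg (A : Finset (Fin n)) (h : ∀ x ∈ A, P x ≠ x) :
    0 ≤ ∑ x ∈ A, wt (oc P) x := Finset.sum_nonneg fun x hx => wt_nonneg (h x hx)

theorem Cut.exists_leg (h : Cut P k T) (hP : Prof P k) (z : Fin n) (F X : Finset (Fin n))
    (hX : ∀ x ∈ X, P (P x) ≠ x ∧ cn P T z x) (hF : 3 * F.card < 3 + X.card) :
    ∃ w, w ∉ F ∧ T w = w ∧ cn P T z w := by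
  classical
  have hcon : ∀ x, ¬ cn P T z x → ∀ y, ¬ cn P T z y → cn P T x y := fun x hx y hy =>
    (h.two z x hx y).resolve_left hy
  have h1 := legs_ge hP h.inv h.fix (Finset.univ.filter fun y => cn P T z y)
    (Finset.univ.filter fun y => cn P T z y ∧ T y = y)
    (by simp only [Finset.mem_filter, Finset.mem_univ, true_and]
        exact fun x hx y hy => (cn P T).trans' hx hy)
    (by simpa using hcon) (by simp)
  have h2 := sum_wt_ge hP (Finset.univ.filter fun y => cn P T z y) X
    (fun x hx => by simpa using (hX x hx).2) (fun x hx => (hX x hx).1)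
  have h3 : (3 : ℚ) * F.card < 3 + X.card := by exact_mod_cast hF
  have h4 : (F.card : ℚ) < (Finset.univ.filter fun y => cn P T z y ∧ T y = y).card := by linarith
  obtain ⟨w, hw, hwF⟩ := Finset.exists_mem_notMem_of_card_lt_card
    (by exact_mod_cast h4 : F.card < (Finset.univ.filter fun y => cn P T z y ∧ T y = y).card)
  rw [Finset.mem_filter] at hw
  exact ⟨w, hwF, hw.2.2, hw.2.1⟩

theorem Cut.exists_leg' (h : Cut P k T) (hP : Prof P k) (z u : Fin n)
    (hz : ∀ d, P d = d → ¬ cn P T z d) : ∃ w, w ≠ u ∧ T w = w ∧ cn P T z w := by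
  classical
  have hcon : ∀ x, ¬ cn P T z x → ∀ y, ¬ cn P T z y → cn P T x y := fun x hx y hy =>
    (h.two z x hx y).resolve_left hy
  have h1 := legs_ge hP h.inv h.fix (Finset.univ.filter fun y => cn P T z y)
    (Finset.univ.filter fun y => cn P T z y ∧ T y = y)
    (by simp only [Finset.mem_filter, Finset.mem_univ, true_and]
        exact fun x hx y hy => (cn P T).trans' hx hy)
    (by simpa using hcon) (by simp)
  have h2 := sum_wt_nonneg (P := P) (Finset.univ.filter fun y => cn P T z y)
    (fun x hx hd => hz x hd (by simpa using hx))
  have h4 : (1 : ℚ) < (Finset.univ.filter fun y => cn P T z y ∧ T y = y).card := by linarith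
  obtain ⟨w, hw, hwF⟩ := Finset.exists_mem_ne
    (by exact_mod_cast h4 : 1 < (Finset.univ.filter fun y => cn P T z y ∧ T y = y).card) u
  rw [Finset.mem_filter] at hw
  exact ⟨w, hwF, hw.2.2, hw.2.1⟩

end Legs

section Sub
variable {n : ℕ} {P : Perm (Fin n)} {k : ℕ} {S T : Perm (Fin n)} {p q x y : Fin n}

/-- The involution `S` is obtained from `T` by removing some of its edges. -/
def SubInv (S T : Perm (Fin n)) : Prop := ∀ z, S z ≠ z → T z = S z

theorem SubInv.fixed (h : SubInv S T) {z : Fin n} (hz : T z = z) : S z = z := by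
  by_contra h'
  exact h' ((h z h').symm.trans hz)

theorem SubInv.fixed_right (hS : S * S = 1) (h : SubInv S T) (hp : S p = p)
    (he : T p = q) :
    S q = q := by
  by_contra h'
  have h1 : S (S q) = q := invol_apply hS q
  have h2 : T (S q) = q := by
    rw [h (S q) (by rw [h1]; exact fun h'' => h' h''.symm), h1]
  have : S q = p := T.injective (h2.trans he.symm)
  rw [this, hp] at h1
  rw [← h1, hp] at h'
  exact h' rfl

theorem SubInv.cut (hS : S * S = 1) (hT : T * T = 1) (h : SubInv S T) (hp : S p = p)
    (he : T p = q) :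
    SubInv S (swap p q * T) := by
  intro z hz
  rw [cut_ne hT he, h z hz]
  · rintro rfl; exact hz hp
  · rintro rfl; exact hz (h.fixed_right hS hp he)

theorem SubInv.sw (h : SubInv S T) (hp : T p = p) (hq : T q = q) : SubInv S (swap p q * T) := by
  intro z hz
  rw [sw_ne hp hq, h z hz]
  · rintro rfl; exact hz (h.fixed hp)
  · rintro rfl; exact hz (h.fixed hq)

theorem SubInv.add (hT : T * T = 1) (h : SubInv S T) (hp : S p = p) (hq : S q = q) (he : T p = q) :
    SubInv (swap p q * S) T := by
  intro z hz
  by_cases h1 : z = p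
  · subst h1; rw [sw_left hp, he]
  by_cases h2 : z = q
  · subst h2; rw [sw_right hq, ← he, invol_apply hT]
  rw [sw_ne hp hq h1 h2] at hz ⊢
  exact h z hz

theorem SubInv.cn_le (h : SubInv S T) : cn P S ≤ cn P T := by
  refine sup_le le_sup_left (oc_le.2 fun z => ?_)
  by_cases hz : S z = z
  · rw [hz]
  · rw [← h z hz]; exact le_sup_right (a := oc P) (oc_apply T z)

theorem SubInv.exists_edge (hS : S * S = 1) (hT : T * T = 1) (h : SubInv S T) (hxy : cn P T x y)
    (hn : ¬ cn P S x y) : ∃ p, S p = p ∧ T p ≠ p ∧ cn P (swap p (T p) * T) x p ∧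
      cn P (swap p (T p) * T) (T p) y := by
  induction hm : fx S using Nat.strong_induction_on generalizing S with
  | _ m ih =>
    subst hm
    by_cases hex : ∃ p, S p = p ∧ T p ≠ p
    · obtain ⟨p, hp, hTp⟩ := hex
      have hq := h.fixed_right hS hp rfl
      have hlt := fx_sw hS hp hq hTp.symm
      by_cases hc : cn P (swap p (T p) * S) x y
      · have hle := (h.cut hS hT hp rfl).cn_le (P := P)
        rw [cn_sw hp hTp.symm, joinS_apply] at hc
        rcases hc with hc | ⟨h1, h2⟩ | ⟨h1, h2⟩
        · exact absurd hc hn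
        · exact ⟨p, hp, hTp, hle h1, hle h2⟩
        · refine ⟨T p, hq, ?_, ?_⟩
          · rw [invol_apply hT]; exact hTp.symm
          · rw [invol_apply hT, swap_comm]; exact ⟨hle h1, hle h2⟩
      · obtain ⟨p', h1, h2⟩ := ih _ (by omega) (sw_invol hS hp hq) (h.add hT hp hq rfl) hc rfl
        refine ⟨p', ?_, h2⟩
        have n1 : p' ≠ p := by
          rintro rfl; rw [sw_left hp] at h1; exact hTp h1
        have n2 : p' ≠ T p := by
          rintro rfl; rw [sw_right hq] at h1; exact hTp h1.symm
        rwa [sw_ne hp hq n1 n2] at h1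
    · push Not at hex
      have : SubInv T S := fun z hz => by
        by_contra h'
        by_cases hz' : S z = z
        · exact hz (hex z hz')
        · exact h' (h z hz').symm
      exact absurd (this.cn_le hxy) hn

end Sub

section AddEdge
variable {n : ℕ} {P : Perm (Fin n)} {k : ℕ} {S T : Perm (Fin n)} {p q p' q' x y : Fin n}

/-- Every fixed point of `P` is joined by `S` to a vertex of degree at least three. -/
structure Anchored (P S : Perm (Fin n)) : Prop where
  inv : S * S = 1
  leaf : ∀ d, P d = d → S d ≠ d ∧ P (P (S d)) ≠ S d

theorem Anchored.add (h : Anchored P S) (hp : S p = p) (hq : S q = q) :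
    Anchored P (swap p q * S) := by
  refine ⟨sw_invol h.inv hp hq, fun d hd => ?_⟩
  rw [sw_ne hp hq]
  · exact h.leaf d hd
  · rintro rfl; exact (h.leaf _ hd).1 hp
  · rintro rfl; exact (h.leaf _ hd).1 hq

/-- Three points of the cycle of `a`. -/
def three (P : Perm (Fin n)) (a : Fin n) : Finset (Fin n) := {a, P a, P (P a)}

theorem three_card {a : Fin n} (h : P (P a) ≠ a) : (three P a).card = 3 := by
  have h1 : P a ≠ a := fun h' => h (by rw [h', h'])
  have h2 : P (P a) ≠ P a := fun h' => h1 (P.injective h')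
  exact Finset.card_eq_three.2 ⟨a, P a, P (P a), h1.symm, h.symm, h2.symm, rfl⟩

theorem three_big {a z : Fin n} (h : P (P a) ≠ a) (hz : z ∈ three P a) : P (P z) ≠ z := by
  simp only [three, Finset.mem_insert, Finset.mem_singleton] at hz
  rcases hz with rfl | rfl | rfl
  · exact h
  · exact fun h' => h (P.injective h')
  · exact fun h' => h (P.injective (P.injective h'))

theorem three_oc {a z : Fin n} (hz : z ∈ three P a) : oc P a z := by
  simp only [three, Finset.mem_insert, Finset.mem_singleton] at hz
  rcases hz with rfl | rfl | rfl
  · exact (oc P).refl' _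
  · exact oc_apply P a
  · exact (oc P).trans' (oc_apply P a) (oc_apply P _)

theorem Cut.rich (h : Cut P k T) (hP : Prof P k) (hS : Anchored P S) (hST : SubInv S T)
    (z u : Fin n) : ∃ w, w ≠ u ∧ T w = w ∧ cn P T z w := by
  by_cases hd : ∃ d, P d = d ∧ cn P T z d
  · obtain ⟨d, hd, hz⟩ := hd
    obtain ⟨h1, h2⟩ := hS.leaf d hd
    have h3 : cn P T z (S d) := by
      rw [← hST d h1]
      exact (cn P T).trans' hz (le_sup_right (a := oc P) (oc_apply T d))
    obtain ⟨w, hw, h4⟩ := h.exists_leg hP z {u} (three P (S d)) (fun x hx =>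
      ⟨three_big h2 hx, (cn P T).trans' h3 (le_sup_left (a := oc P) (three_oc hx))⟩)
      (by rw [three_card h2]; simp)
    exact ⟨w, by simpa using hw, h4⟩
  · push Not at hd
    exact h.exists_leg' hP z u hd

theorem Cut.flip_aux (h : Cut P k T) (hP : Prof P k) (hk : 5 ≤ k)
    (rich : ∀ z u, ∃ w, w ≠ u ∧ T w = w ∧ cn P T z w) (hp : T p = p) (hq : T q = q)
    (hpq : ¬ cn P T p q) (hq' : T q' = q') (hqq : cn P T q q') (hne : q ≠ q') :
    RQ P k 15 (swap p q * T) (swap p q' * T) := by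
  classical
  obtain ⟨s, hsp, hs, hps⟩ := rich p p
  have cross : ∀ {a b}, cn P T p a → cn P T q b → ¬ cn P T a b := fun ha hb hab =>
    hpq ((cn P T).trans' ((cn P T).trans' ha hab) ((cn P T).symm' hb))
  have ne : ∀ {a b}, cn P T p a → cn P T q b → a ≠ b := fun ha hb hab =>
    cross ha hb (by rw [hab])
  have rp := (cn P T).refl' p
  have rq := (cn P T).refl' q
  obtain ⟨r, hr, hrF⟩ := Finset.exists_mem_notMem_of_card_lt_card
    (s := {p, s, q, q'}) (t := Finset.univ.filter fun z => T z = z) (by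
      have h1 : (Finset.univ.filter fun z => T z = z).card = k := h.fix
      have h2 := Finset.card_le_four (a := p) (b := s) (c := q) (d := q')
      omega)
  simp only [Finset.mem_filter, Finset.mem_univ, true_and] at hr
  simp only [Finset.mem_insert, Finset.mem_singleton, not_or] at hrF
  obtain ⟨r1, r2, r3, r4⟩ := hrF
  rcases h.two p q hpq r with hpr | hqr
  · have m1 := h.move hP hp hq hpq hs hq' (cross hps hqq) hsp (ne hps rq) (ne rp hqq).symm hne.symm
    have m2 := h.move hP hs hq' (cross hps hqq) hr hq (cross hpr rq) r2 r4 (ne hps rq).symm hne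
    have m3 := h.move hP hr hq (cross hpr rq) hp hq' (cross rp hqq) (Ne.symm r1) (ne rp rq)
      (ne hpr hqq).symm hne.symm
    exact (m1.trans m2).trans m3
  · have m1 := h.move hP hp hq hpq hs hr (cross hps hqr) hsp (ne hps rq) r1 r3
    have m2 := h.move hP hs hr (cross hps hqr) hp hq' (cross rp hqq) hsp.symm (Ne.symm r1)
      (ne hps hqq).symm (Ne.symm r4)
    exact (m1.trans m2).mono (by norm_num)

theorem Cut.flip (h : Cut P k T) (hP : Prof P k) (hk : 5 ≤ k)
    (rich : ∀ z u, ∃ w, w ≠ u ∧ T w = w ∧ cn P T z w) (hp : T p = p) (hq : T q = q)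
    (hpq : ¬ cn P T p q) (hp' : T p' = p') (hq' : T q' = q') (hpq' : ¬ cn P T p' q') :
    RQ P k 15 (swap p q * T) (swap p' q' * T) := by
  have sy : ∀ {a b}, ¬ cn P T a b → ¬ cn P T b a := fun h h' => h ((cn P T).symm' h')
  have aux : ∀ {p' q'}, T p' = p' → T q' = q' → ¬ cn P T p' q' → cn P T p p' →
      RQ P k 15 (swap p q * T) (swap p' q' * T) := by
    intro p' q' hp' hq' hpq' hpp
    have hqq : cn P T q q' := (h.two p q hpq q').resolve_left fun h' =>
      hpq' ((cn P T).trans' ((cn P T).symm' hpp) h')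
    have e1 : p ≠ q' := by rintro rfl; exact hpq' ((cn P T).symm' hpp)
    have e2 : q ≠ p' := by rintro rfl; exact hpq hpp
    by_cases h1 : p = p' <;> by_cases h2 : q = q'
    · subst h1 h2; exact RQ.refl _ _
    · subst h1; exact h.flip_aux hP hk rich hp hq hpq hq' hqq h2
    · subst h2
      rw [swap_comm p, swap_comm p']
      exact h.flip_aux hP hk rich hq hp (sy hpq) hp' hpp h1
    · exact (h.move hP hp hq hpq hp' hq' hpq' (Ne.symm h1) e2.symm e1.symm (Ne.symm h2)).mono
        (by norm_num)
  rcases h.two p q hpq p' with h1 | h1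
  · exact aux hp' hq' hpq' h1
  · rw [swap_comm p' q']
    refine aux hq' hp' (sy hpq') ((h.two p q hpq q').resolve_right fun h' => hpq' ?_)
    exact (cn P T).trans' ((cn P T).symm' h1) h'

/-- A tree containing the edges of `S`. -/
structure TreeOver (P : Perm (Fin n)) (k : ℕ) (S T : Perm (Fin n)) : Prop where
  tree : PTree P k T
  sub : SubInv S T

theorem TreeOver.cut (h : TreeOver P k S T) (hP : Prof P k) (hS : Anchored P S) (hp : S p = p)
    (he : T p = q) (hne : p ≠ q) : Cut P k (swap p q * T) ∧ ¬ cn P (swap p q * T) p q ∧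
      SubInv S (swap p q * T) ∧
      ∀ z u, ∃ w, w ≠ u ∧ (swap p q * T) w = w ∧ cn P (swap p q * T) z w := by
  obtain ⟨h1, h2⟩ := h.tree.cut hP he hne
  have h3 := h.sub.cut hS.inv h.tree.inv hp he
  exact ⟨h1, h2, h3, h1.rich hP hS h3⟩

theorem TreeOver.exchange (h : TreeOver P k S T) (hP : Prof P k) (hk : 5 ≤ k) (hS : Anchored P S)
    (hp : S p = p) (he : T p = q) (hne : p ≠ q) (hp' : (swap p q * T) p' = p')
    (hq' : (swap p q * T) q' = q') (hpq' : ¬ cn P (swap p q * T) p' q') :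
    TreeOver P k S (swap p' q' * (swap p q * T)) ∧
      RQ P k 15 T (swap p' q' * (swap p q * T)) := by
  obtain ⟨h1, h2, h3, h4⟩ := h.cut hP hS hp he hne
  refine ⟨⟨h1.tree hp' hq' hpq', h3.sw hp' hq'⟩, ?_⟩
  have := h1.flip hP hk h4 (cut_left he) (cut_right h.tree.inv he) h2 hp' hq' hpq'
  rwa [sw_sw] at this

end AddEdge

section AddEdge
variable {n : ℕ} {P : Perm (Fin n)} {k : ℕ} {S T : Perm (Fin n)} {x y : Fin n}

theorem TreeOver.add_leg (h : TreeOver P k S T) (hP : Prof P k) (hk : 5 ≤ k) (hS : Anchored P S)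
    (hx : S x = x) (hy : T y = y) (hxy : ¬ cn P S x y) :
    ∃ T', TreeOver P k S T' ∧ T' x = y ∧ RQ P k 45 T T' := by
  have hne : x ≠ y := by rintro rfl; exact hxy ((cn P S).refl' _)
  have hTT := h.tree.inv
  by_cases hTx : T x = x
  · obtain ⟨p, hp, hTp, h1, h2⟩ := h.sub.exists_edge hS.inv hTT
      (x := x) (y := y) (by rw [h.tree.con]; trivial) hxy
    obtain ⟨c1, c2, c3, c4⟩ := h.cut hP hS hp rfl hTp.symm
    have fixed : ∀ {z}, T z = z → (swap p (T p) * T) z = z := fun {z} hz => by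
      rw [cut_ne hTT rfl, hz]
      · rintro rfl; exact hTp hz
      · rintro rfl; exact hTp (T.injective hz)
    obtain ⟨e1, e2⟩ := h.exchange hP hk hS hp rfl hTp.symm (fixed hTx) (fixed hy) fun h' =>
      c2 ((cn P _).trans' ((cn P _).trans' ((cn P _).symm' h1) h') ((cn P _).symm' h2))
    exact ⟨_, e1, sw_left (fixed hTx), e2.mono (by norm_num)⟩
  obtain ⟨a, ha⟩ : ∃ a, T x = a := ⟨_, rfl⟩
  have hxa : x ≠ a := by rw [← ha]; exact Ne.symm hTx
  have ha' : T a = x := by rw [← ha, invol_apply hTT]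
  have hya : y ≠ a := by rintro rfl; exact hne (ha'.symm.trans hy)
  obtain ⟨c1, c2, c3, c4⟩ := h.cut hP hS hx ha hxa
  have cx := cut_left (T := T) ha
  have ca := cut_right hTT ha
  by_cases hcn : cn P (swap x a * T) x y
  swap
  · obtain ⟨e1, e2⟩ := h.exchange hP hk hS hx ha hxa cx (by rw [cut_ne hTT ha hne.symm hya, hy]) hcn
    exact ⟨_, e1, sw_left cx, e2.mono (by norm_num)⟩
  obtain ⟨p, hp, hTp, h1, h2⟩ := c3.exists_edge hS.inv c1.inv hcn hxy
  obtain ⟨q, hq⟩ : ∃ q, (swap x a * T) p = q := ⟨_, rfl⟩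
  rw [hq] at h1 h2 hTp
  have hpx : p ≠ x := by rintro rfl; exact hTp (hq.symm.trans cx)
  have hpa : p ≠ a := by rintro rfl; exact hTp (hq.symm.trans ca)
  rw [cut_ne hTT ha hpx hpa] at hq
  have hqp : T q = p := by rw [← hq, invol_apply hTT]
  have hqx : q ≠ x := by rintro rfl; exact hpa (hqp.symm.trans ha)
  have hqa : q ≠ a := by rintro rfl; exact hpx (hqp.symm.trans ha')
  have hpy : p ≠ y := by rintro rfl; exact hTp (hq.symm.trans hy)
  have hqy : q ≠ y := by rintro rfl; exact hTp (hy.symm.trans hqp)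
  -- the edge from `p` to `q` separates `y` from the edge from `x` to `a`
  obtain ⟨u1, u2, u3, u4⟩ := h.cut hP hS hp hq (Ne.symm hTp)
  set U := swap p q * T with hU
  have Up : U p = p := cut_left hq
  have Uq : U q = q := cut_right hTT hq
  have Une : ∀ {z}, z ≠ p → z ≠ q → U z = T z := fun a b => cut_ne hTT hq a b
  set W0 := swap p q * (swap x a * T) with hW0
  have hq0 : (swap x a * T) p = q := by rw [cut_ne hTT ha hpx hpa, hq]
  have W0U : SubInv W0 U := by
    intro z hz
    have z1 : z ≠ p := by rintro rfl; exact hz (cut_left hq0)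
    have z2 : z ≠ q := by rintro rfl; exact hz (cut_right c1.inv hq0)
    rw [hW0, cut_ne c1.inv hq0 z1 z2] at hz ⊢
    have z3 : z ≠ x := by rintro rfl; exact hz cx
    have z4 : z ≠ a := by rintro rfl; exact hz ca
    rw [cut_ne hTT ha z3 z4, Une z1 z2]
  obtain ⟨l, hlp, hl, hpl⟩ := u4 p p
  have Ux : U x = a := by rw [Une hpx.symm hqx.symm, ha]
  have Ua : U a = x := by rw [Une hpa.symm hqa.symm, ha']
  have Uy : U y = y := by rw [Une hpy.symm hqy.symm, hy]
  have hlx : l ≠ x := by rintro rfl; exact hxa (hl.symm.trans Ux)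
  have hla : l ≠ a := by rintro rfl; exact hxa (Ua.symm.trans hl)
  have hyq : cn P U q y := W0U.cn_le h2
  have hpx' : cn P U p x := (cn P U).symm' (W0U.cn_le h1)
  have hyl : ¬ cn P U y l := fun h' => u2 ((cn P U).trans' ((cn P U).trans' hpl
    ((cn P U).symm' h')) ((cn P U).symm' hyq))
  have hly : y ≠ l := by rintro rfl; exact hyl ((cn P U).refl' _)
  obtain ⟨t1, m1⟩ := h.exchange hP hk hS hp hq (Ne.symm hTp) Uy hl hyl
  set T1 := swap y l * U with hT1
  have T1ne : ∀ {z}, z ≠ y → z ≠ l → T1 z = U z := fun a b => sw_ne Uy hl a b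
  have T1x : T1 x = a := by rw [T1ne hne hlx.symm, Ux]
  have T1y : T1 y = l := sw_left Uy
  obtain ⟨v1, v2, v3, v4⟩ := t1.cut hP hS hx T1x hxa
  set V := swap x a * T1 with hV
  have Vx : V x = x := cut_left T1x
  have Va : V a = a := cut_right t1.tree.inv T1x
  have Vne : ∀ {z}, z ≠ x → z ≠ a → V z = T1 z := fun a b => cut_ne t1.tree.inv T1x a b
  have Vp : V p = p := by rw [Vne hpx hpa, T1ne hpy hlp.symm, Up]
  have W0ne : ∀ {z}, W0 z ≠ z → z ≠ p ∧ z ≠ q ∧ z ≠ x ∧ z ≠ a ∧ z ≠ y ∧ z ≠ l := by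
    intro z hz
    have hUz : U z ≠ z := by rw [W0U z hz]; exact hz
    refine ⟨?_, ?_, ?_, ?_, ?_, ?_⟩
    · rintro rfl; exact hUz Up
    · rintro rfl; exact hUz Uq
    · rintro rfl
      exact hz (by rw [hW0, cut_ne c1.inv hq0 hpx.symm hqx.symm, cx])
    · rintro rfl
      exact hz (by rw [hW0, cut_ne c1.inv hq0 hpa.symm hqa.symm, ca])
    · rintro rfl; exact hUz Uy
    · rintro rfl; exact hUz hl
  have W0V : SubInv W0 V := by
    intro z hz
    obtain ⟨z1, z2, z3, z4, z5, z6⟩ := W0ne hz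
    rw [Vne z3 z4, T1ne z5 z6, W0U z hz]
  obtain ⟨t2, m2⟩ := t1.exchange hP hk hS hx T1x hxa Va Vp fun h' =>
    v2 ((cn P V).trans' (W0V.cn_le h1) ((cn P V).symm' h'))
  set T2 := swap a p * V with hT2
  have T2ne : ∀ {z}, z ≠ a → z ≠ p → T2 z = V z := fun a b => sw_ne Va Vp a b
  have T2y : T2 y = l := by rw [T2ne hya hpy.symm, Vne hne.symm hya, T1y]
  have T2x : T2 x = x := by rw [T2ne hxa hpx.symm, Vx]
  have T2a : T2 a = p := sw_left Va
  have Sy := h.sub.fixed hy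
  obtain ⟨w1, w2, w3, w4⟩ := t2.cut hP hS Sy T2y hly
  set W := swap y l * T2 with hW
  have Wy : W y = y := cut_left T2y
  have Wne : ∀ {z}, z ≠ y → z ≠ l → W z = T2 z := fun a b => cut_ne t2.tree.inv T2y a b
  have W0W : SubInv W0 W := by
    intro z hz
    obtain ⟨z1, z2, z3, z4, z5, z6⟩ := W0ne hz
    rw [Wne z5 z6, T2ne z4 z1, W0V z hz]
  have Wxp : cn P W x p := W0W.cn_le h1
  have Wxa : cn P W x a := by
    refine (cn P W).trans' Wxp ((cn P W).symm' ?_)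
    have : W a = p := by rw [Wne hya.symm hla.symm, T2a]
    rw [← this]
    exact le_sup_right (a := oc P) (oc_apply W a)
  have UW : cn P U ≤ cn P W := by
    refine sup_le le_sup_left (oc_le.2 fun z => ?_)
    by_cases z1 : z = x
    · rw [z1, Ux]; exact Wxa
    by_cases z2 : z = a
    · rw [z2, Ua]; exact (cn P W).symm' Wxa
    by_cases z3 : U z = z
    · rw [z3]
    have z4 : z ≠ p := by rintro rfl; exact z3 Up
    have z5 : z ≠ y := by rintro rfl; exact z3 Uy
    have z6 : z ≠ l := by rintro rfl; exact z3 hl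
    have : W z = U z := by rw [Wne z5 z6, T2ne z2 z4, Vne z1 z2, T1ne z5 z6]
    rw [← this]
    exact le_sup_right (a := oc P) (oc_apply W z)
  have Wx : W x = x := by rw [Wne hne hlx.symm, T2x]
  obtain ⟨t3, m3⟩ := t2.exchange hP hk hS Sy T2y hly Wx Wy fun h' =>
    w2 ((cn P W).trans' ((cn P W).symm' h') ((cn P W).trans' Wxp (UW hpl)))
  exact ⟨_, t3, sw_left Wx, (m1.trans m2).trans m3⟩

/-- Any edge not creating a cycle can be added, keeping the edges of `S`. -/
theorem TreeOver.add_edge (h : TreeOver P k S T) (hP : Prof P k) (hk : 5 ≤ k) (hS : Anchored P S)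
    (hx : S x = x) (hy : S y = y) (hxy : ¬ cn P S x y) :
    ∃ T', TreeOver P k S T' ∧ T' x = y ∧ RQ P k 60 T T' := by
  have hyx : ¬ cn P S y x := fun h' => hxy ((cn P S).symm' h')
  have hne : x ≠ y := by rintro rfl; exact hxy ((cn P S).refl' _)
  have rev : ∀ {T'}, TreeOver P k S T' → T' y = x → T' x = y := fun h' h'' => by
    rw [← h'', invol_apply h'.tree.inv]
  by_cases hTy : T y = y
  · obtain ⟨T', h1, h2, h3⟩ := h.add_leg hP hk hS hx hTy hxy
    exact ⟨T', h1, h2, h3.mono (by norm_num)⟩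
  by_cases hTx : T x = x
  · obtain ⟨T', h1, h2, h3⟩ := h.add_leg hP hk hS hy hTx hyx
    exact ⟨T', h1, rev h1 h2, h3.mono (by norm_num)⟩
  by_cases hTxy : T x = y
  · exact ⟨T, h, hTxy, RQ.refl _ _⟩
  obtain ⟨c1, c2, c3, c4⟩ := h.cut hP hS hx rfl (Ne.symm hTx)
  obtain ⟨l, hlx, hl, hxl⟩ := c4 x x
  have hTT := h.tree.inv
  have ca := cut_right hTT (rfl : T x = T x)
  have hla : l ≠ T x := by rintro rfl; exact c2 hxl
  obtain ⟨t1, m1⟩ := h.exchange hP hk hS hx rfl (Ne.symm hTx) hl ca fun h' =>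
    c2 ((cn P _).trans' hxl h')
  obtain ⟨T', h1, h2, h3⟩ := t1.add_leg hP hk hS hy (by
    rw [sw_ne hl ca hlx.symm (Ne.symm hTx), cut_left rfl]) hyx
  exact ⟨T', h1, rev h1 h2, m1.trans h3⟩

end AddEdge

section Dihedral
variable {n : ℕ}

theorem cn_ind {P T : Perm (Fin n)} {x y : Fin n} (h : cn P T x y) {A : Set (Fin n)} (hx : x ∈ A)
    (hA : ∀ z ∈ A, P z ∈ A ∧ T z ∈ A) : y ∈ A := by
  have pw : ∀ {σ : Perm (Fin n)}, (∀ z ∈ A, σ z ∈ A) → ∀ z, z ∈ A ↔ σ z ∈ A := by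
    intro σ hσ z
    refine ⟨hσ z, fun hz => ?_⟩
    obtain ⟨i, hi⟩ := SameCycle.exists_nat_pow_eq (oc_apply' σ z)
    rw [← hi]
    clear hi
    induction i with
    | zero => exact hz
    | succ i ih => rw [pow_succ', Perm.mul_apply]; exact hσ _ ih
  have : cn P T ≤ spl A ⊤ := by
    refine sup_le ?_ ?_ <;> rw [oc_le] <;> intro z
    · exact ⟨pw (fun z hz => (hA z hz).1) z, fun _ => trivial⟩
    · exact ⟨pw (fun z hz => (hA z hz).2) z, fun _ => trivial⟩
  exact (this h).1.1 hx

theorem dihedral_zpow {D : Set (Fin n)} {p r : Perm (Fin n)} {e : Fin n}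
    (hp : ∀ z ∈ D, p z ∈ D ∧ p (p z) = z) (hr : ∀ z ∈ D, r z ∈ D ∧ r (r z) = z)
    (he : e ∈ D) (re : r e = e) (i : ℤ) : ((p * r) ^ i) e ∈ D ∧
      r (((p * r) ^ i) e) = ((p * r) ^ (-i)) e ∧ p (((p * r) ^ i) e) = ((p * r) ^ (1 - i)) e := by
  set κ := p * r with hκ
  have hinv : ∀ z ∈ D, κ⁻¹ z = r (p z) := by
    intro z hz
    rw [Perm.inv_eq_iff_eq, hκ, Perm.mul_apply, (hr _ (hp z hz).1).2, (hp z hz).2]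
  have main : ∀ i : ℤ, (κ ^ i) e ∈ D ∧ r ((κ ^ i) e) = (κ ^ (-i)) e := by
    intro i
    induction i with
    | zero => exact ⟨he, by simpa using re⟩
    | succ i ih =>
      obtain ⟨h1, h2⟩ := ih
      have e1 : (κ ^ ((i : ℤ) + 1)) e = p (r ((κ ^ (i : ℤ)) e)) := by
        rw [add_comm, zpow_add, zpow_one]; rfl
      refine ⟨by rw [e1]; exact (hp _ (hr _ h1).1).1, ?_⟩
      rw [e1, ← hinv _ (hr _ h1).1, h2, ← Perm.mul_apply, ← zpow_neg_one, ← zpow_add]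
      congr 2; ring
    | pred i ih =>
      obtain ⟨h1, h2⟩ := ih
      have e1 : (κ ^ (-(i : ℤ) - 1)) e = r (p ((κ ^ (-(i : ℤ))) e)) := by
        rw [← hinv _ h1, ← Perm.mul_apply, ← zpow_neg_one, ← zpow_add]; congr 2; ring
      refine ⟨by rw [e1]; exact (hr _ (hp _ h1).1).1, ?_⟩
      rw [e1, (hr _ (hp _ h1).1).2]
      conv_lhs => rw [← (hr _ h1).2, h2]
      rw [← Perm.mul_apply, ← hκ, ← Perm.mul_apply, ← zpow_one_add]
      congr 2; ring
  obtain ⟨h1, h2⟩ := main i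
  refine ⟨h1, h2, ?_⟩
  conv_lhs => rw [← (hr _ h1).2, h2]
  rw [← Perm.mul_apply, ← hκ, ← Perm.mul_apply, ← zpow_one_add]
  congr 2

theorem zpow_eq_iff_dvd {D : Set (Fin n)} {κ : Perm (Fin n)} {e : Fin n}
    (h : ∀ z, z ∈ D ↔ ∃ i : ℤ, (κ ^ i) e = z) (i j : ℤ) :
    (κ ^ i) e = (κ ^ j) e ↔ (Nat.card D : ℤ) ∣ i - j := by
  classical
  have h1 : MulAction.orbit (Subgroup.zpowers κ) e = D := by
    ext z
    rw [h, MulAction.mem_orbit_iff]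
    constructor
    · rintro ⟨⟨_, i, rfl⟩, rfl⟩; exact ⟨i, rfl⟩
    · rintro ⟨i, rfl⟩; exact ⟨⟨κ ^ i, i, rfl⟩, rfl⟩
  have h2 : Nat.card D = Function.minimalPeriod (κ • ·) e := by
    rw [← h1, Nat.card_eq_fintype_card, MulAction.minimalPeriod_eq_card]
  rw [h2, ← MulAction.zpow_smul_eq_iff_minimalPeriod_dvd]
  rw [sub_eq_neg_add, zpow_add, zpow_neg, mul_smul, inv_smul_eq_iff]
  rfl

/-- Two dihedral paths on the same set are conjugate. -/
theorem exists_dihedral_conj {D : Set (Fin n)} {p r r' : Perm (Fin n)} {e e' : Fin n}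
    (hp : ∀ z ∈ D, p z ∈ D ∧ p (p z) = z) (hr : ∀ z ∈ D, r z ∈ D ∧ r (r z) = z)
    (hr' : ∀ z ∈ D, r' z ∈ D ∧ r' (r' z) = z) (he : e ∈ D) (re : r e = e) (he' : e' ∈ D)
    (re' : r' e' = e')
    (con : ∀ A : Set (Fin n), e ∈ A → (∀ z ∈ A, z ∈ D → p z ∈ A ∧ r z ∈ A) → D ⊆ A)
    (con' : ∀ A : Set (Fin n), e' ∈ A → (∀ z ∈ A, z ∈ D → p z ∈ A ∧ r' z ∈ A) → D ⊆ A) :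
    ∃ σ : Perm (Fin n), (∀ z ∉ D, σ z = z) ∧
      (∀ z ∈ D, σ z ∈ D ∧ σ (p z) = p (σ z) ∧ σ (r z) = r' (σ z)) ∧ σ e = e' := by
  classical
  have orb : ∀ {r : Perm (Fin n)} {e}, (∀ z ∈ D, r z ∈ D ∧ r (r z) = z) → e ∈ D → r e = e →
      (∀ A : Set (Fin n), e ∈ A → (∀ z ∈ A, z ∈ D → p z ∈ A ∧ r z ∈ A) → D ⊆ A) →
      ∀ z, z ∈ D ↔ ∃ i : ℤ, ((p * r) ^ i) e = z := by
    intro r e hr he re con z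
    constructor
    · intro hz
      refine con {z | ∃ i : ℤ, ((p * r) ^ i) e = z} ⟨0, rfl⟩ ?_ hz
      rintro z ⟨i, rfl⟩ -
      obtain ⟨-, h2, h3⟩ := dihedral_zpow hp hr he re i
      exact ⟨⟨_, h3.symm⟩, ⟨_, h2.symm⟩⟩
    · rintro ⟨i, rfl⟩; exact (dihedral_zpow hp hr he re i).1
  have o1 := orb hr he re con
  have o2 := orb hr' he' re' con'
  have d1 := zpow_eq_iff_dvd o1
  have d2 := zpow_eq_iff_dvd o2
  choose idx hidx using fun z (hz : z ∈ D) => (o1 z).1 hz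
  let F : Fin n → Fin n := fun z => if hz : z ∈ D then ((p * r') ^ idx z hz) e' else z
  have Fout : ∀ z, z ∉ D → F z = z := fun z hz => dif_neg hz
  have Fin' : ∀ i : ℤ, F (((p * r) ^ i) e) = ((p * r') ^ i) e' := by
    intro i
    have hz : ((p * r) ^ i) e ∈ D := (o1 _).2 ⟨i, rfl⟩
    have : F (((p * r) ^ i) e) = ((p * r') ^ idx _ hz) e' := dif_pos hz
    rw [this, d2, ← d1, hidx]
  have FD : ∀ z ∈ D, F z ∈ D := by
    intro z hz
    obtain ⟨i, rfl⟩ := (o1 z).1 hz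
    rw [Fin']; exact (o2 _).2 ⟨i, rfl⟩
  have inj : Function.Injective F := by
    intro a b hab
    by_cases ha : a ∈ D <;> by_cases hb : b ∈ D
    · obtain ⟨i, rfl⟩ := (o1 a).1 ha
      obtain ⟨j, rfl⟩ := (o1 b).1 hb
      rwa [Fin', Fin', d2, ← d1] at hab
    · rw [Fout b hb] at hab; exact absurd (hab ▸ FD a ha) hb
    · rw [Fout a ha] at hab; exact absurd (hab ▸ FD b hb) ha
    · rwa [Fout a ha, Fout b hb] at hab
  refine ⟨Equiv.ofBijective F (Finite.injective_iff_bijective.1 inj), Fout, ?_, Fin' 0⟩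
  intro z hz
  refine ⟨FD z hz, ?_⟩
  obtain ⟨i, rfl⟩ := (o1 z).1 hz
  obtain ⟨-, h2, h3⟩ := dihedral_zpow hp hr he re i
  obtain ⟨-, h2', h3'⟩ := dihedral_zpow hp hr' he' re' i
  simp only [Equiv.ofBijective_apply]
  rw [h2, h3, Fin', Fin', Fin', h2', h3']
  exact ⟨rfl, rfl⟩

end Dihedral

section Chains
variable {n : ℕ} {P : Perm (Fin n)} {k : ℕ} {L S T : Perm (Fin n)} {x y z : Fin n}

/-- The points lying on cycles of length two. -/
def deg2 (P : Perm (Fin n)) (z : Fin n) : Prop := P z ≠ z ∧ P (P z) = z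

theorem deg2.apply (h : deg2 P z) : deg2 P (P z) :=
  ⟨fun h' => h.1 (P.injective h'), by rw [h.2]⟩

/-- The number of fixed points of `S` on cycles of length two. -/
noncomputable def slack (P S : Perm (Fin n)) : ℕ := {z | deg2 P z ∧ S z = z}.ncard

/-- A tree `T` with a chosen set `S` of edges, which differs from `L` only by edges between
vertices of degree two. -/
structure Chain (P : Perm (Fin n)) (k : ℕ) (L S T : Perm (Fin n)) : Prop where
  base : TreeOver P k S T
  anch : Anchored P S
  off : ∀ z, ¬ deg2 P z → S z = L z
  on : ∀ z, deg2 P z → deg2 P (S z)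

theorem Prof.exists_odd (hP : Prof P k) (hk : 5 ≤ k) : ∃ z, ¬ deg2 P z := by
  by_contra! h
  have h1 : P * P = 1 := by ext1 z; exact (h z).2
  have h2 := nc_invol h1
  have h3 : fx P = 0 := by
    rw [fx, Finset.card_eq_zero, Finset.filter_eq_empty_iff]
    exact fun z _ => (h z).1
  have h4 := hP.eq
  rw [Nat.card_fin] at h2
  omega

theorem Chain.exists_free (h : Chain P k L S T) (hP : Prof P k) (hk : 5 ≤ k) (hx : deg2 P x) :
    ∃ y, deg2 P y ∧ S y = y ∧ cn P S x y := by
  by_contra! hn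
  obtain ⟨w, hw⟩ := hP.exists_odd hk
  have hxw : cn P T x w := by rw [h.base.tree.con]; trivial
  refine hw (cn_ind hxw (A := {z | deg2 P z ∧ cn P S x z}) ⟨hx, (cn P S).refl' _⟩ ?_).1
  rintro z ⟨h1, h2⟩
  refine ⟨⟨h1.apply, (cn P S).trans' h2 (le_sup_left (a := oc P) (oc_apply P z))⟩, ?_⟩
  rw [h.base.sub z fun h3 => hn z h1 h3 h2]
  exact ⟨h.on z h1, (cn P S).trans' h2 (le_sup_right (a := oc P) (oc_apply S z))⟩

theorem ncard_fx (T : Perm (Fin n)) : {z | T z = z}.ncard = fx T := by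
  rw [Set.ncard_eq_toFinset_card', fx]; congr 1; ext z; simp

theorem Prof.ncard_odd (hP : Prof P k) : {z | ¬ deg2 P z}.ncard + 8 ≤ 3 * k := by
  classical
  rw [Set.ncard_eq_toFinset_card']
  refine hP.card_odd _ fun x hx => ?_
  simp only [Set.mem_toFinset, Set.mem_ofPred_eq, deg2, not_and_or, not_not] at hx
  exact hx.symm

theorem TreeOver.chain (h : TreeOver P k L T) (hP : Prof P k) (hL : Anchored P L)
    (hL2 : ∀ z, deg2 P z → L z = z) : ∃ S, Chain P k L S T ∧ slack P S ≤ 4 * k := by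
  set Q : Set (Fin n) := {z | deg2 P z ∧ deg2 P (T z)} with hQ
  have hTT := h.tree.inv
  have hc : Closed T Q := fun z => by
    simp only [hQ, Set.mem_ofPred_eq, invol_apply hTT]; exact and_comm
  set S := L * restrictPerm T Q with hS
  have S1 : ∀ {z}, z ∈ Q → S z = T z := fun {z} hz => by
    rw [hS, Perm.mul_apply, restrictPerm_mem hc hz, hL2 _ hz.2]
  have S2 : ∀ {z}, z ∉ Q → S z = L z := fun {z} hz => by
    rw [hS, Perm.mul_apply, restrictPerm_not_mem hc hz]
  have LQ : ∀ {z}, z ∉ Q → L z ∉ Q := fun {z} hz hL' => by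
    have h1 := hL2 _ hL'.1
    have h2 := L.injective h1
    rw [h2] at hL'
    exact hz hL'
  have inv : S * S = 1 := by
    ext1 z
    rw [Perm.mul_apply, Perm.one_apply]
    by_cases hz : z ∈ Q
    · rw [S1 hz, S1 ((hc z).2 hz), invol_apply hTT]
    · rw [S2 hz, S2 (LQ hz), invol_apply hL.inv]
  have sub : SubInv S T := fun z hz => by
    by_cases h1 : z ∈ Q
    · rw [S1 h1]
    · rw [S2 h1] at hz ⊢; exact h.sub z hz
  refine ⟨S, ⟨⟨h.tree, sub⟩, ⟨inv, fun d hd => ?_⟩, fun z hz => S2 fun h' => hz h'.1,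
    fun z hz => ?_⟩, ?_⟩
  · rw [S2 fun h' => h'.1.1 hd]; exact hL.leaf d hd
  · by_cases h1 : z ∈ Q
    · rw [S1 h1]; exact h1.2
    · rw [S2 h1, hL2 z hz]; exact hz
  · have h1 : {z | deg2 P z ∧ S z = z} ⊆ {z | T z = z} ∪ T '' {z | ¬ deg2 P z} := by
      rintro z ⟨h1, h2⟩
      by_cases h3 : z ∈ Q
      · exact Or.inl ((S1 h3).symm.trans h2)
      · exact Or.inr ⟨T z, fun h' => h3 ⟨h1, h'⟩, invol_apply hTT z⟩
    have h2 := Set.ncard_le_ncard h1 (Set.toFinite _)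
    have h3 := Set.ncard_union_le {z | T z = z} (T '' {z | ¬ deg2 P z})
    rw [ncard_fx, Set.ncard_image_of_injective _ T.injective] at h3
    have h4 := hP.ncard_odd
    have h5 := h.tree.fix
    unfold slack
    omega

theorem Chain.complete (h : Chain P k L S T) (hP : Prof P k) (hk : 5 ≤ k) :
    ∃ S' T', Chain P k L S' T' ∧ (∀ x y, deg2 P x → deg2 P y → cn P S' x y) ∧
      slack P S' ≤ slack P S ∧ RQ P k (60 * slack P S) T T' := by
  induction hm : slack P S using Nat.strong_induction_on generalizing S T with
  | _ m ih =>
    by_cases hall : ∀ x y, deg2 P x → deg2 P y → cn P S x y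
    · exact ⟨S, T, h, hall, hm.le, RQ.refl _ _⟩
    push Not at hall
    obtain ⟨x, y, hx, hy, hxy⟩ := hall
    obtain ⟨x', h1, h2, h3⟩ := h.exists_free hP hk hx
    obtain ⟨y', h4, h5, h6⟩ := h.exists_free hP hk hy
    have hxy' : ¬ cn P S x' y' := fun h' =>
      hxy ((cn P S).trans' h3 ((cn P S).trans' h' ((cn P S).symm' h6)))
    have hne : x' ≠ y' := by rintro rfl; exact hxy' ((cn P S).refl' _)
    obtain ⟨T₁, t1, t2, t3⟩ := h.base.add_edge hP hk h.anch h2 h5 hxy'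
    have hc : Chain P k L (swap x' y' * S) T₁ := by
      refine ⟨⟨t1.tree, t1.sub.add t1.tree.inv h2 h5 t2⟩, h.anch.add h2 h5, fun z hz => ?_,
        fun z hz => ?_⟩
      · rw [sw_ne h2 h5]
        · exact h.off z hz
        · rintro rfl; exact hz h1
        · rintro rfl; exact hz h4
      · by_cases z1 : z = x'
        · rw [z1, sw_left h2]; exact h4
        by_cases z2 : z = y'
        · rw [z2, sw_right h5]; exact h1
        rw [sw_ne h2 h5 z1 z2]; exact h.on z hz
    have hlt : slack P (swap x' y' * S) < slack P S := by
      refine Set.ncard_lt_ncard ⟨?_, fun hsub => ?_⟩ (Set.toFinite _)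
      · rintro z ⟨z1, z2⟩
        refine ⟨z1, ?_⟩
        rw [sw_ne h2 h5] at z2
        · exact z2
        · rintro rfl; rw [sw_left h2] at z2; exact hne z2.symm
        · rintro rfl; rw [sw_right h5] at z2; exact hne z2
      · have := (hsub ⟨h1, h2⟩ : _ ∧ _).2
        rw [sw_left h2] at this
        exact hne this.symm
    rw [hm] at hlt
    obtain ⟨S', T', r1, r2, r3, r4⟩ := ih _ hlt hc rfl
    exact ⟨S', T', r1, r2, by omega, (t3.trans r4).mono (by omega)⟩

theorem Chain.exists_conj {S' T' : Perm (Fin n)} (h : Chain P k L S T) (h' : Chain P k L S' T')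
    (hP : Prof P k) (hk : 5 ≤ k) (hc : ∀ x y, deg2 P x → deg2 P y → cn P S x y)
    (hc' : ∀ x y, deg2 P x → deg2 P y → cn P S' x y) :
    ∃ σ : Perm (Fin n), σ * P * σ⁻¹ = P ∧ σ * S * σ⁻¹ = S' := by
  by_cases hE : ∃ e, deg2 P e
  swap
  · push Not at hE
    refine ⟨1, by simp, ?_⟩
    ext1 z
    rw [one_mul, inv_one, mul_one, h.off z (hE z), h'.off z (hE z)]
  obtain ⟨e₀, he₀⟩ := hE
  obtain ⟨e, e1, e2, -⟩ := h.exists_free hP hk he₀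
  obtain ⟨e', e1', e2', -⟩ := h'.exists_free hP hk he₀
  have con : ∀ {S : Perm (Fin n)} {e}, (∀ z, deg2 P z → deg2 P (S z)) →
      (∀ x y, deg2 P x → deg2 P y → cn P S x y) → deg2 P e → ∀ A : Set (Fin n), e ∈ A →
      (∀ z ∈ A, z ∈ {z | deg2 P z} → P z ∈ A ∧ S z ∈ A) → {z | deg2 P z} ⊆ A := by
    intro S e h1 h2 h3 A h4 h5 z hz
    exact (cn_ind (h2 e z h3 hz) (A := {z | deg2 P z} ∩ A) ⟨h3, h4⟩ fun w hw =>
      ⟨⟨hw.1.apply, (h5 w hw.2 hw.1).1⟩, ⟨h1 w hw.1, (h5 w hw.2 hw.1).2⟩⟩).2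
  obtain ⟨σ, s1, s2, -⟩ := exists_dihedral_conj (D := {z | deg2 P z}) (p := P) (r := S) (r' := S')
    (fun z hz => ⟨hz.apply, hz.2⟩) (fun z hz => ⟨h.on z hz, invol_apply h.anch.inv z⟩)
    (fun z hz => ⟨h'.on z hz, invol_apply h'.anch.inv z⟩) e1 e2 e1' e2'
    (con h.on hc e1) (con h'.on hc' e1')
  refine ⟨σ, ?_, ?_⟩ <;> rw [mul_inv_eq_iff_eq_mul] <;> ext1 z <;>
    rw [Perm.mul_apply, Perm.mul_apply] <;> by_cases hz : deg2 P z
  · exact (s2 z hz).2.1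
  · rw [s1 z hz, s1 _ fun h1 => hz ?_]
    exact ⟨fun h2 => h1.1 (by rw [h2, h2]), P.injective h1.2⟩
  · exact (s2 z hz).2.2
  · rw [s1 z hz, h.off z hz, h'.off z hz, s1]
    intro h1
    apply hz
    have h2 := h.on _ h1
    rwa [← h.off z hz, invol_apply h.anch.inv] at h2

/-- The number of points at which `T'` has an edge that `T` does not have. -/
noncomputable def diffs (T T' : Perm (Fin n)) : ℕ := {z | T' z ≠ z ∧ T z ≠ T' z}.ncard

theorem TreeOver.merge {T' : Perm (Fin n)} (h : TreeOver P k S T) (h' : TreeOver P k S T')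
    (hS : Anchored P S) (hP : Prof P k) (hk : 5 ≤ k) : RQ P k (60 * diffs T T') T T' := by
  induction hm : diffs T T' using Nat.strong_induction_on generalizing T with
  | _ m ih =>
    have hTT := h.tree.inv
    have hTT' := h'.tree.inv
    by_cases hbad : ∃ z, T' z ≠ z ∧ T z ≠ T' z
    swap
    · push Not at hbad
      have h1 : ∀ z, T z = z → T' z = z := fun z hz => by
        by_contra h2; exact h2 ((hbad z h2).symm.trans hz)
      have h2 : {z | T z = z} = {z | T' z = z} := by
        refine Set.eq_of_subset_of_ncard_le h1 ?_ (Set.toFinite _)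
        rw [ncard_fx, ncard_fx]
        have := h.tree.fix
        have := h'.tree.fix
        omega
      have : T = T' := by
        ext1 z
        by_cases hz : T' z = z
        · rw [hz]; exact (Set.ext_iff.1 h2 z).2 hz
        · exact hbad z hz
      rw [this]; exact RQ.refl _ _
    obtain ⟨z, z1, z2⟩ := hbad
    set Q : Set (Fin n) := {z | T z = T' z} with hQ
    have hc : Closed T Q := by
      have : ∀ z, z ∈ Q → T z ∈ Q := fun z hz => by
        have hz' : T z = T' z := hz
        change T (T z) = T' (T z)
        rw [invol_apply hTT, hz', invol_apply hTT']
      exact fun z => ⟨fun hz => by simpa only [invol_apply hTT] using this _ hz, this z⟩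
    set S₁ := restrictPerm T Q with hS₁
    have q1 : ∀ {z}, z ∈ Q → S₁ z = T z := fun hz => restrictPerm_mem hc hz
    have q2 : ∀ {z}, z ∉ Q → S₁ z = z := fun hz => restrictPerm_not_mem hc hz
    have inv₁ : S₁ * S₁ = 1 := restrict_invol hc hTT
    have SS₁ : ∀ z, S z ≠ z → S₁ z = S z := fun z hz => by
      rw [q1 ((h.sub z hz).trans (h'.sub z hz).symm), h.sub z hz]
    have sub : SubInv S₁ T := fun z hz => by
      by_cases h1 : z ∈ Q
      · rw [q1 h1]
      · exact absurd (q2 h1) hz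
    have sub' : SubInv S₁ T' := fun z hz => by
      by_cases h1 : z ∈ Q
      · rw [q1 h1]; exact Eq.symm h1
      · exact absurd (q2 h1) hz
    have anch₁ : Anchored P S₁ := ⟨inv₁, fun d hd => by
      obtain ⟨h1, h2⟩ := hS.leaf d hd
      rw [SS₁ d h1]; exact ⟨h1, h2⟩⟩
    have hz : S₁ z = z := q2 z2
    obtain ⟨w, hw⟩ : ∃ w, T' z = w := ⟨_, rfl⟩
    have hzw : z ≠ w := by rw [← hw]; exact z1.symm
    have hw1 : S₁ w = w := sub'.fixed_right inv₁ hz hw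
    have hcn : ¬ cn P S₁ z w := fun h1 =>
      (h'.tree.cut hP hw hzw).2 ((sub'.cut inv₁ hTT' hz hw).cn_le h1)
    obtain ⟨T₁, t1, t2, t3⟩ := (⟨h.tree, sub⟩ : TreeOver P k S₁ T).add_edge hP hk anch₁ hz hw1 hcn
    have hlt : diffs T₁ T' < diffs T T' := by
      refine Set.ncard_lt_ncard ⟨?_, fun hsub => ?_⟩ (Set.toFinite _)
      · rintro v ⟨v1, v2⟩
        refine ⟨v1, fun v3 => v2 ?_⟩
        rw [← v3, ← q1 v3]
        exact t1.sub v (by rw [q1 v3, v3]; exact v1)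
      · exact (hsub ⟨z1, z2⟩ : _ ∧ _).2 (t2.trans hw.symm)
    rw [hm] at hlt
    have hbase : TreeOver P k S T₁ := ⟨t1.tree, fun v hv => by
      rw [← SS₁ v hv]; exact t1.sub v (by rw [SS₁ v hv]; exact hv)⟩
    exact (t3.trans (ih _ hlt hbase rfl)).mono (by omega)

theorem Chain.diffs_le {T' : Perm (Fin n)} (h : Chain P k L S T) (h' : TreeOver P k S T')
    (hP : Prof P k) : diffs T T' + 8 ≤ slack P S + 3 * k := by
  have h1 : {z | T' z ≠ z ∧ T z ≠ T' z} ⊆ {z | deg2 P z ∧ S z = z} ∪ {z | ¬ deg2 P z} := by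
    rintro z ⟨z1, z2⟩
    by_cases h3 : deg2 P z
    · refine Or.inl ⟨h3, ?_⟩
      by_contra h4
      exact z2 ((h.base.sub z h4).trans (h'.sub z h4).symm)
    · exact Or.inr h3
  have h2 := Set.ncard_le_ncard h1 (Set.toFinite _)
  have h3 := Set.ncard_union_le {z | deg2 P z ∧ S z = z} {z | ¬ deg2 P z}
  have h4 := hP.ncard_odd
  unfold slack diffs
  omega

theorem Good.conn_of_sub {f g : Surf n} (hf : Good P k f) (hg : Good P k g) (hP : Prof P k)
    (hk : 5 ≤ k) (hL : Anchored P L) (hL2 : ∀ z, deg2 P z → L z = z)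
    (tf : TreeOver P k L (f R)) (tg : TreeOver P k L (g R)) : Conn (901 * k) f g := by
  obtain ⟨S, c1, c2⟩ := tf.chain hP hL hL2
  obtain ⟨S', c1', c2'⟩ := tg.chain hP hL hL2
  obtain ⟨S₁, T₁, d1, d2, d3, d4⟩ := c1.complete hP hk
  obtain ⟨S₁', T₁', d1', d2', d3', d4'⟩ := c1'.complete hP hk
  obtain ⟨σ, hσ, hσS⟩ := d1'.exists_conj d1 hP hk d2' d2
  obtain ⟨f₁, f1, f2, f3⟩ := d4 f hf rfl
  obtain ⟨g₁, g1, g2, g3⟩ := d4' g hg rfl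
  obtain ⟨g₂, g4, g5, g6⟩ := RQ.conj hσ _ g₁ g1 g2
  have ho : oc (g₂ R * P) = ⊤ := by
    rw [g5]
    nth_rewrite 1 [← hσ]
    rw [show σ * T₁' * σ⁻¹ * (σ * P * σ⁻¹) = σ * (T₁' * P) * σ⁻¹ by group, Setoid.eq_top_iff]
    intro x y
    rw [← Equiv.apply_symm_apply σ x, ← Equiv.apply_symm_apply σ y, oc_conj, d1'.base.tree.trans hP]
    trivial
  have sub : TreeOver P k S₁ (g₂ R) := ⟨g4.tree hP ho, by
    rw [g5, ← hσS]
    intro z hz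
    simp only [Perm.mul_apply] at hz ⊢
    rw [d1'.base.sub]
    intro h1; rw [h1] at hz; exact hz (σ.apply_symm_apply z)⟩
  obtain ⟨f₂, f4, f5, f6⟩ := d1.base.merge sub d1.anch hP hk f₁ f1 f2
  have h1 := d1.diffs_le sub hP
  have ho2 : oc (f₂ R * P) = ⊤ := by rw [f5, ho]
  have h2 := f4.same_R g4 ho2 f5
  have h3 := (g3.trans g6).symm hg.inv
  exact (((f3.trans f6).trans h2).trans h3).mono (by omega)

end Chains

section Jump
variable {n : ℕ} {P : Perm (Fin n)} {k : ℕ} {f : Surf n}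

theorem Good.vertPow (hf : Good P k f) {c : Set (Fin n)} {u : Fin n} (hu : u ∈ c)
    (hG : ∀ y ∈ c, f G y ∈ c) (hR : ∀ y ∈ c, f R y ∈ c)
    (con : ∀ Y : Set (Fin n), u ∈ Y → (∀ y ∈ Y, y ∈ c → f G y ∈ Y ∧ f R y ∈ Y) → c ⊆ Y)
    (m : ℕ) :
    ∃ f', Good P k f' ∧ Step f f' ∧ (∀ y ∈ c, f' G y = f G (((f R * f G) ^ m) y)) ∧
      (∀ y ∈ c, f' R y = f R (((f R * f G) ^ m) y)) ∧ ∀ y ∉ c, f' R y = f R y := by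
  have hc : comp f R G u = c := by
    apply Set.Subset.antisymm
    · intro z hz
      exact comp_ind hf.inv hz hu fun y hy _ => ⟨hR y hy, hG y hy⟩
    · exact con _ ((oc (f R) ⊔ oc (f G)).refl' u)
        fun y hy _ => ⟨(comp_closed_right f R G u y).2 hy, (comp_closed_left f R G u y).2 hy⟩
  have hs := Sheared.exists hf.inv (comp_closed_left f R G u) (comp_closed_right f R G u) m
  have hst : Step f (shearPow f R G (comp f R G u) m) := ⟨R, G, u, m, Or.inl rfl, hs⟩
  rw [hc] at hs hst
  exact ⟨_, hst.good hf, hst, hs.on G (Or.inr rfl), hs.on R (Or.inl rfl), fun y hy => hs.off _ _ hy⟩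

variable {T : Perm (Fin n)} {d a y z : Fin n}

/-- Re-attaching a fixed point of `P` to another leg. -/
theorem PTree.jump (h : PTree P k T) (hP : Prof P k) (hd : P d = d) (hT : T d = a) (hne : d ≠ a)
    (hu : T (P a) = P a) (hy : T y = y) (hz : T z = z) (hyu : y ≠ P a) (hzu : z ≠ P a)
    (hyz : y ≠ z) (hor : oc (swap (P a) y * (T * P)) z (P a)) :
    PTree P k (swap d z * (swap d a * T)) ∧ RQ P k 8 T (swap d z * (swap d a * T)) := by
  have hTT := h.inv
  have hTa : T a = d := by rw [← hT, invol_apply hTT]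
  have ne1 : ∀ {w}, T w = w → w ≠ d ∧ w ≠ a := fun {w} hw => ⟨by
    rintro rfl; exact hne (hw.symm.trans hT), by rintro rfl; exact hne (hTa.symm.trans hw)⟩
  obtain ⟨c1, c2⟩ := h.cut hP hT hne
  have cd := cut_left hT
  have cz : (swap d a * T) z = z := by rw [cut_ne hTT hT (ne1 hz).1 (ne1 hz).2, hz]
  have hdz : ¬ cn P (swap d a * T) d z := fun h' =>
    (ne1 hz).1 (cn_ind h' (A := {d}) rfl (by rintro w rfl; exact ⟨hd, cd⟩))
  have tree' := c1.tree cd cz hdz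
  refine ⟨tree', fun f hf hR => ?_⟩
  obtain ⟨u, hPa⟩ : ∃ u, P a = u := ⟨_, rfl⟩
  rw [hPa] at hu hyu hzu hor
  obtain ⟨f1, g1, C1, R1, Gu, Gy, hn, hall, hG⟩ := hf.link (x := u) (y := y)
    (by rw [hR]; exact h.trans hP) hyu.symm (by rw [hR, hu]) (by rw [hR, hy])
  rw [hR] at R1
  rw [← mul_assoc, ← R1] at hor
  set ρ := f1 R * P with hρ
  have R1d : f1 R d = a := by rw [R1, sw_ne hu hy (ne1 hu).1.symm (ne1 hy).1.symm, hT]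
  have R1a : f1 R a = d := by rw [← R1d, invol_apply (g1.inv R)]
  have R1u : f1 R u = y := by rw [R1, sw_left hu]
  have R1y : f1 R y = u := by rw [← R1u, invol_apply (g1.inv R)]
  have R1z : f1 R z = z := by rw [R1, sw_ne hu hy hzu hyz.symm, hz]
  have ρd : ρ d = a := by rw [hρ, Perm.mul_apply, hd, R1d]
  have ρa : ρ a = y := by rw [hρ, Perm.mul_apply, hPa, R1u]
  have hay : oc ρ a y := by rw [← ρa]; exact oc_apply ρ a
  have nza : ¬ oc ρ z a := fun h' =>
    hn ((oc ρ).trans' ((oc ρ).symm' hor) ((oc ρ).trans' h' hay))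
  obtain ⟨f2, g2, s2, R2, Gz2, o2, -⟩ := g1.align (x := z) (y := u) ((oc ρ).trans' (hG z) hor)
  have Ga2 : f2 G a = f1 G a :=
    (o2 a nza fun h' => nza ((oc ρ).trans' ((oc ρ).symm' (hG z)) h')).1
  obtain ⟨f3, g3, s3, R3, Ga3, o3, -⟩ := g2.align (x := a) (y := a) (by rw [R2, Ga2]; exact hG a)
  rw [R2] at R3
  have Gz : f3 G z = u := by
    rw [(o3 z ?_ ?_).1, Gz2] <;> rw [R2]
    · exact fun h' => nza ((oc ρ).symm' h')
    · rw [Ga2]; exact fun h' => nza ((oc ρ).trans' ((oc ρ).symm' h') (hG a))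
  have Gu3 : f3 G u = z := by rw [← Gz, invol_apply (g3.inv G)]
  have Gd : f3 G d = y := by
    have := g3.G_pow 1 d
    rw [R3, ← hρ, pow_one, ρd, Ga3, ρa] at this
    exact this.symm
  have Gy3 : f3 G y = d := by rw [← Gd, invol_apply (g3.inv G)]
  have κz : (f3 R * f3 G) z = y := by rw [Perm.mul_apply, Gz, R3, R1u]
  have κy : (f3 R * f3 G) y = a := by rw [Perm.mul_apply, Gy3, R3, R1d]
  have κa : (f3 R * f3 G) a = d := by rw [Perm.mul_apply, Ga3, R3, R1a]
  have κd : (f3 R * f3 G) d = u := by rw [Perm.mul_apply, Gd, R3, R1y]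
  have κu : (f3 R * f3 G) u = z := by rw [Perm.mul_apply, Gu3, R3, R1z]
  obtain ⟨f4, g4, s4, G4, R4, R4o⟩ := g3.vertPow (c := {z, u, y, d, a}) (u := z) (by simp)
    (by rintro w (rfl | rfl | rfl | rfl | rfl) <;> simp [Gz, Gu3, Gy3, Gd, Ga3])
    (by rintro w (rfl | rfl | rfl | rfl | rfl) <;> simp [R3, R1z, R1u, R1y, R1d, R1a])
    (fun Y hY hw => by
      have y1 : u ∈ Y := by rw [← Gz]; exact (hw z hY (by simp)).1
      have y2 : y ∈ Y := by rw [← R1u, ← R3]; exact (hw u y1 (by simp)).2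
      have y3 : d ∈ Y := by rw [← Gy3]; exact (hw y y2 (by simp)).1
      have y4 : a ∈ Y := by rw [← R1d, ← R3]; exact (hw d y3 (by simp)).2
      rintro w (rfl | rfl | rfl | rfl | rfl) <;> assumption) 2
  simp only [pow_two, Perm.mul_apply (f3 R * f3 G)] at G4 R4
  have R4y : f4 R y = a := by rw [R4 _ (by simp), κy, κa, R3, R1d]
  have R4a : f4 R a = y := by rw [R4 _ (by simp), κa, κd, R3, R1u]
  have R4z : f4 R z = d := by rw [R4 _ (by simp), κz, κy, R3, R1a]
  have R4d : f4 R d = z := by rw [R4 _ (by simp), κd, κu, R3, R1z]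
  have R4u : f4 R u = u := by rw [R4 _ (by simp), κu, κz, R3, R1y]
  have G4y : f4 G y = y := by rw [G4 _ (by simp), κy, κa, Gd]
  have G4a : f4 G a = z := by rw [G4 _ (by simp), κa, κd, Gu3]
  have G4z : f4 G z = a := by rw [G4 _ (by simp), κz, κy, Ga3]
  have key : swap y a * f4 R = swap d z * (swap d a * T) := by
    have ca := cut_right hTT hT
    ext1 w
    by_cases w1 : w = y
    · rw [w1, cut_left R4y, sw_ne cd cz (ne1 hy).1 hyz, cut_ne hTT hT (ne1 hy).1 (ne1 hy).2, hy]
    by_cases w2 : w = a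
    · rw [w2, cut_right (g4.inv R) R4y, sw_ne cd cz hne.symm (ne1 hz).2.symm, ca]
    rw [cut_ne (g4.inv R) R4y w1 w2]
    by_cases w3 : w = d
    · rw [w3, R4d, sw_left cd]
    by_cases w4 : w = z
    · rw [w4, R4z, sw_right cz]
    rw [sw_ne cd cz w3 w4, cut_ne hTT hT w3 w2]
    by_cases w5 : w = u
    · rw [w5, R4u, hu]
    · rw [R4o w (by simp [*]), R3, R1, sw_ne hu hy w5 w1]
  have e : f4 R * P = swap y a * ((swap d z * (swap d a * T)) * P) := by
    rw [← key, mul_assoc (swap y a), sw_sw]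
  have hya : y ≠ a := (ne1 hy).2
  have htop := tree'.trans hP
  have hnot : ¬ oc (f4 R * P) y a := by
    rw [e]; exact not_oc_swap_mul hya (by rw [htop]; trivial)
  have haz : oc (f4 R * P) (f4 G a) a := by
    rw [G4a]
    have : joinS (oc (f4 R * P)) y a y z := by
      rw [e, joinS_swap_mul]
      exact le_joinS _ _ _ (by rw [htop]; trivial)
    rcases joinS_apply.1 this with h' | h' | h'
    · exfalso
      have := g4.oc_G h'
      rw [G4y, G4z] at this
      exact hnot this
    · exact (oc _).symm' h'.2
    · exfalso
      have := g4.oc_G h'.2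
      rw [G4y, G4z] at this
      exact hnot this
  obtain ⟨f5, g5, C5, R5⟩ := g4.unlink R4y hnot (by rw [G4y]) haz
  exact ⟨f5, g5, by rw [R5, key],
    ((((C1.trans (Conn.step s2)).trans (Conn.step s3)).trans (Conn.step s4)).trans C5).mono
      (by norm_num)⟩

end Jump

section Slide
variable {n : ℕ} {P : Perm (Fin n)} {k : ℕ} {T : Perm (Fin n)} {d w : Fin n}

theorem Prof.leaf_unique (hP : Prof P k) {d d' : Fin n} (h : P d = d) (h' : P d' = d') :
    d = d' := by
  have h1 : (Finset.univ.filter fun z => P z = z).card ≤ 1 := hP.fix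
  exact Finset.card_le_one.1 h1 d (by simpa using h) d' (by simpa using h')

theorem Cut.rich_leaf (h : Cut P k T) (hP : Prof P k) (hd : P d = d) (hw : P (P w) ≠ w)
    (hdw : cn P T d w) (z u : Fin n) : ∃ v, v ≠ u ∧ T v = v ∧ cn P T z v := by
  by_cases hz : cn P T z d
  · obtain ⟨v, hv, h1⟩ := h.exists_leg hP z {u} (three P w) (fun x hx =>
      ⟨three_big hw hx, (cn P T).trans' ((cn P T).trans' hz hdw)
        (le_sup_left (a := oc P) (three_oc hx))⟩) (by rw [three_card hw]; simp)
    exact ⟨v, by simpa using hv, h1⟩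
  · exact h.exists_leg' hP z u fun d' hd' h' => hz (by rwa [hP.leaf_unique hd hd'])

/-- Turning `u` into a leg. -/
theorem PTree.make_leg (h : PTree P k T) (hP : Prof P k) (u : Fin n) (hd : P d = d)
    (hw : P (P w) ≠ w) (hdw : T u ≠ u → cn P (swap u (T u) * T) d w) :
    ∃ T', PTree P k T' ∧ RQ P k 5 T T' ∧ T' u = u ∧
      ∀ z, T z ≠ z → z ≠ u → z ≠ T u → T' z = T z := by
  by_cases hu : T u = u
  · exact ⟨T, h, RQ.refl _ _, hu, fun _ _ _ _ => rfl⟩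
  obtain ⟨v, hv⟩ : ∃ v, T u = v := ⟨_, rfl⟩
  rw [hv] at hu hdw ⊢
  obtain ⟨c1, c2⟩ := h.cut hP hv (Ne.symm hu)
  have cu := cut_left hv
  have cv := cut_right h.inv hv
  have rich := c1.rich_leaf hP hd hw (hdw hu)
  obtain ⟨l, l1, l2, l3⟩ := rich u u
  obtain ⟨m, m1, m2, m3⟩ := rich v v
  set C := swap u v * T with hC
  have hlm : ¬ cn P C l m := fun h' =>
    c2 ((cn P C).trans' ((cn P C).trans' l3 h') ((cn P C).symm' m3))
  have l4 : l ≠ v := by rintro rfl; exact c2 l3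
  have m4 : m ≠ u := by rintro rfl; exact c2 ((cn P C).symm' m3)
  have mv := c1.move hP cu cv c2 l2 m2 hlm l1 l4 m4 m1
  rw [hC, sw_sw] at mv
  refine ⟨_, c1.tree l2 m2 hlm, mv, by rw [sw_ne l2 m2 l1.symm m4.symm, cu], fun z z1 z2 z3 => ?_⟩
  have hz : C z = T z := cut_ne h.inv hv z2 z3
  rw [sw_ne l2 m2, hz]
  · rintro rfl; exact z1 (hz.symm.trans l2)
  · rintro rfl; exact z1 (hz.symm.trans m2)

/-- The path from the fixed point `d` of `P` to the nearest vertex of degree at least three. -/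
structure Stem (P T : Perm (Fin n)) (d : Fin n) (l : ℤ) (e : ℤ → Fin n) : Prop where
  one_le : 1 ≤ l
  zero : e 0 = d
  pp : ∀ i, 0 ≤ i → i < l → P (e i) = e (-i) ∧ P (e (-i)) = e i
  tt : ∀ i, 1 ≤ i → i ≤ l → T (e i) = e (1 - i)
  big : P (P (e l)) ≠ e l

variable {l : ℤ} {e : ℤ → Fin n}

theorem Stem.inner (h : Stem P T d l e) {i : ℤ} (h1 : 1 - l ≤ i) (h2 : i < l) :
    P (e i) = e (-i) := by
  rcases le_or_gt 0 i with h0 | h0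
  · exact (h.pp i h0 h2).1
  · have := (h.pp (-i) (by omega) (by omega)).2
    rwa [neg_neg] at this

theorem Stem.small (h : Stem P T d l e) {i : ℤ} (h1 : 1 - l ≤ i) (h2 : i < l) :
    P (P (e i)) = e i := by
  rw [h.inner h1 h2, h.inner (by omega) (by omega), neg_neg]

theorem Stem.edge (h : Stem P T d l e) (hT : T * T = 1) {i : ℤ} (h1 : 1 - l ≤ i) (h2 : i ≤ l) :
    T (e i) = e (1 - i) := by
  rcases lt_or_ge 0 i with h0 | h0
  · exact h.tt i h0 h2
  · have := h.tt (1 - i) (by omega) (by omega)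
    rw [sub_sub_cancel] at this
    rw [← this, invol_apply hT]

theorem Stem.path (h : Stem P T d l e) (j : ℕ) (hj : (j : ℤ) ≤ l) : cn P T d (e j) := by
  induction j with
  | zero => rw [Nat.cast_zero, h.zero]
  | succ j ih =>
    push_cast at hj ⊢
    have h1 := le_sup_left (a := oc P) (b := oc T) (oc_apply P (e j))
    rw [(h.pp j (by omega) (by omega)).1] at h1
    have h2 := le_sup_right (a := oc P) (b := oc T) (oc_apply T (e (j + 1)))
    rw [h.tt _ (by omega) hj, show 1 - ((j : ℤ) + 1) = -j by ring] at h2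
    exact (cn P T).trans' ((cn P T).trans' (ih (by omega)) h1)
      ((cn P T).symm' h2)

theorem Stem.congr {T' : Perm (Fin n)} (h : Stem P T d l e)
    (h' : ∀ i, 1 ≤ i → i ≤ l → T' (e i) = T (e i)) : Stem P T' d l e :=
  ⟨h.one_le, h.zero, h.pp, fun i h1 h2 => by rw [h' i h1 h2, h.tt i h1 h2], h.big⟩

theorem Stem.edge_ne (h : Stem P T d l e) (hT : PTree P k T) {i : ℤ} (h1 : 1 ≤ i) (h2 : i ≤ l) :
    T (e i) ≠ e i := by
  intro hi
  have hcn : cn P T d (e l) := by rw [hT.con]; trivial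
  have := cn_ind hcn (A := {z | ∃ j, 1 - i ≤ j ∧ j < i ∧ z = e j})
    ⟨0, by omega, by omega, h.zero.symm⟩ (by
      rintro z ⟨j, j1, j2, rfl⟩
      refine ⟨⟨-j, by omega, by omega, h.inner (by omega) (by omega)⟩, ?_⟩
      rw [h.edge hT.inv (by omega) (by omega)]
      rcases eq_or_ne j (1 - i) with rfl | h3
      · refine ⟨1 - i, le_rfl, by omega, ?_⟩
        rw [sub_sub_cancel, ← h.tt i h1 h2, hi]
      · exact ⟨1 - j, by omega, by omega, rfl⟩)
  obtain ⟨j, j1, j2, j3⟩ := this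
  exact h.big (by rw [j3]; exact h.small (by omega) (by omega))

theorem Prof.exists_big (hP : Prof P k) (hk : 4 ≤ k) (hd : P d = d) : ∃ w, P (P w) ≠ w := by
  by_contra! h
  have h1 : P * P = 1 := by ext1 z; exact h z
  have h2 := nc_invol h1
  have h3 := hP.fix
  have h4 := hP.eq
  have h5 : 0 < fx P := Finset.card_pos.2 ⟨d, by simpa using hd⟩
  rw [Nat.card_fin] at h2
  omega

theorem PTree.exists_stem (h : PTree P k T) (hP : Prof P k) (hk : 4 ≤ k) (hd : P d = d) :
    ∃ l e, Stem P T d l e := by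
  classical
  obtain ⟨w, hw⟩ := hP.exists_big hk hd
  set e : ℤ → Fin n := fun i => ((T * P) ^ i) d with he
  have hes : ∀ i, T (P (e i)) = e (i + 1) := fun i => by
    simp only [he]; rw [add_comm, zpow_add, zpow_one]; rfl
  have hdw : oc (T * P) d w := by rw [h.trans hP]; trivial
  obtain ⟨i, hi⟩ := SameCycle.exists_nat_pow_eq hdw
  have hex : ∃ j : ℕ, P (P (e j)) ≠ e j := ⟨i, by simp only [he, zpow_natCast, hi]; exact hw⟩
  have e0 : e 0 = d := rfl
  have key : ∀ j : ℕ, (∀ i < j, P (P (e i)) = e i) →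
      (∀ i : ℕ, i < j → P (e i) = e (-i) ∧ P (e (-i)) = e i) ∧
      ∀ i : ℕ, i < j → T (e (i + 1)) = e (-i) := by
    intro j
    induction j with
    | zero => simp
    | succ j ih =>
      intro hj
      obtain ⟨i1, i2⟩ := ih fun i hi => hj i (by omega)
      have a1 : P (e j) = e (-j) ∧ P (e (-j)) = e j := by
        have : P (e (-j)) = e j := by
          rcases j with _ | j
          · simpa [e0] using hd
          · have h1 := i2 j (by omega)
            have h2 := hes (-(j + 1 : ℤ))
            rw [show -((j : ℤ) + 1) + 1 = -j by ring, ← h1] at h2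
            push_cast
            exact T.injective h2
        exact ⟨P.injective (by rw [hj j (by omega), this]), this⟩
      have a2 : T (e (j + 1)) = e (-j) := by
        rw [← hes, invol_apply h.inv, a1.1]
      refine ⟨fun i hi => ?_, fun i hi => ?_⟩ <;> rcases Nat.lt_succ_iff_lt_or_eq.1 hi with h' | rfl
      exacts [i1 i h', a1, i2 i h', a2]
  obtain ⟨k1, k2⟩ := key (Nat.find hex) fun i hi => not_not.1 (Nat.find_min hex hi)
  refine ⟨Nat.find hex, e, ?_, e0, fun i i1 i2 => ?_, fun i i1 i2 => ?_, Nat.find_spec hex⟩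
  · have : Nat.find hex ≠ 0 := fun h0 => Nat.find_spec hex (by
      rw [h0, Nat.cast_zero, e0, hd, hd])
    omega
  · obtain ⟨i, rfl⟩ := Int.eq_ofNat_of_zero_le i1
    exact k1 i (by omega)
  · obtain ⟨j, hj⟩ := Int.eq_ofNat_of_zero_le (show 0 ≤ i - 1 by omega)
    obtain rfl : i = j + 1 := by omega
    rw [k2 j (by omega)]; congr 1; ring

/-- A stem whose end is adjacent to a leg, indexed periodically. -/
structure Hair (P T : Perm (Fin n)) (l : ℤ) (e : ℤ → Fin n) : Prop where
  one_le : 1 ≤ l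
  per : ∀ i, e (i + (2 * l + 1)) = e i
  tt : ∀ i, T (e i) = e (1 - i)
  pp : ∀ i, 1 - l ≤ i → i ≤ l → P (e i) = e (-i)
  ne : ∀ i, 1 ≤ i → i ≤ l → T (e i) ≠ e i

theorem per_mul {e : ℤ → Fin n} {q : ℤ} (h : ∀ i, e (i + q) = e i) (m i : ℤ) :
    e (i + m * q) = e i := by
  induction m generalizing i with
  | zero => simp
  | succ m ih => rw [show i + ((m : ℤ) + 1) * q = i + q + m * q by ring, ih, h]
  | pred m ih => rw [← h, show i + (-(m : ℤ) - 1) * q + q = i + -m * q by ring, ih]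

theorem exists_rep {l : ℤ} (hl : 1 ≤ l) (a i : ℤ) :
    ∃ m, a ≤ i + m * (2 * l + 1) ∧ i + m * (2 * l + 1) ≤ a + 2 * l := by
  refine ⟨-((i - a) / (2 * l + 1)), ?_⟩
  have h1 := Int.emod_nonneg (i - a) (show 2 * l + 1 ≠ 0 by omega)
  have h2 := Int.emod_lt_of_pos (i - a) (show 0 < 2 * l + 1 by omega)
  have h3 := Int.emod_add_mul_ediv (i - a) (2 * l + 1)
  constructor <;> linarith [mul_comm ((i - a) / (2 * l + 1)) (2 * l + 1)]

theorem Stem.exists_hair (h : Stem P T d l e) (hT : PTree P k T) (hl : T (P (e l)) = P (e l)) :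
    ∃ e', Hair P T l e' ∧ e' 0 = d ∧ e' (-l) = P (e l) ∧ e' l = e l := by
  have l1 := h.one_le
  set r : ℤ → ℤ := fun i => (i + (l - 1)) % (2 * l + 1) - (l - 1) with hr
  have r1 : ∀ i, 1 - l ≤ i → i ≤ l + 1 → r i = i := fun i h1 h2 => by
    simp only [hr]; rw [Int.emod_eq_of_lt (by omega) (by omega)]; ring
  set e' : ℤ → Fin n := fun i => if r i = l + 1 then P (e l) else e (r i) with he'
  have e1 : ∀ i, 1 - l ≤ i → i ≤ l → e' i = e i := fun i h1 h2 => by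
    simp only [he']; rw [r1 i h1 (by omega), if_neg (by omega)]
  have e2 : e' (l + 1) = P (e l) := by
    simp only [he']; rw [r1 _ (by omega) le_rfl, if_pos rfl]
  have per : ∀ i, e' (i + (2 * l + 1)) = e' i := fun i => by
    simp only [he', hr]
    rw [show i + (2 * l + 1) + (l - 1) = i + (l - 1) + (2 * l + 1) by ring, Int.add_emod_right]
  have e3 : e' (-l) = P (e l) := by
    rw [← per, show -l + (2 * l + 1) = l + 1 by ring, e2]
  refine ⟨e', ⟨l1, per, fun i => ?_, fun i h1 h2 => ?_, fun i h1 h2 => ?_⟩, ?_, e3,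
    e1 l (by omega) le_rfl⟩
  · obtain ⟨m, m1, m2⟩ := exists_rep l1 (1 - l) i
    rw [← per_mul per m i, ← per_mul per (-m) (1 - i)]
    set j := i + m * (2 * l + 1) with hj
    rw [show 1 - i + -m * (2 * l + 1) = 1 - j by rw [hj]; ring]
    rcases eq_or_ne j (l + 1) with h3 | h3
    · rw [h3, e2, hl, show 1 - (l + 1) = -l by ring, e3]
    · rw [e1 j m1 (by omega), e1 (1 - j) (by omega) (by omega), h.edge hT.inv m1 (by omega)]
  · rcases eq_or_ne i l with rfl | h3
    · rw [e1 i h1 h2, e3]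
    · rw [e1 i h1 h2, e1 (-i) (by omega) (by omega), h.inner h1 (by omega)]
  · rw [e1 i (by omega) h2]; exact h.edge_ne hT h1 h2
  · rw [e1 0 (by omega) (by omega), h.zero]

theorem Hair.slide {f : Surf n} (hf : Good P k f) (h : Hair P (f R) l e)
    (hT : PTree P k (f R)) (hP : Prof P k) :
    ∃ f', Good P k f' ∧ PTree P k (f' R) ∧ f' R (e 0) = e (-l) ∧ Conn 2 f f' := by
  have l1 := h.one_le
  obtain ⟨f1, g1, s1, R1, Ge, -, -⟩ := hf.align (x := e 1) (y := e 1)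
    (by rw [hT.trans hP]; trivial)
  rw [← R1] at h hT
  have perm : ∀ m i, e (i + m * (2 * l + 1)) = e i := per_mul h.per
  have ρs : ∀ i, 1 - l ≤ i → i ≤ l → (f1 R * P) (e i) = e (i + 1) := fun i h1 h2 => by
    rw [Perm.mul_apply, h.pp i h1 h2, h.tt]; congr 1; ring
  have ρm : ∀ (m : ℕ) (i : ℤ), 1 - l ≤ i → i + m ≤ l + 1 →
      ((f1 R * P) ^ m) (e i) = e (i + m) := by
    intro m
    induction m with
    | zero => intro i _ _; simp
    | succ m ih =>
      intro i h1 h2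
      rw [Nat.cast_succ] at h2 ⊢
      rw [pow_succ', Perm.mul_apply, ih i h1 (by omega), ρs _ (by omega) (by omega)]
      congr 1; ring
  have Gm : ∀ m : ℕ, (m : ℤ) ≤ l → f1 G (e (1 - m)) = e (1 + m) := fun m hm => by
    rw [← g1.G_pow m, ρm m _ (by omega) (by omega), show (1 : ℤ) - m + m = 1 by ring, Ge,
      ρm m _ (by omega) (by omega)]
  have Gi : ∀ i, f1 G (e i) = e (2 - i) := fun i => by
    obtain ⟨m, hm1, hm2⟩ := exists_rep l1 (1 - l) i
    rw [← perm m i, ← perm (-m) (2 - i), show 2 - i + -m * (2 * l + 1) =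
      2 - (i + m * (2 * l + 1)) by ring]
    generalize i + m * (2 * l + 1) = j at hm1 hm2
    rcases le_total j 1 with hj | hj
    · have := Gm (1 - j).toNat (by omega)
      rw [Int.toNat_of_nonneg (by omega)] at this
      rw [show j = 1 - (1 - j) by ring, this]; congr 1; ring
    · have := Gm (j - 1).toNat (by omega)
      rw [Int.toNat_of_nonneg (by omega)] at this
      rw [show j = 1 + (j - 1) by ring, ← this, invol_apply (g1.inv G)]; congr 1; ring
  have κm : ∀ (m : ℕ) (i : ℤ), ((f1 R * f1 G) ^ m) (e i) = e (i - m) := by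
    intro m
    induction m with
    | zero => intro i; simp
    | succ m ih =>
      intro i
      rw [pow_succ', Perm.mul_apply, ih, Perm.mul_apply, Gi, h.tt]
      push_cast; congr 1; ring
  obtain ⟨f2, g2, s2, -, R2, R2o⟩ := g1.vertPow (c := Set.range e) (u := e 1) ⟨1, rfl⟩
    (by rintro _ ⟨i, rfl⟩; exact ⟨_, (Gi i).symm⟩) (by rintro _ ⟨i, rfl⟩; exact ⟨_, (h.tt i).symm⟩)
    (fun Y hY hw => by
      have hd : ∀ i, e i ∈ Y → e (i - 1) ∈ Y := fun i hi => by
        have h1 := (hw _ hi ⟨i, rfl⟩).1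
        rw [Gi] at h1
        have h2 := (hw _ h1 ⟨_, rfl⟩).2
        rw [h.tt] at h2
        rwa [show i - 1 = 1 - (2 - i) by ring]
      have hn : ∀ m : ℕ, e (1 - m) ∈ Y := fun m => by
        induction m with
        | zero => simpa using hY
        | succ m ih =>
          have := hd _ ih
          rwa [show (1 : ℤ) - m - 1 = 1 - (m + 1 : ℕ) by push_cast; ring] at this
      rintro _ ⟨i, rfl⟩
      obtain ⟨m, -, hm⟩ := exists_rep l1 (1 - 2 * l) i
      have := hn (1 - (i + m * (2 * l + 1))).toNat
      rw [Int.toNat_of_nonneg (by omega)] at this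
      rwa [← perm m i, show i + m * (2 * l + 1) = 1 - (1 - (i + m * (2 * l + 1))) by ring])
    l.toNat
  have Ri : ∀ i, f2 R (e i) = e (1 + l - i) := fun i => by
    rw [R2 _ ⟨i, rfl⟩, κm, h.tt, Int.toNat_of_nonneg (by omega)]; congr 1; ring
  have R0 : f2 R (e 0) = e (-l) := by
    rw [Ri, ← h.per (-l)]; congr 1; ring
  have one : ∀ (m : ℕ), (m : ℤ) ≤ l → cn P (f2 R) (e 0) (e m) ∧ cn P (f2 R) (e 0) (e (-m)) := by
    intro m
    induction m with
    | zero => intro _; simp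
    | succ m ih =>
      intro hm
      rw [Nat.cast_succ] at hm ⊢
      obtain ⟨-, i2⟩ := ih (by omega)
      have c1 := le_sup_right (a := oc P) (oc_apply (f2 R) (e (-m)))
      rw [Ri, show 1 + l - -(m : ℤ) = -(l - m) + (2 * l + 1) by ring, h.per,
        ← h.pp (l - m) (by omega) (by omega)] at c1
      have c2 := le_sup_left (b := oc (f2 R)) (oc_apply' P (e (l - m)))
      have c3 := le_sup_right (a := oc P) (oc_apply (f2 R) (e (l - m)))
      rw [Ri, show 1 + l - (l - (m : ℤ)) = m + 1 by ring] at c3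
      have c4 := le_sup_left (b := oc (f2 R)) (oc_apply P (e (m + 1)))
      rw [h.pp _ (by omega) (by omega)] at c4
      have c5 := (cn P (f2 R)).trans' i2 ((cn P (f2 R)).trans' c1 ((cn P (f2 R)).trans' c2 c3))
      exact ⟨c5, (cn P (f2 R)).trans' c5 c4⟩
  have all : ∀ i, cn P (f2 R) (e 0) (e i) := fun i => by
    obtain ⟨m, hm1, hm2⟩ := exists_rep l1 (-l) i
    rw [← perm m i]
    generalize i + m * (2 * l + 1) = j at hm1 hm2
    rcases le_total 0 j with hj | hj
    · have := (one j.toNat (by omega)).1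
      rwa [Int.toNat_of_nonneg (by omega)] at this
    · have := (one (-j).toNat (by omega)).2
      rwa [Int.toNat_of_nonneg (by omega), neg_neg] at this
  have con : cn P (f2 R) = ⊤ := by
    rw [eq_top_iff, ← hT.con]
    refine sup_le le_sup_left (oc_le.2 fun z => ?_)
    by_cases hz : z ∈ Set.range e
    · obtain ⟨i, rfl⟩ := hz
      rw [h.tt]
      exact (cn P (f2 R)).trans' ((cn P (f2 R)).symm' (all i)) (all _)
    · rw [← R2o z hz]
      exact le_sup_right (a := oc P) (oc_apply _ _)
  have hfix : ∀ i, f1 R (e i) = e i → e i = e (-l) := fun i hi => by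
    obtain ⟨m, hm1, hm2⟩ := exists_rep l1 (-l) i
    rw [← perm m i] at hi ⊢
    generalize i + m * (2 * l + 1) = j at hm1 hm2 hi
    rcases lt_or_ge 0 j with hj | hj
    · exact absurd hi (h.ne j (by omega) (by omega))
    · rcases eq_or_lt_of_le hm1 with rfl | hj'
      · rfl
      · exfalso
        refine h.ne (1 - j) (by omega) (by omega) ?_
        rw [← h.tt j, invol_apply (g1.inv R), hi]
  obtain ⟨w, hw, hwR⟩ : ∃ w ∈ Set.range e, f2 R w = w := by
    rcases Int.even_or_odd' l with ⟨q, hq | hq⟩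
    · refine ⟨e (3 * q + 1), ⟨_, rfl⟩, ?_⟩
      rw [Ri, ← perm 1]; congr 1; omega
    · refine ⟨e (q + 1), ⟨_, rfl⟩, ?_⟩
      rw [Ri]; congr 1; omega
  have hle : fx (f1 R) ≤ fx (f2 R) := by
    classical
    refine Finset.card_le_card_of_injOn (fun z => if z ∈ Set.range e then w else z) ?_ ?_
    · intro z hz
      have hz : f1 R z = z := by simpa using hz
      by_cases hzc : z ∈ Set.range e
      · simp only [hzc, if_true]; simpa using hwR
      · simp only [hzc, if_false]; simpa using (R2o z hzc).trans hz
    · intro x hx y hy hxy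
      have hx : f1 R x = x := by simpa using hx
      have hy : f1 R y = y := by simpa using hy
      by_cases hxc : x ∈ Set.range e <;> by_cases hyc : y ∈ Set.range e
      · obtain ⟨i, rfl⟩ := hxc
        obtain ⟨j, rfl⟩ := hyc
        rw [hfix i hx, hfix j hy]
      · simp only [hxc, hyc, if_true, if_false] at hxy
        exact absurd (hxy ▸ hw) hyc
      · simp only [hxc, hyc, if_true, if_false] at hxy
        exact absurd (hxy ▸ hw) hxc
      · simpa only [hxc, hyc, if_false] using hxy
  have tree : PTree P k (f2 R) := by
    have : Nonempty (Fin n) := ⟨e 0⟩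
    refine ⟨g2.inv R, con, ?_⟩
    have n1 := nc_sup_oc (oc P) (f2 R)
    rw [nc_eq_one_iff.2 con] at n1
    have n2 := nc_invol (g2.inv R)
    have n3 := hP.eq
    have n4 := hT.fix
    rw [Nat.card_fin] at n1 n2
    omega
  exact ⟨f2, g2, tree, R0, (Conn.step s1).trans (Conn.step s2)⟩

end Slide

section SlideLeaf
variable {n : ℕ} {P : Perm (Fin n)} {k : ℕ} {f : Surf n} {d : Fin n}

theorem Good.slide (hf : Good P k f) (hP : Prof P k) (hT : PTree P k (f R)) (hk : 4 ≤ k)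
    (hd : P d = d) :
    ∃ f', Good P k f' ∧ PTree P k (f' R) ∧ P (P (f' R d)) ≠ f' R d ∧ Conn 7 f f' := by
  obtain ⟨l, e, st⟩ := hT.exists_stem hP hk hd
  have l1 := st.one_le
  obtain ⟨u, hu⟩ : ∃ u, P (e l) = u := ⟨_, rfl⟩
  have ub : P (P u) ≠ u := by
    rw [← hu]; exact fun h => st.big (P.injective h)
  have n1 : ∀ i, 1 ≤ i → i ≤ l → e i ≠ u := fun i h1 h2 h => by
    rcases eq_or_lt_of_le h2 with rfl | h3
    · exact st.big (by rw [hu, ← h, hu, ← h])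
    · exact ub (by rw [← h]; exact st.small (by omega) h3)
  have n2 : ∀ i, 1 ≤ i → i ≤ l → e i ≠ f R u := fun i h1 h2 h => by
    have : u = e (1 - i) := by rw [← st.tt i h1 h2, h, invol_apply hT.inv]
    exact ub (by rw [this]; exact st.small (by omega) (by omega))
  obtain ⟨T', t', rq, Tu, keep⟩ := hT.make_leg hP u hd st.big fun _ => by
    have st' : Stem P (swap u (f R u) * f R) d l e := st.congr fun i h1 h2 =>
      cut_ne hT.inv rfl (n1 i h1 h2) (n2 i h1 h2)
    have := st'.path l.toNat (by omega)
    rwa [Int.toNat_of_nonneg (by omega)] at this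
  have st' : Stem P T' d l e := st.congr fun i h1 h2 =>
    keep _ (st.edge_ne hT h1 h2) (n1 i h1 h2) (n2 i h1 h2)
  obtain ⟨e', hair, e0, el, -⟩ := st'.exists_hair t' (by rw [hu, Tu])
  obtain ⟨f1, g1, R1, c1⟩ := rq f hf rfl
  rw [← R1] at hair t'
  obtain ⟨f2, g2, t2, R2, c2⟩ := hair.slide g1 t' hP
  refine ⟨f2, g2, t2, ?_, c1.trans c2⟩
  rw [← e0, R2, el, hu]
  exact ub

end SlideLeaf

section NormalLeaf
variable {n : ℕ} {P S T : Perm (Fin n)} {k : ℕ} {d a b u : Fin n}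

theorem TreeOver.free_leg (h : TreeOver P k S T) (hP : Prof P k) (hk : 5 ≤ k) (hS : Anchored P S)
    (hu : S u = u) (F X : Finset (Fin n)) (hX : ∀ x ∈ X, P (P x) ≠ x ∧ cn P S u x)
    (hF : 3 * F.card < 3 + X.card) (hFS : ∀ w ∈ F, cn P S u w) (huF : u ∈ F) :
    ∃ T', TreeOver P k S T' ∧ T' u = u ∧ RQ P k 15 T T' ∧ ∀ w ∈ F, T w = w → T' w = w := by
  by_cases hTu : T u = u
  · exact ⟨T, h, hTu, RQ.refl _ _, fun _ _ hw => hw⟩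
  obtain ⟨v, hv⟩ : ∃ v, T u = v := ⟨_, rfl⟩
  have huv : u ≠ v := by rintro rfl; exact hTu hv
  obtain ⟨c1, c2, c3, rich⟩ := h.cut hP hS hu hv huv
  obtain ⟨l, l1, l2, l3⟩ := c1.exists_leg hP u F X (fun x hx => ⟨(hX x hx).1,
    c3.cn_le (hX x hx).2⟩) hF
  obtain ⟨m, m1, m2, m3⟩ := rich v v
  have hm : ¬ cn P (swap u v * T) u m := fun h' =>
    c2 ((cn P _).trans' h' ((cn P _).symm' m3))
  have hlm : ¬ cn P (swap u v * T) l m := fun h' => hm ((cn P _).trans' l3 h')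
  have keep : ∀ w ∈ F, (swap u v * T) w = w → (swap l m * (swap u v * T)) w = w :=
    fun w hw hw' => by
      rw [sw_ne l2 m2, hw']
      · rintro rfl; exact l1 hw
      · rintro rfl; exact hm (c3.cn_le (hFS _ hw))
  obtain ⟨e1, e2⟩ := h.exchange hP hk hS hu hv huv l2 m2 hlm
  refine ⟨_, e1, keep u huF (cut_left hv), e2, fun w hw hw' => keep w hw ?_⟩
  rw [cut_ne h.tree.inv hv, hw']
  · rintro rfl; exact hTu hw'
  · rintro rfl; exact huv ((invol_apply h.tree.inv u).symm.trans ((congrArg T hv).trans hw'))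

theorem PTree.rotate (h : PTree P k T) (hd : P d = d) (hda : T d = a) (hab : oc P a b) :
    ∃ T', PTree P k T' ∧ T' d = b ∧ RQ P k 0 T T' := by
  obtain ⟨i, hi⟩ := hab
  have hc : P ^ i * P * (P ^ i)⁻¹ = P := by group
  have hTT : (P ^ i * T * (P ^ i)⁻¹) (P ^ i • d) = b := by
    simp [hda, hi]
  have hdi : (P ^ i) d = d := zpow_apply_eq_self_of_apply_eq_self hd i
  refine ⟨P ^ i * T * (P ^ i)⁻¹, ⟨?_, ?_, ?_⟩, ?_, RQ.conj hc T⟩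
  · have : P ^ i * T * (P ^ i)⁻¹ * (P ^ i * T * (P ^ i)⁻¹) = P ^ i * (T * T) * (P ^ i)⁻¹ := by
      group
    rw [this, h.inv]; group
  · have h1 := sup_conj_le (P ^ i) P T
    rw [hc, show oc P ⊔ oc T = ⊤ from h.con] at h1
    rw [Setoid.eq_top_iff]
    intro x y
    have := h1 (show (⊤ : Setoid (Fin n)) ((P ^ i)⁻¹ x) ((P ^ i)⁻¹ y) from trivial)
    simpa [Setoid.comap_rel] using this
  · rw [fx_conj]; exact h.fix
  · rw [← hTT, Perm.smul_def, hdi]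

theorem PTree.move_leaf (h : PTree P k T) (hP : Prof P k) (hk : 5 ≤ k) (hd : P d = d)
    (hda : T d = a) (ha : P (P a) ≠ a) (hb : P (P b) ≠ b) :
    ∃ T', PTree P k T' ∧ T' d = b ∧ RQ P k 98 T T' := by
  by_cases hab : oc P a b
  · obtain ⟨T', h1, h2, h3⟩ := h.rotate hd hda hab
    exact ⟨T', h1, h2, h3.mono (by norm_num)⟩
  have big_d : ∀ {z}, P (P z) ≠ z → z ≠ d := fun hz => by
    rintro rfl; exact hz (by rw [hd, hd])
  have hra : ∀ {z}, z ∈ three P a → oc P a z := three_oc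
  set x := P (P a) with hx
  set y := P.symm b with hy
  have Py : P y = b := P.apply_symm_apply b
  have hby : oc P b y := by rw [← Py]; exact oc_apply' P y
  have yb : P (P y) ≠ y := by
    intro h'; rw [Py] at h'; exact hb (by rw [h', Py])
  have hay : ∀ {z}, oc P a z → z ≠ y := fun hz => by
    rintro rfl; exact hab ((oc P).trans' hz ((oc P).symm' hby))
  have hax : oc P a x := hra (by simp [three, hx])
  have haP : oc P a (P a) := hra (by simp [three])
  have xb : P (P x) ≠ x := three_big ha (by simp [three, hx])
  have Pb : P (P (P a)) ≠ P a := three_big ha (by simp [three])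
  have hP1 : P a ≠ a := fun h' => ha (by rw [hx, h', h'])
  have hne : d ≠ a := (big_d ha).symm
  have f1 : (1 : Perm (Fin n)) d = d := rfl
  have f2 : (1 : Perm (Fin n)) a = a := rfl
  set S := swap d a * 1 with hS
  have Sne : ∀ {z}, z ≠ d → z ≠ a → S z = z := fun h1 h2 => by rw [hS, sw_ne f1 f2 h1 h2]; rfl
  have Sd : S d = a := sw_left f1
  have Sa : S a = d := sw_right f2
  have anch : Anchored P S := ⟨sw_invol (one_mul 1) f1 f2, fun d' hd' => by
    rw [hP.leaf_unique hd' hd, Sd]; exact ⟨hne.symm, ha⟩⟩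
  have t0 : TreeOver P k S T := ⟨h, SubInv.add h.inv (fun z hz => absurd rfl hz) f1 f2 hda⟩
  have Sx : S x = x := Sne (big_d xb) ha
  have hya : y ≠ a := (hay ((oc P).refl' a)).symm
  have Sy : S y = y := Sne (big_d yb) hya
  have hxy : ¬ cn P S x y := fun h' => by
    have := cn_ind h' (A := {z | z = d ∨ oc P a z}) (Or.inr hax) (by
      rintro z (rfl | hz)
      · exact ⟨Or.inl hd, by rw [Sd]; exact Or.inr ((oc P).refl' a)⟩
      · refine ⟨Or.inr ((oc P).trans' hz (oc_apply P z)), ?_⟩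
        by_cases za : z = a
        · rw [za, Sa]; exact Or.inl rfl
        by_cases zd : z = d
        · rw [zd, Sd]; exact Or.inr ((oc P).refl' a)
        rw [Sne zd za]; exact Or.inr hz)
    rcases this with h' | h'
    · exact big_d yb h'
    · exact hay h' rfl
  obtain ⟨T1, t1, e1, q1⟩ := t0.add_edge hP hk anch Sx Sy hxy
  have anch2 := anch.add Sx Sy
  set S2 := swap x y * S with hS2
  have t1' : TreeOver P k S2 T1 := ⟨t1.tree, t1.sub.add t1.tree.inv Sx Sy e1⟩
  have c_ax : cn P S2 a x := le_sup_left (b := oc S2) hax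
  have c_xy : cn P S2 x y := by
    have := le_sup_right (a := oc P) (oc_apply S2 x)
    rwa [hS2, sw_left Sx] at this
  have c_by : cn P S2 b y := le_sup_left (b := oc S2) hby
  have c_au : cn P S2 a (P a) := le_sup_left (b := oc S2) haP
  have c_ab : cn P S2 a b := (cn P S2).trans' c_ax ((cn P S2).trans' c_xy ((cn P S2).symm' c_by))
  set X := three P a ∪ three P b with hX
  have cX : X.card = 6 := by
    rw [hX, Finset.card_union_of_disjoint, three_card ha, three_card hb]
    rw [Finset.disjoint_left]
    intro z h1 h2
    exact hab ((oc P).trans' (hra h1) ((oc P).symm' (three_oc h2)))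
  have X1 : ∀ z ∈ X, P (P z) ≠ z ∧ cn P S2 a z := fun z hz => by
    rcases Finset.mem_union.1 hz with h' | h'
    · exact ⟨three_big ha h', le_sup_left (b := oc S2) (hra h')⟩
    · exact ⟨three_big hb h', (cn P S2).trans' c_ab (le_sup_left (b := oc S2) (three_oc h'))⟩
  have Su : S2 (P a) = P a := by
    rw [hS2, sw_ne Sx Sy (fun h' => hP1 (P.injective h'.symm)) (hay haP), Sne (big_d Pb) hP1]
  have Sb : S2 b = b := by
    rw [hS2, sw_ne Sx Sy (fun h' => hab (by rw [h']; exact hax)) (fun h' => by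
      have h2 : P b = b := (congrArg P h').trans Py
      exact hb (by rw [h2, h2])), Sne (big_d hb) (fun h' => hab (by rw [h']))]
  obtain ⟨T2, t2, u2, q2, -⟩ := t1'.free_leg hP hk anch2 Su {P a} X (fun z hz => ⟨(X1 z hz).1,
    (cn P S2).trans' ((cn P S2).symm' c_au) (X1 z hz).2⟩) (by rw [cX]; simp)
    (fun w hw => by rw [Finset.mem_singleton.1 hw]) (by simp)
  have c_bu : cn P S2 b (P a) := (cn P S2).trans' ((cn P S2).symm' c_ab) c_au
  have hub : P a ≠ b := fun h' => hab (by rw [← h']; exact haP)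
  obtain ⟨T3, t3, b3, q3, k3⟩ := t2.free_leg hP hk anch2 Sb {P a, b} X (fun z hz => ⟨(X1 z hz).1,
    (cn P S2).trans' ((cn P S2).symm' c_ab) (X1 z hz).2⟩) (by
      rw [cX, Finset.card_pair hub]; norm_num)
    (fun w hw => by
      rcases Finset.mem_insert.1 hw with rfl | hw
      · exact c_bu
      · rw [Finset.mem_singleton.1 hw]) (by simp)
  have u3 := k3 (P a) (by simp) u2
  obtain ⟨w, hw, hwn⟩ : ∃ w, T3 w = w ∧ w ∉ ({P a, b} : Finset (Fin n)) := by
    by_contra! hall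
    have h1 : fx T3 ≤ ({P a, b} : Finset (Fin n)).card :=
      Finset.card_le_card fun z hz => hall z (by simpa using hz)
    rw [Finset.card_pair hub] at h1
    have := t3.tree.fix
    omega
  rw [Finset.mem_insert, Finset.mem_singleton, not_or] at hwn
  have Tx : T3 x = y := by
    have : S2 x = y := sw_left Sx
    rw [t3.sub x (by rw [this]; exact fun h' => hay hax h'.symm), this]
  have Td : T3 d = a := by
    have : S2 d = a := by
      rw [hS2, sw_ne Sx Sy (big_d xb).symm (big_d yb).symm, Sd]
    rw [t3.sub d (by rw [this]; exact hne.symm), this]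
  have Ty : T3 y = x := by rw [← Tx, invol_apply t3.tree.inv]
  obtain ⟨j1, j2⟩ := t3.tree.jump hP hd Td hne u3 hw b3 hwn.1 hub.symm hwn.2 (by
    have s1 := oc_apply (swap (P a) w * (T3 * P)) (P a)
    have r1 : (swap (P a) w * (T3 * P)) (P a) = y := by
      rw [Perm.mul_apply, Perm.mul_apply, ← hx, Tx,
        swap_apply_of_ne_of_ne (hay haP).symm]
      rintro rfl
      exact hay hax (Ty.symm.trans hw)
    have s2 := oc_apply (swap (P a) w * (T3 * P)) y
    have r2 : (swap (P a) w * (T3 * P)) y = b := by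
      rw [Perm.mul_apply, Perm.mul_apply, Py, b3, swap_apply_of_ne_of_ne hub.symm (Ne.symm hwn.2)]
    rw [r1] at s1
    rw [r2] at s2
    exact (oc _).symm' ((oc _).trans' s1 s2))
  refine ⟨_, j1, sw_left (cut_left Td), (((q1.trans q2).trans q3).trans j2)⟩

end NormalLeaf

section Final
variable {n : ℕ} {P : Perm (Fin n)} {k : ℕ} {f g : Surf n} {d a : Fin n}

theorem Good.conn_conj (hf : Good P k f) (hg : Good P k g) (ht : oc (g R * P) = ⊤)
    {σ : Perm (Fin n)} (hσ : ∀ z, σ (P z) = P (σ z)) (hR : ∀ z, σ (f R z) = g R (σ z)) :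
    Conn 1 f g := by
  have h1 : σ * P * σ⁻¹ = P := by
    rw [mul_inv_eq_iff_eq_mul]; ext1 z; exact hσ z
  have h2 : conjS σ f R = g R := by
    rw [conjS, mul_inv_eq_iff_eq_mul]; ext1 z; exact hR z
  have h3 := hf.conj σ
  rw [h1] at h3
  have := h3.same_R hg (by rw [h2]; exact ht) h2
  exact (Conn.iso 0 f σ).trans this

theorem Good.conn_of_small (hf : Good P k f) (hg : Good P k g) (hP : Prof P k) (hk : 3 ≤ k)
    (tf : PTree P k (f R)) (tg : PTree P k (g R)) (hPP : ∀ z, P (P z) = z) : Conn 1 f g := by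
  have leg : ∀ {T}, PTree P k T → ∃ e, T e = e := fun {T} h => by
    have h1 : 0 < fx T := by have := h.fix; omega
    obtain ⟨e, he⟩ := Finset.card_pos.1 h1
    exact ⟨e, by simpa using he⟩
  have con : ∀ {T}, PTree P k T → ∀ e, ∀ A : Set (Fin n), e ∈ A →
      (∀ z ∈ A, z ∈ Set.univ → P z ∈ A ∧ T z ∈ A) → Set.univ ⊆ A := fun {T} h e A he hA z _ =>
    cn_ind (x := e) (by rw [h.con]; trivial) he fun w hw => hA w hw trivial
  obtain ⟨e, he⟩ := leg tf
  obtain ⟨e', he'⟩ := leg tg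
  obtain ⟨σ, -, h2, -⟩ := exists_dihedral_conj (D := Set.univ) (p := P) (r := f R) (r' := g R)
    (fun z _ => ⟨trivial, hPP z⟩) (fun z _ => ⟨trivial, invol_apply tf.inv z⟩)
    (fun z _ => ⟨trivial, invol_apply tg.inv z⟩) trivial he trivial he' (con tf e) (con tg e')
  exact hf.conn_conj hg (tg.trans hP) (fun z => (h2 z trivial).2.1) fun z => (h2 z trivial).2.2

theorem Prof.sq_of_no_leaf (hP : Prof P k) (hk : k ≤ 4) (hd : ∀ d, P d ≠ d) (z : Fin n) :
    P (P z) = z := by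
  by_contra hz
  have h1 := wt_big hz
  have h2 := Finset.single_le_sum (fun x _ => wt_nonneg (hd x)) (Finset.mem_univ z)
  rw [hP.sum_wt] at h2
  have h3 : (k : ℚ) ≤ 4 := by exact_mod_cast hk
  linarith

theorem Prof.sq_of_three (hP : Prof P k) (hk : k ≤ 3) (z : Fin n) : P (P z) = z := by
  by_contra hz
  have := hP.card_odd (three P z) fun x hx => Or.inl (three_big hz hx)
  rw [three_card hz] at this
  omega

theorem Good.normal_four (hf : Good P 4 f) (hP : Prof P 4) (tf : PTree P 4 (f R)) (hd : P d = d)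
    (ha : P (P a) ≠ a) (hall : ∀ z, P (P z) ≠ z → z ∈ three P a) :
    ∃ f', Good P 4 f' ∧ PTree P 4 (f' R) ∧ f' R d = a ∧ f' R (P a) = P a ∧ Conn 12 f f' := by
  obtain ⟨f1, g1, t1, b1, c1⟩ := hf.slide hP tf le_rfl hd
  obtain ⟨T, t2, e2, q2⟩ := t1.rotate (b := a) hd rfl ((oc P).symm' (three_oc (hall _ b1)))
  have hP1 : P a ≠ a := fun h' => ha (by rw [h', h'])
  have hda : d ≠ a := by rintro rfl; exact hP1 hd
  have hdu : d ≠ P a := fun h => hda (P.injective (hd.trans h))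
  have hTa : T a = d := by rw [← e2, invol_apply t2.inv]
  have hdT : d ≠ T (P a) := fun h => hP1 (T.injective (h.symm.trans hTa.symm))
  obtain ⟨T', t3, q3, u3, keep⟩ := t2.make_leg hP (P a) hd ha fun _ => by
    have := le_sup_right (a := oc P) (oc_apply (swap (P a) (T (P a)) * T) d)
    rwa [cut_ne t2.inv rfl hdu hdT, e2] at this
  obtain ⟨f2, g2, R2, c2⟩ := (q2.trans q3) f1 g1 rfl
  refine ⟨f2, g2, by rw [R2]; exact t3, ?_, by rw [R2]; exact u3, c1.trans c2⟩
  rw [R2, keep d (by rw [e2]; exact hda.symm) hdu hdT, e2]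

theorem Good.conn_four (hf : Good P 4 f) (hg : Good P 4 g) (hP : Prof P 4)
    (tf : PTree P 4 (f R)) (tg : PTree P 4 (g R)) (hd : P d = d) : Conn 25 f g := by
  classical
  obtain ⟨a, ha⟩ := hP.exists_big le_rfl hd
  have hP1 : P a ≠ a := fun h' => ha (by rw [h', h'])
  have hall : ∀ z, P (P z) ≠ z → z ∈ three P a := fun z hz => by
    by_contra hza
    have hd3 : d ∉ three P a := fun h' => three_big ha h' (by rw [hd, hd])
    have hdz : d ≠ z := by rintro rfl; exact hz (by rw [hd, hd])
    have := hP.card_odd (insert d (insert z (three P a))) fun x hx => by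
      simp only [Finset.mem_insert] at hx
      rcases hx with rfl | rfl | hx
      · exact Or.inr hd
      · exact Or.inl hz
      · exact Or.inl (three_big ha hx)
    rw [Finset.card_insert_of_notMem (by simp [hd3, hdz]), Finset.card_insert_of_notMem hza,
      three_card ha] at this
    omega
  obtain ⟨u, hu⟩ : ∃ u, P a = u := ⟨_, rfl⟩
  obtain ⟨v, hv⟩ : ∃ v, P u = v := ⟨_, rfl⟩
  have three_eq : three P a = {a, u, v} := by rw [three, hu, hv]
  have va : v ≠ a := by rwa [hu, hv] at ha
  have ua : u ≠ a := by rwa [hu] at hP1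
  have uv : u ≠ v := fun h => ua (P.injective (hu.trans (h.trans hv.symm))).symm
  have Pv : P v = a := by
    have := hall (P v) (by
      rw [← hv, ← hu]
      exact fun h => ha (P.injective (P.injective (P.injective h))))
    rw [three_eq] at this
    simp only [Finset.mem_insert, Finset.mem_singleton] at this
    rcases this with h | h | h
    · exact h
    · exact absurd (P.injective (h.trans hu.symm)) va
    · exact absurd (P.injective (h.trans hv.symm)) uv.symm
  have Pother : ∀ z, z ≠ a → z ≠ u → z ≠ v → P (P z) = z := fun z h1 h2 h3 => by
    by_contra h
    have := hall z h
    rw [three_eq] at this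
    simp [h1, h2, h3] at this
  obtain ⟨f1, gf, sf, fd, fu, cf⟩ := hf.normal_four hP tf hd ha hall
  obtain ⟨f2, gg, sg, gd, gu, cg⟩ := hg.normal_four hP tg hd ha hall
  rw [hu] at fu gu
  have hda : d ≠ a := by rintro rfl; exact hP1 hd
  have hdu : d ≠ u := by rintro rfl; exact hda (P.injective (hd.trans hu.symm))
  have hdv : d ≠ v := by rintro rfl; exact hdu (P.injective (hd.trans hv.symm))
  set p := swap a u * P with hp
  have pu : p u = v := by rw [hp, Perm.mul_apply, hv, swap_apply_of_ne_of_ne va uv.symm]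
  have pv : p v = u := by rw [hp, Perm.mul_apply, Pv, swap_apply_left]
  have po : ∀ z, z ≠ a → z ≠ v → p z = P z := fun z h1 h2 => by
    rw [hp, Perm.mul_apply, swap_apply_of_ne_of_ne]
    · exact fun h => h2 (P.injective (h.trans Pv.symm))
    · exact fun h => h1 (P.injective (h.trans hu.symm))
  set D : Set (Fin n) := {z | z ≠ d ∧ z ≠ a} with hD
  have uD : u ∈ D := ⟨hdu.symm, ua⟩
  have vD : v ∈ D := ⟨hdv.symm, va⟩
  have PD : ∀ z ∈ D, z ≠ u → z ≠ v → P z ∈ D ∧ P z ≠ u ∧ P z ≠ v := fun z hz h1 h2 =>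
    ⟨⟨fun h => hz.1 (P.injective (h.trans hd.symm)), fun h => h2 (P.injective (h.trans Pv.symm))⟩,
      fun h => hz.2 (P.injective (h.trans hu.symm)), fun h => h1 (P.injective (h.trans hv.symm))⟩
  have hpD : ∀ z ∈ D, p z ∈ D ∧ p (p z) = z := fun z hz => by
    by_cases h1 : z = u
    · subst h1; rw [pu, pv]; exact ⟨vD, rfl⟩
    by_cases h2 : z = v
    · subst h2; rw [pv, pu]; exact ⟨uD, rfl⟩
    obtain ⟨q1, q2, q3⟩ := PD z hz h1 h2
    rw [po z hz.2 h2, po _ q1.2 q3]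
    exact ⟨q1, Pother z hz.2 h1 h2⟩
  have hrD : ∀ {T : Perm (Fin n)}, PTree P 4 T → T d = a → ∀ z ∈ D, T z ∈ D ∧ T (T z) = z :=
    fun {T} h hTd z hz => ⟨⟨fun h' => hz.2 (T.injective (h'.trans (by
      rw [← hTd, invol_apply h.inv]))), fun h' => hz.1 (T.injective (h'.trans hTd.symm))⟩,
      invol_apply h.inv z⟩
  have con : ∀ {T : Perm (Fin n)}, PTree P 4 T → T d = a → ∀ A : Set (Fin n), u ∈ A →
      (∀ z ∈ A, z ∈ D → p z ∈ A ∧ T z ∈ A) → D ⊆ A := fun {T} h hTd A hA hc z hz => by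
    have := cn_ind (P := P) (T := T) (x := u) (y := z) (by rw [h.con]; trivial)
      (A := {w | w ∈ A ∨ w = d ∨ w = a}) (Or.inl hA) fun w hw => by
        by_cases w1 : w = d
        · rw [w1, hd, hTd]; exact ⟨Or.inr (Or.inl rfl), Or.inr (Or.inr rfl)⟩
        by_cases w2 : w = a
        · rw [w2, hu, ← hTd, invol_apply h.inv]; exact ⟨Or.inl hA, Or.inr (Or.inl rfl)⟩
        have wA : w ∈ A := by
          rcases hw with h' | h' | h'
          exacts [h', absurd h' w1, absurd h' w2]
        obtain ⟨k1, k2⟩ := hc w wA ⟨w1, w2⟩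
        refine ⟨?_, Or.inl k2⟩
        by_cases w3 : w = v
        · rw [w3, Pv]; exact Or.inr (Or.inr rfl)
        · rw [← po w w2 w3]; exact Or.inl k1
    rcases this with h' | h' | h'
    · exact h'
    · exact absurd h' hz.1
    · exact absurd h' hz.2
  obtain ⟨σ, o1, o2, o3⟩ := exists_dihedral_conj hpD (hrD sf fd) (hrD sg gd) uD fu uD gu
    (con sf fd) (con sg gd)
  have σd : σ d = d := o1 d fun h => h.1 rfl
  have σa : σ a = a := o1 a fun h => h.2 rfl
  have σv : σ v = v := by
    have := (o2 u uD).2.1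
    rwa [pu, o3, pu] at this
  have hσ : ∀ z, σ (P z) = P (σ z) := fun z => by
    by_cases z1 : z = d
    · rw [z1, σd, hd, σd]
    by_cases z2 : z = a
    · rw [z2, σa, hu, o3]
    by_cases z3 : z = v
    · rw [z3, σv, Pv, σa]
    have := o2 z ⟨z1, z2⟩
    rw [← po z z2 z3, this.2.1, po _ this.1.2]
    exact fun h => z3 (σ.injective (h.trans σv.symm))
  have hR : ∀ z, σ (f1 R z) = f2 R (σ z) := fun z => by
    by_cases z1 : z = d
    · rw [z1, σd, fd, gd, σa]
    by_cases z2 : z = a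
    · rw [z2, σa, ← fd, invol_apply sf.inv, fd, ← gd, invol_apply sg.inv, σd]
    exact (o2 z ⟨z1, z2⟩).2.2
  exact (cf.trans (gf.conn_conj gg (sg.trans hP) hσ hR)).trans (cg.symm hg.inv)

theorem Good.conn_of_trees (hf : Good P k f) (hg : Good P k g) (hP : Prof P k)
    (tf : PTree P k (f R)) (tg : PTree P k (g R)) : Conn (943 * k) f g := by
  have h3 := hP.card_odd ∅ (by simp)
  rw [Finset.card_empty] at h3
  by_cases hd : ∃ d, P d = d
  · obtain ⟨d, hd⟩ := hd
    rcases lt_or_ge k 4 with hk | hk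
    · exact (hf.conn_of_small hg hP (by omega) tf tg (hP.sq_of_three (by omega))).mono (by omega)
    rcases eq_or_lt_of_le hk with rfl | hk
    · exact (hf.conn_four hg hP tf tg hd).mono (by omega)
    obtain ⟨a, ha⟩ := hP.exists_big (by omega) hd
    have key : ∀ {f : Surf n}, Good P k f → PTree P k (f R) →
        ∃ f', Good P k f' ∧ PTree P k (f' R) ∧ f' R d = a ∧ Conn 105 f f' := fun {f} hf tf => by
      obtain ⟨f1, g1, t1, b1, c1⟩ := hf.slide hP tf (by omega) hd
      obtain ⟨T, t2, e2, q2⟩ := t1.move_leaf hP hk hd rfl b1 ha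
      obtain ⟨f2, g2, R2, c2⟩ := q2 f1 g1 rfl
      exact ⟨f2, g2, by rw [R2]; exact t2, by rw [R2, e2], c1.trans c2⟩
    obtain ⟨f1, gf, sf, fd, cf⟩ := key hf tf
    obtain ⟨f2, gg, sg, gd, cg⟩ := key hg tg
    have hda : d ≠ a := by rintro rfl; exact ha (by rw [hd, hd])
    have i1 : (1 : Perm (Fin n)) d = d := rfl
    have i2 : (1 : Perm (Fin n)) a = a := rfl
    have sub : ∀ {T : Perm (Fin n)}, PTree P k T → T d = a → TreeOver P k (swap d a * 1) T :=
      fun h he => ⟨h, SubInv.add h.inv (fun z hz => absurd rfl hz) i1 i2 he⟩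
    have := gf.conn_of_sub gg hP hk (L := swap d a * 1)
      ⟨sw_invol (one_mul 1) i1 i2, fun d' hd' => by
        rw [hP.leaf_unique hd' hd, sw_left i1]; exact ⟨hda.symm, ha⟩⟩
      (fun z hz => by
        rw [sw_ne i1 i2]
        · rfl
        · rintro rfl; exact hz.1 hd
        · rintro rfl; exact ha hz.2) (sub sf fd) (sub sg gd)
    exact ((cf.trans this).trans (cg.symm hg.inv)).mono (by omega)
  · push Not at hd
    rcases le_or_gt k 4 with hk | hk
    · exact (hf.conn_of_small hg hP (by omega) tf tg (hP.sq_of_no_leaf hk hd)).mono (by omega)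
    have sub : ∀ {T : Perm (Fin n)}, PTree P k T → TreeOver P k 1 T :=
      fun h => ⟨h, fun z hz => absurd rfl hz⟩
    exact (hf.conn_of_sub hg hP hk (L := 1) ⟨one_mul 1, fun d h => absurd h (hd d)⟩
      (fun _ _ => rfl) (sub tf) (sub tg)).mono (by omega)

theorem Good.conn (hf : Good P k f) (hg : Good P k g) (hP : Prof P k) (hk : 1 ≤ k) :
    Conn (969 * k) f g := by
  obtain ⟨f1, gf, cf, of⟩ := hf.to_pathLike hP hk
  obtain ⟨f2, gg, cg, og⟩ := hg.to_pathLike hP hk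
  have := gf.conn_of_trees gg hP (gf.tree hP of) (gg.tree hP og)
  exact ((cf.trans this).trans (cg.symm hg.inv)).mono (by omega)

end Final

end ShearConnectivity

/-- There is a constant `C > 0` such that any two square-tiled
surfaces with the same spherical profile `(μ, k)`, `k ≥ 1` and `μ_1 ≤ 1`, are
connected by at most `C·k` powers of cylinder shears, up to isomorphism. -/
theorem stmt15 :
    ∃ C : ℕ, 0 < C ∧
      ∀ (n : ℕ) (τ τ' : Surf n) (μ : ℕ → ℕ) (k : ℕ),
        IsSTS n τ → IsSTS n τ' →
        HasProfile τ μ k → HasProfile τ' μ k →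
        (∑ i ∈ Finset.Icc 1 n, (μ i : ℤ) * ((i : ℤ) - 2)) = (k : ℤ) - 4 →
        1 ≤ k → μ 1 ≤ 1 →
        ∃ (L : ℕ) (f'' : Surf n),
          L ≤ C * k ∧ ShearPowSeq n L τ f'' ∧ Isomorphic n τ' f'' := by
  refine ⟨969, by norm_num, fun n τ τ' μ k hτ hτ' hp hp' hs hk hμ => ?_⟩
  have g := hτ.good hp
  have g' := hτ'.good hp'
  have hP : Prof (prodRGB τ) k := by
    refine ⟨?_, ?_⟩
    · rw [profile_sum τ μ k hp] at hs; omega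
    · have := hp.1 1 le_rfl
      rw [cycleCount, if_pos rfl] at this
      exact this.trans_le hμ
  obtain ⟨σ, hσ⟩ := isConj_iff.1
    (Equiv.Perm.isConj_iff_cycleType_eq.2 (cycleType_eq τ' τ μ k hp' hp))
  have g'' := g'.conj σ
  rw [hσ] at g''
  have c := g.conn g'' hP hk
  obtain ⟨L, f'', h1, h2, ρ, h3⟩ := c.final hτ.2.1
  refine ⟨L, f'', h1, h2, ρ * σ, fun X => ?_⟩
  rw [h3 X, conjS]; group
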